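/- Let m ≥ 2 be an integer. There exists an integer k₀, depending only on m and independent of q, such that for every prime power q and every admissible k-tuple {h₁, …, h_k} of distinct polynomials in 𝔽_q[t] with k ≥ k₀, there are infinitely many f ∈ 𝔽_q[t] (for every N there is such an f of degree greater than N) such that at least m of the polynomials f + h₁, …, f + h_k are prime. -/

import Mathlib

open Polynomial

/-- A polynomial over a finite field is "prime" if it is monic and irreducible. -/
def IsPrimePoly {F : Type} [Field F] (P : Polynomial F) : Prop :=
  P.Monic ∧ Irreducible P

/-- An admissible tuple of distinct polynomials. -/
def AdmissibleTuple {F : Type} [Field F] {k : ℕ} (h : Fin k → Polynomial F) : Prop :=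
  Function.Injective h ∧
    ∀ p : Polynomial F, IsPrimePoly p →
      ∃ r : Polynomial F ⧸ Ideal.span {p},
        ∀ i, Ideal.Quotient.mk (Ideal.span {p}) (h i) ≠ r

/-- A Kummer criterion: if the field contains the `s`-th roots of unity and `a` is not a proper
`d`-th power for any `d ∣ s`, then `X ^ s - a` is irreducible. -/
theorem irreducible_X_pow_sub_C_of_isPrimitiveRoot {L : Type*} [Field L] {s : ℕ} (hs : 0 < s)
    {ζ : L} (hζ : IsPrimitiveRoot ζ s) {a : L} (ha : a ≠ 0)
    (hpow : ∀ d, d ∣ s → ∀ u : L, u ^ d = a → d = 1) :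
    Irreducible (X ^ s - C a : L[X]) := by
  let Ω := AlgebraicClosure L
  obtain ⟨α, hα⟩ := IsAlgClosed.exists_pow_nat_eq (algebraMap L Ω a) hs
  have hα0 : α ≠ 0 := by
    rintro rfl
    rw [zero_pow hs.ne'] at hα
    exact ha ((map_eq_zero _).1 hα.symm)
  have hintegral : IsIntegral L α := (IsAlgClosure.isAlgebraic.isAlgebraic α).isIntegral
  have hdvd : minpoly L α ∣ X ^ s - C a := minpoly.dvd _ _ (by simp [hα])
  set μ := minpoly L α with hμ
  have hζ' : IsPrimitiveRoot (algebraMap L Ω ζ) s := hζ.map_of_injective (algebraMap L Ω).injective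
  have hroot : ∀ β ∈ (μ.map (algebraMap L Ω)).roots, β / α ∈ (algebraMap L Ω).fieldRange := by
    intro β hβ
    have h1 : (μ.map (algebraMap L Ω)).eval β = 0 := (mem_roots'.1 hβ).2
    have h2 : β ^ s = algebraMap L Ω a := by
      obtain ⟨r, hr⟩ := hdvd
      have := congrArg (fun p => (p.map (algebraMap L Ω)).eval β) hr
      simp only [Polynomial.map_mul, eval_mul, h1, zero_mul] at this
      simpa [sub_eq_zero] using this
    have h3 : (β / α) ^ s = 1 := by
      rw [div_pow, h2, hα, div_self]
      exact (_root_.map_ne_zero _).2 ha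
    have : NeZero s := ⟨hs.ne'⟩
    obtain ⟨i, -, hi⟩ := hζ'.eq_pow_of_pow_eq_one h3
    exact ⟨ζ ^ i, by simp [hi]⟩
  have hprod : ∀ m : Multiset Ω, (∀ β ∈ m, β / α ∈ (algebraMap L Ω).fieldRange) →
      m.prod / α ^ m.card ∈ (algebraMap L Ω).fieldRange := by
    intro m
    induction m using Multiset.induction_on with
    | empty => intro _; simp
    | cons b m ih =>
      intro h
      have := mul_mem (h b (by simp)) (ih fun β hβ => h β (by simp [hβ]))
      rw [Multiset.prod_cons, Multiset.card_cons, pow_succ']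
      rwa [div_mul_div_comm] at this
  have hsplit : (μ.map (algebraMap L Ω)).Splits := IsAlgClosed.splits _
  have hmon : μ.Monic := minpoly.monic hintegral
  set t := μ.natDegree with ht
  have hcard : (μ.map (algebraMap L Ω)).roots.card = t := by
    rw [← hsplit.natDegree_eq_card_roots, natDegree_map]
  have hp := hprod _ hroot
  rw [hcard] at hp
  have hcoeff : (μ.map (algebraMap L Ω)).roots.prod ∈ (algebraMap L Ω).fieldRange := by
    have h1 := hsplit.coeff_zero_eq_prod_roots_of_monic (hmon.map _)
    have h2 : (μ.map (algebraMap L Ω)).roots.prod =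
        (-1) ^ (μ.map (algebraMap L Ω)).natDegree * (μ.map (algebraMap L Ω)).coeff 0 := by
      rw [h1, ← mul_assoc, ← mul_pow]; norm_num
    rw [h2, coeff_map]
    exact mul_mem (pow_mem (neg_mem (one_mem _)) _) ⟨_, rfl⟩
  have hne : (μ.map (algebraMap L Ω)).roots.prod ≠ 0 := by
    intro h0
    have : (0 : Ω) ∈ (μ.map (algebraMap L Ω)).roots := Multiset.prod_eq_zero_iff.1 h0
    obtain ⟨r, hr⟩ := hdvd
    have h1 := (mem_roots'.1 this).2
    have h2 := congrArg (fun p => (p.map (algebraMap L Ω)).eval 0) hr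
    rw [IsRoot] at h1
    simp only [Polynomial.map_mul, eval_mul, h1, zero_mul] at h2
    simp [hs.ne', ha] at h2
  have hαt : α ^ t ∈ (algebraMap L Ω).fieldRange := by
    have := div_mem hcoeff hp
    rwa [div_div_cancel₀ hne] at this
  have hαs : α ^ s ∈ (algebraMap L Ω).fieldRange := ⟨a, hα.symm⟩
  have hαg : α ^ (Nat.gcd t s) ∈ (algebraMap L Ω).fieldRange := by
    have h := Nat.gcd_eq_gcd_ab t s
    have : α ^ (Nat.gcd t s) = (α ^ t) ^ (Nat.gcdA t s) * (α ^ s) ^ (Nat.gcdB t s) := by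
      rw [← zpow_natCast, h, zpow_add₀ hα0, zpow_mul, zpow_mul, zpow_natCast, zpow_natCast]
    rw [this]
    exact mul_mem (zpow_mem hαt _) (zpow_mem hαs _)
  obtain ⟨u, hu⟩ := hαg
  obtain ⟨e, he⟩ := Nat.gcd_dvd_right t s
  have h1 : e = 1 := by
    refine hpow e ⟨_, by rw [mul_comm]; exact he⟩ u ?_
    apply (algebraMap L Ω).injective
    rw [map_pow, hu, ← pow_mul, ← he, hα]
  have hst : s ∣ t := by
    rw [h1, mul_one] at he
    rw [he]; exact Nat.gcd_dvd_left t s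
  have hμX : μ = X ^ s - C a := by
    symm
    refine Polynomial.eq_of_monic_of_dvd_of_natDegree_le hmon (monic_X_pow_sub_C a hs.ne') hdvd ?_
    rw [natDegree_X_pow_sub_C]
    exact Nat.le_of_dvd (minpoly.natDegree_pos hintegral) hst
  rw [← hμX]
  exact minpoly.irreducible hintegral

/-- Degree bound for the Sylvester resultant of two polynomials in two variables. -/
theorem natDegree_resultant_le {R : Type*} [CommRing R] (f g : R[X][X]) (m n a b : ℕ)
    (hf : ∀ i, (f.coeff i).natDegree ≤ a) (hg : ∀ i, (g.coeff i).natDegree ≤ b) :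
    (resultant f g m n).natDegree ≤ n * a + m * b := by
  rw [resultant, Matrix.det_apply]
  refine natDegree_sum_le_of_forall_le _ _ fun σ _ => ?_
  have key : ∀ i j, (sylvester f g m n i j).natDegree ≤
      j.addCases (motive := fun _ => ℕ) (fun _ => b) (fun _ => a) := by
    intro i j
    refine Fin.addCases (fun j₁ => ?_) (fun j₁ => ?_) j
    · simp only [sylvester, Matrix.of_apply, Fin.addCases_left]
      split_ifs
      · exact hg _
      · simp
    · simp only [sylvester, Matrix.of_apply, Fin.addCases_right]
      split_ifs
      · exact hf _
      · simp
  have h2 : (∏ i, sylvester f g m n (σ i) i).natDegree ≤ n * a + m * b := by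
    refine (natDegree_prod_le _ _).trans ?_
    refine (Finset.sum_le_sum fun i _ => key (σ i) i).trans ?_
    rw [Fin.sum_univ_add]
    simp [add_comm]
  rcases Int.units_eq_one_or (Equiv.Perm.sign σ) with h | h <;> simpa [h] using h2

theorem FiniteField.exists_isPrimitiveRoot {K : Type*} [Field K] [Fintype K] {s g : ℕ}
    (hsg : s * g = Fintype.card K - 1) : ∃ ζ : K, IsPrimitiveRoot ζ s := by
  classical
  obtain ⟨γ, hγ⟩ := IsCyclic.exists_ofOrder_eq_natCard (α := Kˣ)
  have h1 : orderOf γ = g * s := by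
    rw [hγ, Nat.card_eq_fintype_card, Fintype.card_units, mul_comm, hsg]
  have hpos : 0 < orderOf γ := orderOf_pos γ
  have h2 : IsPrimitiveRoot (γ : K) (g * s) := by
    rw [← h1]
    exact IsPrimitiveRoot.coe_units_iff.2 (IsPrimitiveRoot.orderOf γ)
  exact ⟨_, h2.pow (by omega) rfl⟩

theorem irreducible_X_pow_sub_C_ratFunc {K : Type*} [Field K] [Fintype K] {s g : ℕ} (hs : 0 < s)
    (hsg : s * g = Fintype.card K - 1) {F : K[X]} (hF : F ≠ 0)
    (hmult : ∀ d, d ∣ s → (∀ θ, d ∣ F.rootMultiplicity θ) → d = 1) {c : K} (hc : c ≠ 0) :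
    Irreducible (X ^ s - C (algebraMap K[X] (RatFunc K) (C c) / algebraMap K[X] (RatFunc K) F)
      : (RatFunc K)[X]) := by
  classical
  obtain ⟨ζ, hζ⟩ := FiniteField.exists_isPrimitiveRoot hsg
  have hinj : Function.Injective (algebraMap K[X] (RatFunc K)) := IsFractionRing.injective _ _
  have hF' : algebraMap K[X] (RatFunc K) F ≠ 0 := by
    rwa [Ne, map_eq_zero_iff _ hinj]
  have hc' : algebraMap K[X] (RatFunc K) (C c) ≠ 0 := by
    rw [Ne, map_eq_zero_iff _ hinj]; simpa using hc
  refine irreducible_X_pow_sub_C_of_isPrimitiveRoot hs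
    (hζ.map_of_injective (algebraMap K (RatFunc K)).injective) (div_ne_zero hc' hF') ?_
  intro d hd u hu
  refine hmult d hd fun θ => ?_
  obtain ⟨A, B, hB, rfl⟩ := IsFractionRing.div_surjective (A := K[X]) u
  have hB0 : B ≠ 0 := nonZeroDivisors.ne_zero hB
  have hB' : algebraMap K[X] (RatFunc K) B ≠ 0 := by
    rwa [Ne, map_eq_zero_iff _ hinj]
  rw [div_pow, div_eq_div_iff (pow_ne_zero _ hB') hF', ← map_pow, ← map_pow, ← map_mul,
    ← map_mul] at hu
  have h1 := hinj hu
  have hne : C c * B ^ d ≠ 0 := mul_ne_zero (by simpa using hc) (pow_ne_zero _ hB0)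
  have h2 := congrArg (rootMultiplicity θ) h1
  rw [rootMultiplicity_mul (h1 ▸ hne), rootMultiplicity_mul hne, rootMultiplicity_C, zero_add] at h2
  have hpow : ∀ P : K[X], d ∣ rootMultiplicity θ (P ^ d) := by
    intro P
    rw [← count_roots, roots_pow, Multiset.count_nsmul]
    exact dvd_mul_right _ _
  exact (Nat.dvd_add_right (hpow A)).1 (h2 ▸ hpow B)

/-- Nonvanishing step in Stepanov's method. -/
theorem stepanov_nonvanishing {K : Type*} [Field K] [Fintype K] {s g m B : ℕ} (hs : 0 < s)
    (hsg : s * g = Fintype.card K - 1) {F : K[X]} (hF : F ≠ 0) (hm : F.natDegree ≤ m)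
    (hmult : ∀ d, d ∣ s → (∀ θ, d ∣ F.rootMultiplicity θ) → d = 1)
    {a : K} (ha : F.eval a ≠ 0) (hB : s * B + s * m < Fintype.card K)
    (k : Fin s → K[X]) (hk : ∀ j, (k j).natDegree ≤ B)
    (hdvd : (X - C a) ^ Fintype.card K ∣ ∑ j, k j * F ^ (g * j)) : k = 0 := by
  classical
  set Q := Fintype.card K with hQ
  have hQ1 : 1 < Q := Fintype.one_lt_card
  obtain ⟨p, hp⟩ := CharP.exists K
  have hpp : Fact p.Prime := ⟨CharP.char_is_prime K p⟩
  obtain ⟨r, -, hr⟩ := FiniteField.card K p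
  by_contra hk0
  set f0 := F.eval a
  -- the two-variable polynomials
  let P : K[X][X] := C F * X ^ s - C (C f0)
  let Y : K[X][X] := ∑ j : Fin s, monomial (j : ℕ) (k j)
  have hYcoeff : ∀ i, Y.coeff i = if h : i < s then k ⟨i, h⟩ else 0 := by
    intro i
    simp only [Y, finsetSum_coeff, coeff_monomial]
    split_ifs with h
    · rw [Finset.sum_eq_single ⟨i, h⟩]
      · simp
      · intro b _ hb
        rw [if_neg]
        intro h'; exact hb (Fin.ext h')
      · simp
    · apply Finset.sum_eq_zero
      intro b _
      rw [if_neg]; intro h'; exact h (h' ▸ b.2)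
  have hY0 : Y ≠ 0 := by
    intro h
    apply hk0
    ext1 j
    have := hYcoeff j
    rw [h] at this
    simpa using this.symm
  have hYdeg : Y.natDegree ≤ s := by
    refine natDegree_sum_le_of_forall_le _ _ fun j _ => (natDegree_monomial_le _).trans j.2.le
  have hYdeg' : Y.natDegree < s := by
    rw [natDegree_lt_iff_degree_lt hY0, degree_lt_iff_coeff_zero]
    intro i hi
    rw [hYcoeff, dif_neg (by omega)]
  have hPdeg : P.natDegree = s := by
    simp only [P]
    rw [natDegree_sub_C, natDegree_C_mul_X_pow _ _ hF]
  let φ := algebraMap K[X] (RatFunc K)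
  have hinj : Function.Injective φ := IsFractionRing.injective _ _
  have hφF : φ F ≠ 0 := by rwa [Ne, map_eq_zero_iff _ hinj]
  have hirr := irreducible_X_pow_sub_C_ratFunc hs hsg hF hmult (c := f0) ha
  have hPmap : P.map φ = C (φ F) * (X ^ s - C (φ (C f0) / φ F)) := by
    simp only [P, Polynomial.map_sub, Polynomial.map_mul, map_C, Polynomial.map_pow, map_X,
      mul_sub, ← C_mul, mul_div_cancel₀ _ hφF]
  have hPirr : Irreducible (P.map φ) := by
    rw [hPmap]
    exact (irreducible_isUnit_mul (isUnit_C.2 (isUnit_iff_ne_zero.2 hφF))).2 hirr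
  have hcop : IsCoprime (Y.map φ) (P.map φ) := by
    refine ((hPirr.coprime_iff_not_dvd).2 fun h => ?_).symm
    have := natDegree_le_of_dvd h ((Polynomial.map_ne_zero_iff hinj).2 hY0)
    rw [natDegree_map_eq_of_injective hinj, natDegree_map_eq_of_injective hinj, hPdeg] at this
    omega
  have hres : resultant Y P ≠ 0 := by
    intro h
    have h1 : resultant (Y.map φ) (P.map φ) = 0 := by
      rw [natDegree_map_eq_of_injective hinj, natDegree_map_eq_of_injective hinj,
        resultant_map_map, h, map_zero]
    exact (resultant_eq_zero_iff.1 h1).2 hcop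
  obtain ⟨u, v, -, -, huv⟩ := exists_mul_add_mul_eq_C_resultant (m := Y.natDegree)
    (n := P.natDegree) Y P le_rfl le_rfl (Or.inr (by omega))
  have hdeg : (resultant Y P).natDegree ≤ P.natDegree * B + Y.natDegree * m := by
    refine natDegree_resultant_le _ _ _ _ _ _ ?_ ?_
    · intro i
      rw [hYcoeff]
      split_ifs
      · exact hk _
      · simp
    · intro i
      simp only [P, coeff_sub, coeff_C_mul, coeff_X_pow, coeff_C]
      refine (natDegree_sub_le _ _).trans (max_le ?_ ?_)
      · split_ifs <;> simp [hm]
      · split_ifs <;> simp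
  have hdvd2 : (X - C a) ^ Q ∣ F * (F ^ g) ^ s - C f0 := by
    have h1 : F * (F ^ g) ^ s = F ^ Q := by
      rw [← pow_mul, mul_comm g s, hsg, ← pow_succ']
      congr 1; omega
    have h2 : (C f0 : K[X]) = (C f0) ^ Q := by
      rw [← C_pow, FiniteField.pow_card]
    rw [h1, h2, hQ, hr, ← sub_pow_char_pow]
    exact pow_dvd_pow_of_dvd (dvd_iff_isRoot.2 (by simp [f0])) _
  have hR : (X - C a) ^ Q ∣ resultant Y P := by
    have h1 := congrArg (eval (F ^ g)) huv
    rw [eval_add, eval_mul, eval_mul, eval_C] at h1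
    rw [← h1]
    refine dvd_add (Dvd.dvd.mul_right ?_ _) (Dvd.dvd.mul_right ?_ _)
    · simpa [Y, eval_finsetSum, ← pow_mul] using hdvd
    · simpa [P] using hdvd2
  have := natDegree_le_of_dvd hR hres
  rw [natDegree_pow, natDegree_X_sub_C, mul_one] at this
  rw [hPdeg] at this hdeg
  have h3 : Y.natDegree * m ≤ s * m := Nat.mul_le_mul_right _ hYdeg
  omega

theorem pow_mul_hasseDeriv_pow {K : Type*} [Field K] {F : K[X]} {m : ℕ} (hm : F.natDegree ≤ m)
    (N b : ℕ) : ∃ u : K[X], F ^ b * hasseDeriv b (F ^ N) = F ^ N * u ∧ u.natDegree ≤ b * m := by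
  induction N generalizing b with
  | zero =>
    rcases Nat.eq_zero_or_pos b with rfl | hb
    · exact ⟨1, by simp, by simp⟩
    · exact ⟨0, by simp [hasseDeriv_apply_one b hb], by simp⟩
  | succ N ih =>
    choose u hu hdeg using ih
    have hv : ∀ j, ∃ v : K[X], F ^ j * hasseDeriv j F = F * v ∧ v.natDegree ≤ j * m := by
      intro j
      rcases j with _ | j
      · exact ⟨1, by simp, by simp⟩
      · refine ⟨F ^ j * hasseDeriv (j + 1) F, by ring, ?_⟩
        refine natDegree_mul_le.trans ?_
        have h1 := natDegree_pow_le_of_le j hm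
        have h2 := (natDegree_hasseDeriv_le F (j + 1)).trans (Nat.sub_le _ _)
        rw [add_mul, one_mul]; omega
    choose v hv hvdeg using hv
    refine ⟨∑ ij ∈ Finset.HasAntidiagonal.antidiagonal b, u ij.1 * v ij.2, ?_, ?_⟩
    · rw [pow_succ F N, hasseDeriv_mul, Finset.mul_sum, Finset.mul_sum]
      refine Finset.sum_congr rfl fun ij hij => ?_
      rw [← Finset.HasAntidiagonal.mem_antidiagonal.1 hij, pow_add]
      calc _ = (F ^ ij.1 * hasseDeriv ij.1 (F ^ N)) * (F ^ ij.2 * hasseDeriv ij.2 F) := by ring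
        _ = _ := by rw [hu, hv]; ring
    · refine natDegree_sum_le_of_forall_le _ _ fun ij hij => ?_
      rw [← Finset.HasAntidiagonal.mem_antidiagonal.1 hij, add_mul]
      exact natDegree_mul_le.trans (add_le_add (hdeg _) (hvdeg _))

theorem X_sub_C_pow_dvd_iff_hasseDeriv {K : Type*} [Field K] (P : K[X]) (x : K) (E : ℕ) :
    (X - C x) ^ E ∣ P ↔ ∀ i < E, (hasseDeriv i P).eval x = 0 := by
  have h1 : (X - C x) ^ E ∣ P ↔ X ^ E ∣ taylor x P := by
    rw [← map_dvd_iff (taylorEquiv x)]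
    simp [taylorEquiv]
  rw [h1, X_pow_dvd_iff]
  simp only [taylor_coeff]

/-- The auxiliary linear operators in Stepanov's method. -/
theorem exists_stepanov_operator {K : Type*} [Field K] {F : K[X]} {m : ℕ}
    (hm : F.natDegree ≤ m) (i N : ℕ) : ∃ T : K[X] →ₗ[K] K[X],
      (∀ k, F ^ i * hasseDeriv i (k * F ^ N) = F ^ N * T k) ∧
      ∀ k, (T k).natDegree ≤ k.natDegree + i * m := by
  choose u hu hdeg using pow_mul_hasseDeriv_pow hm N
  refine ⟨∑ ij ∈ Finset.HasAntidiagonal.antidiagonal i,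
    (LinearMap.mulLeft K (F ^ ij.1 * u ij.2)).comp (hasseDeriv ij.1), fun k => ?_, fun k => ?_⟩
  · rw [hasseDeriv_mul, Finset.mul_sum, LinearMap.sum_apply, Finset.mul_sum]
    refine Finset.sum_congr rfl fun ij hij => ?_
    rw [← Finset.HasAntidiagonal.mem_antidiagonal.1 hij, pow_add]
    calc _ = (F ^ ij.1 * hasseDeriv ij.1 k) * (F ^ ij.2 * hasseDeriv ij.2 (F ^ N)) := by ring
      _ = _ := by rw [hu, LinearMap.comp_apply,
      LinearMap.mulLeft_apply]; ring
  · rw [LinearMap.sum_apply]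
    refine natDegree_sum_le_of_forall_le _ _ fun ij hij => ?_
    rw [← Finset.HasAntidiagonal.mem_antidiagonal.1 hij, add_mul, LinearMap.comp_apply,
      LinearMap.mulLeft_apply]
    refine natDegree_mul_le.trans ?_
    have h1 := (natDegree_mul_le (p := F ^ ij.1) (q := u ij.2)).trans
      (add_le_add (natDegree_pow_le_of_le ij.1 hm) (hdeg ij.2))
    have h2 := (natDegree_hasseDeriv_le k ij.1).trans (Nat.sub_le _ _)
    omega

theorem stepanov_nonvanishing_sum {K : Type*} [Field K] [Fintype K] {s g m B L : ℕ} (hs : 0 < s)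
    (hsg : s * g = Fintype.card K - 1) {F : K[X]} (hF : F ≠ 0) (hm : F.natDegree ≤ m)
    (hmult : ∀ d, d ∣ s → (∀ θ, d ∣ F.rootMultiplicity θ) → d = 1)
    {a : K} (ha : F.eval a ≠ 0) (hB : s * B + s * m < Fintype.card K)
    (k : Fin s → Fin L → K[X]) (hk : ∀ j l, (k j l).natDegree ≤ B)
    (h0 : ∑ l, (∑ j, k j l * F ^ (g * j)) * (X ^ Fintype.card K - C a) ^ (l : ℕ) = 0) :
    k = 0 := by
  obtain ⟨p, hp⟩ := CharP.exists K
  have hpp : Fact p.Prime := ⟨CharP.char_is_prime K p⟩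
  obtain ⟨r, -, hr⟩ := FiniteField.card K p
  have hZ : (X ^ Fintype.card K - C a : K[X]) = (X - C a) ^ Fintype.card K := by
    conv_rhs => rw [hr, sub_pow_char_pow, ← hr, ← C_pow, FiniteField.pow_card]
  set Z := (X ^ Fintype.card K - C a : K[X])
  have hZ0 : Z ≠ 0 := by rw [hZ]; exact pow_ne_zero _ (X_sub_C_ne_zero a)
  have key : ∀ n, ∀ l : Fin L, (l : ℕ) = n → (fun j => k j l) = 0 := by
    intro n
    induction n using Nat.strong_induction_on with
    | _ n ih =>
      rintro l rfl
      refine stepanov_nonvanishing hs hsg hF hm hmult ha hB _ (fun j => hk j l) ?_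
      rw [← hZ]
      have h1 : Z ^ ((l : ℕ) + 1) ∣ (∑ j, k j l * F ^ (g * j)) * Z ^ (l : ℕ) := by
        rw [← Finset.add_sum_erase _ _ (Finset.mem_univ l), ] at h0
        rw [eq_neg_of_add_eq_zero_left h0, dvd_neg]
        refine Finset.dvd_sum fun l' hl' => ?_
        rcases lt_or_ge (l' : ℕ) l with h | h
        · have := ih l' h l' rfl
          have : ∀ j, k j l' = 0 := fun j => congrFun this j
          simp [this]
        · refine Dvd.dvd.mul_left (pow_dvd_pow _ ?_) _
          have := Finset.ne_of_mem_erase hl'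
          have : (l' : ℕ) ≠ l := fun h => this (Fin.ext h)
          omega
      rw [pow_succ'] at h1
      exact (mul_dvd_mul_iff_right (pow_ne_zero _ hZ0)).1 h1
  ext1 j
  ext1 l
  exact congrFun (key l l rfl) j

theorem stepanov_card_le_aux {K : Type*} [Field K] [Fintype K] [DecidableEq K] {s g m B L E : ℕ}
    (hs : 0 < s) (hE : Fintype.card K = E ^ 2)
    (hsg : s * g = Fintype.card K - 1) {F : K[X]} (hF : F ≠ 0) (hm : F.natDegree ≤ m)
    (hmult : ∀ d, d ∣ s → (∀ θ, d ∣ F.rootMultiplicity θ) → d = 1) {c : K} (hc : c ≠ 0)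
    (hB0 : 0 < B) (hB : s * B + s * m < Fintype.card K + s)
    (hdim : E * (B + L + E * m) < s * L * B) :
    (Finset.univ.filter fun x => F.eval x ^ g = c).card ≤ E * (L + m + 1) := by
  obtain ⟨p, hp⟩ := CharP.exists K
  have hpp : Fact p.Prime := ⟨CharP.char_is_prime K p⟩
  obtain ⟨r, -, hr⟩ := FiniteField.card K p
  have hQ1 : 1 < Fintype.card K := Fintype.one_lt_card
  have hg : g ≠ 0 := by rintro rfl; omega
  set T := Finset.univ.filter fun x => F.eval x ^ g = c with hT
  rcases T.eq_empty_or_nonempty with hT0 | ⟨a, ha⟩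
  · rw [hT0]; simp
  have hTne : ∀ x ∈ T, F.eval x ≠ 0 := by
    intro x hx h
    rw [hT, Finset.mem_filter, h, zero_pow hg] at hx
    exact hc hx.2.symm
  have hE0 : 0 < E := by rcases Nat.eq_zero_or_pos E with rfl | h; · simp at hE
                         · exact h
  choose T' hT1 hT2 using fun i N => exists_stepanov_operator hm i N
  set M := B + L + E * m
  let V := Fin s → Fin L → degreeLT K B
  let Φ : ℕ → V →ₗ[K] K[X] := fun i =>
    ∑ j : Fin s, ∑ l : Fin L,
      (LinearMap.mulLeft K (C (c ^ (j : ℕ)) * (X - C a) ^ (l : ℕ))) ∘ₗ (T' i (g * j)) ∘ₗ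
        (degreeLT K B).subtype ∘ₗ (LinearMap.proj l) ∘ₗ (LinearMap.proj j)
  have hΦ : ∀ i (v : V), Φ i v = ∑ j : Fin s, ∑ l : Fin L,
      C (c ^ (j : ℕ)) * (X - C a) ^ (l : ℕ) * T' i (g * j) (v j l) := by
    intro i v
    simp only [Φ, LinearMap.sum_apply, LinearMap.comp_apply,
      LinearMap.mulLeft_apply]
    rfl
  have hdegv : ∀ (w : degreeLT K B), (w : K[X]).natDegree ≤ B - 1 := by
    intro w
    have := mem_degreeLT.1 w.2
    by_cases hw : (w : K[X]) = 0
    · simp [hw]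
    · rw [← natDegree_lt_iff_degree_lt hw] at this
      omega
  have hΦdeg : ∀ i < E, ∀ v, (Φ i v).natDegree < M := by
    intro i hi v
    have : (Φ i v).natDegree ≤ (B - 1) + L + E * m := by
      rw [hΦ]
      refine natDegree_sum_le_of_forall_le _ _ fun j _ =>
        natDegree_sum_le_of_forall_le _ _ fun l _ => ?_
      refine natDegree_mul_le.trans ?_
      have h1 : (C (c ^ (j : ℕ)) * (X - C a) ^ (l : ℕ)).natDegree ≤ L := by
        refine (natDegree_C_mul_le _ _).trans ?_
        rw [natDegree_pow, natDegree_X_sub_C, mul_one]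
        exact l.2.le
      have h2 := hT2 i (g * j) (v j l)
      have h3 := hdegv (v j l)
      have h4 : i * m ≤ E * m := Nat.mul_le_mul_right _ hi.le
      omega
    omega
  let Ψ : V →ₗ[K] (Fin E → Fin M → K) :=
    LinearMap.pi fun i => LinearMap.pi fun n => (lcoeff K n) ∘ₗ Φ i
  have hker : LinearMap.ker Ψ ≠ ⊥ := by
    apply LinearMap.ker_ne_bot_of_finrank_lt
    have h1 : Module.finrank K (degreeLT K B) = B := by
      rw [(degreeLTEquiv K B).finrank_eq]; simp
    have : Module.finrank K V = s * (L * B) := by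
      simp only [V]
      rw [Module.finrank_pi_fintype]
      simp [Module.finrank_pi_fintype, h1]
    rw [this, Module.finrank_pi_fintype]
    simp [← mul_assoc, hdim]
  obtain ⟨v, hv, hv0⟩ := (Submodule.ne_bot_iff _).1 hker
  have hΦ0 : ∀ i < E, Φ i v = 0 := by
    intro i hi
    ext n
    rcases lt_or_ge n M with hn | hn
    · have := congrFun (congrFun (LinearMap.mem_ker.1 hv) ⟨i, hi⟩) ⟨n, hn⟩
      simpa [Ψ] using this
    · rw [coeff_eq_zero_of_natDegree_lt ((hΦdeg i hi v).trans_le hn), coeff_zero]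
  set Q := Fintype.card K with hQ
  let R : K[X] := ∑ l, (∑ j, (v j l : K[X]) * F ^ (g * j)) * (X ^ Q - C a) ^ (l : ℕ)
  have hR0 : R ≠ 0 := by
    intro h
    apply hv0
    have := stepanov_nonvanishing_sum hs hsg hF hm hmult (hTne a ha) (B := B - 1)
      (by
        have : s * (B - 1) + s = s * B := by
          rw [← Nat.mul_succ, Nat.succ_eq_add_one, Nat.sub_add_cancel hB0]
        omega) (fun j l => (v j l : K[X])) (fun j l => hdegv _) h
    ext1 j
    ext1 l
    exact Subtype.ext (congrFun (congrFun this j) l)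
  have hdvd : ∀ x ∈ T, (X - C x) ^ E ∣ R := by
    intro x hx
    have hxc : F.eval x ^ g = c := (Finset.mem_filter.1 hx).2
    let S : K[X] := ∑ l : Fin L, (∑ j, (v j l : K[X]) * F ^ (g * j)) * (C (x - a)) ^ (l : ℕ)
    have hEQ : E ≤ Q := by rw [hE]; nlinarith
    have hZ : (X - C x) ^ E ∣ (X ^ Q - C a) - C (x - a) := by
      have : (X ^ Q - C a) - C (x - a) = (X - C x) ^ Q := by
        rw [C_sub]
        conv_rhs => rw [hr, sub_pow_char_pow, ← hr, ← C_pow, FiniteField.pow_card]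
        ring
      rw [this]
      exact pow_dvd_pow _ hEQ
    have hRS : (X - C x) ^ E ∣ R - S := by
      simp only [R, S, ← Finset.sum_sub_distrib, ← mul_sub]
      refine Finset.dvd_sum fun l _ => Dvd.dvd.mul_left (hZ.trans (sub_dvd_pow_sub_pow _ _ _)) _
    have hS : (X - C x) ^ E ∣ S := by
      rw [X_sub_C_pow_dvd_iff_hasseDeriv]
      intro i hi
      have h1 : F.eval x ^ i * (hasseDeriv i S).eval x = (Φ i v).eval x := by
        rw [← eval_pow, ← eval_mul, hΦ]
        simp only [S, map_sum, Finset.sum_mul, Finset.mul_sum, eval_finsetSum]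
        rw [Finset.sum_comm]
        refine Finset.sum_congr rfl fun j _ => Finset.sum_congr rfl fun l _ => ?_
        have h2 : (v j l : K[X]) * F ^ (g * j) * C (x - a) ^ (l : ℕ) =
            (x - a) ^ (l : ℕ) • ((v j l : K[X]) * F ^ (g * j)) := by
          rw [smul_eq_C_mul, C_pow, mul_comm]
        rw [h2, map_smul, mul_smul_comm, hT1, eval_smul, eval_mul, eval_mul, eval_mul, eval_C,
          eval_pow, eval_pow, pow_mul, hxc]
        simp only [eval_sub, eval_X, eval_C, smul_eq_mul]
        ring
      rw [hΦ0 i hi, eval_zero] at h1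
      exact (mul_eq_zero.1 h1).resolve_left (pow_ne_zero _ (hTne x hx))
    exact (dvd_sub_left hS).1 hRS |>.trans dvd_rfl
  have hprod : ∏ x ∈ T, (X - C x) ^ E ∣ R := by
    refine Finset.prod_dvd_of_coprime ?_ hdvd
    intro x _ y _ hxy
    exact (isCoprime_X_sub_C_of_isUnit_sub (sub_ne_zero.2 hxy).isUnit).pow
  have h1 := natDegree_le_of_dvd hprod hR0
  rw [natDegree_prod _ _ (fun x _ => pow_ne_zero _ (X_sub_C_ne_zero x))] at h1
  simp only [natDegree_pow, natDegree_X_sub_C, mul_one, Finset.sum_const, smul_eq_mul] at h1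
  have hgs : s * g ≤ Q := by omega
  have h2 : R.natDegree ≤ B - 1 + Q * m + L * Q := by
    refine natDegree_sum_le_of_forall_le _ _ fun l _ => natDegree_mul_le.trans ?_
    have h3 : ((X ^ Q - C a : K[X]) ^ (l : ℕ)).natDegree ≤ L * Q := by
      rw [natDegree_pow, natDegree_X_pow_sub_C]
      exact Nat.mul_le_mul_right _ l.2.le
    have h4 : (∑ j, (v j l : K[X]) * F ^ (g * j)).natDegree ≤ B - 1 + Q * m := by
      refine natDegree_sum_le_of_forall_le _ _ fun j _ => natDegree_mul_le.trans ?_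
      refine add_le_add (hdegv _) ((natDegree_pow_le_of_le _ hm).trans ?_)
      refine Nat.mul_le_mul_right _ (le_trans ?_ hgs)
      rw [mul_comm]
      exact Nat.mul_le_mul_right _ j.2.le
    exact add_le_add h4 h3
  have hBQ : B - 1 ≤ Q := by
    have : s * (B - 1) + s = s * B := by
      rw [← Nat.mul_succ, Nat.succ_eq_add_one, Nat.sub_add_cancel hB0]
    have : B - 1 ≤ s * (B - 1) := Nat.le_mul_of_pos_left _ hs
    omega
  have h5 : T.card * E ≤ (E * (L + m + 1)) * E := by
    calc T.card * E ≤ Q + Q * m + L * Q := by omega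
      _ = _ := by rw [hE]; ring
  exact Nat.le_of_mul_le_mul_right h5 hE0

/-- Stepanov's bound for the number of `x` with `F(x) ^ g = c`. -/
theorem stepanov_card_le {K : Type*} [Field K] [Fintype K] [DecidableEq K] {s g m E : ℕ}
    (hs : 0 < s) (hE : Fintype.card K = E ^ 2)
    (hsg : s * g = Fintype.card K - 1) {F : K[X]} (hF : F ≠ 0) (hm : F.natDegree ≤ m)
    (hmult : ∀ d, d ∣ s → (∀ θ, d ∣ F.rootMultiplicity θ) → d = 1) {c : K} (hc : c ≠ 0)
    (hlarge : (m + 4) * (s * m + s + 2) ≤ E) :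
    s * (Finset.univ.filter fun x => F.eval x ^ g = c).card ≤ E ^ 2 + s * (2 * m + 5) * E := by
  have hsg' : s * g + 1 = E ^ 2 := by
    have : 1 < Fintype.card K := Fintype.one_lt_card
    omega
  have hEm : s * m + s + 2 ≤ E := le_trans (Nat.le_mul_of_pos_left _ (by omega)) hlarge
  have hmg : m < g := by
    by_contra! h
    have : s * g ≤ s * m := Nat.mul_le_mul_left _ h
    nlinarith
  have hdiv := Nat.div_add_mod E s
  have hmod := Nat.mod_lt E hs
  set e := E / s
  have hB1 : s * (g - m) + s * m = s * g := by
    rw [← mul_add, Nat.sub_add_cancel hmg.le]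
  have := stepanov_card_le_aux hs hE hsg hF hm hmult hc (B := g - m) (L := e + m + 4)
    (by omega) (by omega) (by
      obtain ⟨b, rfl⟩ : ∃ b, g = b + m := ⟨g - m, by omega⟩
      simp only [Nat.add_sub_cancel]
      have h1 : E + s * (m + 3) ≤ s * (e + m + 4) := by nlinarith
      have h2 : e ≤ E := Nat.div_le_self _ _
      have h3 : (E + s * (m + 3)) * b ≤ s * (e + m + 4) * b := Nat.mul_le_mul_right _ h1
      have h4 : s * b + s * m + 1 = E ^ 2 := by rw [← hsg']; ring
      have h5 : E * (b + (e + m + 4) + E * m) ≤ E * b + E * (E + m + 4) + E ^ 2 * m := by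
        have : E * e ≤ E * E := Nat.mul_le_mul_left _ h2
        nlinarith
      have h6 : E * (E + m + 4) + E ^ 2 * m < (m + 3) * (s * b) := by
        have h7 : (m + 4) * (s * m + s + 2) * E ≤ E * E := Nat.mul_le_mul_right _ hlarge
        have h8 : (m + 4) * E ≤ E * E := by
          refine le_trans (Nat.mul_le_mul_right _ ?_) h7
          exact Nat.le_mul_of_pos_right _ (by omega)
        have h9 : (m + 3) * (s * m + 1) < E * E := by nlinarith
        have h10 : (m + 3) * (s * b) + (m + 3) * (s * m + 1) = (m + 3) * E ^ 2 := by
          rw [← h4]; ring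
        nlinarith
      nlinarith)
  have h1 : s * e ≤ E := by omega
  calc _ ≤ s * (E * (e + m + 4 + m + 1)) := Nat.mul_le_mul_left _ this
    _ = (s * e) * E + s * (2 * m + 5) * E := by ring
    _ ≤ E * E + s * (2 * m + 5) * E := by gcongr
    _ = _ := by ring

theorem mulChar_apply_eq_sum {K : Type*} [Field K] [Fintype K] [DecidableEq K] {s g : ℕ}
    (hs : 0 < s) (hsg : s * g = Fintype.card K - 1) {γ : Kˣ} (hγ : ∀ x, x ∈ Subgroup.zpowers γ)
    (ω : MulChar K ℂ) (hω : ω γ ^ s = 1) (y : K) :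
    ω y = ∑ i ∈ Finset.range s, ω γ ^ i * if y ^ g = (γ : K) ^ (g * i) then 1 else 0 := by
  have hQ1 : 1 < Fintype.card K := Fintype.one_lt_card
  have hg : g ≠ 0 := by rintro rfl; omega
  by_cases hy : y = 0
  · subst hy
    rw [MulChar.map_zero, Finset.sum_eq_zero]
    intro i _
    rw [zero_pow hg, if_neg, mul_zero]
    exact (pow_ne_zero _ γ.ne_zero).symm
  have hord : orderOf γ = s * g := by
    rw [orderOf_eq_card_of_forall_mem_zpowers hγ, Nat.card_eq_fintype_card, Fintype.card_units, hsg]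
  obtain ⟨j, hj⟩ : ∃ j : ℕ, γ ^ j = Units.mk0 y hy := by
    exact mem_powers_iff_mem_zpowers.2 (hγ (Units.mk0 y hy))
  have hj' : y = (γ : K) ^ j := by rw [← Units.val_pow_eq_pow_val, hj, Units.val_mk0]
  have hiff : ∀ i, y ^ g = (γ : K) ^ (g * i) ↔ j ≡ i [MOD s] := by
    intro i
    rw [hj', ← pow_mul]
    have : IsUnit (γ : K) := γ.isUnit
    rw [mul_comm j g, ← Units.val_pow_eq_pow_val, ← Units.val_pow_eq_pow_val, Units.val_inj,
      pow_eq_pow_iff_modEq, hord, mul_comm s g]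
    constructor
    · exact fun h => Nat.ModEq.mul_left_cancel' hg h
    · exact fun h => Nat.ModEq.mul_left' g h
  rw [Finset.sum_eq_single (j % s)]
  · rw [if_pos ((hiff _).2 (Nat.mod_modEq j s).symm), mul_one, hj', map_pow]
    conv_lhs => rw [← Nat.div_add_mod j s, pow_add, pow_mul, hω, one_pow, one_mul]
  · intro i hi hne
    rw [if_neg, mul_zero]
    intro h
    apply hne
    have := (hiff i).1 h
    rw [Nat.ModEq, Nat.mod_eq_of_lt (Finset.mem_range.1 hi)] at this
    exact this.symm
  · intro h
    exact absurd (Finset.mem_range.2 (Nat.mod_lt _ hs)) h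

theorem norm_sum_mulChar_eval_le {K : Type*} [Field K] [Fintype K] [DecidableEq K] {s g m E : ℕ}
    (hs : 0 < s) (hE : Fintype.card K = E ^ 2)
    (hsg : s * g = Fintype.card K - 1) {F : K[X]} (hF : F ≠ 0) (hm : F.natDegree ≤ m)
    (hmult : ∀ d, d ∣ s → (∀ θ, d ∣ F.rootMultiplicity θ) → d = 1)
    (hlarge : (m + 4) * (s * m + s + 2) ≤ E) {γ : Kˣ} (hγ : ∀ x, x ∈ Subgroup.zpowers γ)
    (ω : MulChar K ℂ) (hω : ω γ ^ s = 1) (hω1 : ω γ ≠ 1) :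
    ‖∑ x, ω (F.eval x)‖ ≤ s * (2 * m + 5) * E + m := by
  have hQ1 : 1 < Fintype.card K := Fintype.one_lt_card
  have hg : g ≠ 0 := by rintro rfl; omega
  set z := ω γ with hz
  set N : ℕ → ℕ := fun i => (Finset.univ.filter fun x => F.eval x ^ g = (γ : K) ^ (g * i)).card
  have hN : ∀ i, (s : ℝ) * N i ≤ (E : ℝ) ^ 2 + s * (2 * m + 5) * E := fun i => by
    exact_mod_cast stepanov_card_le hs hE hsg hF hm hmult (pow_ne_zero (g * i) γ.ne_zero) hlarge
  have hsum : ∑ x, ω (F.eval x) = ∑ i ∈ Finset.range s, z ^ i * N i := by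
    rw [Finset.sum_congr rfl fun x _ => mulChar_apply_eq_sum hs hsg hγ ω hω (F.eval x),
      Finset.sum_comm]
    refine Finset.sum_congr rfl fun i _ => ?_
    rw [← Finset.mul_sum, Finset.sum_boole]
  have hgeom : ∑ i ∈ Finset.range s, z ^ i = 0 := by
    rw [geom_sum_eq hω1, hω, sub_self, zero_div]
  have hznorm : ‖z‖ = 1 := by
    have := congrArg norm hω
    rw [norm_pow, norm_one] at this
    exact (pow_eq_one_iff_of_nonneg (norm_nonneg _) hs.ne').1 this
  have hs' : (0 : ℝ) < s := by exact_mod_cast hs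
  set M : ℝ := ((E : ℝ) ^ 2 + s * (2 * m + 5) * E) / s
  have hNM : ∀ i, (N i : ℝ) ≤ M := fun i => by
    rw [le_div_iff₀ hs', mul_comm]; exact hN i
  have hsM : s * M = (E : ℝ) ^ 2 + s * (2 * m + 5) * E := by
    simp only [M]; field_simp
  -- total count
  have htotal : (E : ℝ) ^ 2 - m ≤ ∑ i ∈ Finset.range s, (N i : ℝ) := by
    have h1 : (Finset.univ.filter fun x => ¬ F.eval x = 0).card ≤ ∑ i ∈ Finset.range s, N i := by
      rw [Finset.card_filter]
      simp only [N, Finset.card_filter]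
      rw [Finset.sum_comm]
      refine Finset.sum_le_sum fun x _ => ?_
      split_ifs with hx
      · exact Nat.zero_le _
      · have h2 := mulChar_apply_eq_sum hs hsg hγ ω hω (F.eval x)
        by_contra! h3
        have h4 : ∀ i ∈ Finset.range s, ¬ (F.eval x ^ g = (γ : K) ^ (g * i)) := by
          intro i hi hc
          have := Finset.single_le_sum (f := fun i => if F.eval x ^ g = (γ : K) ^ (g * i) then 1
            else 0) (fun _ _ => Nat.zero_le _) hi
          simp only [if_pos hc] at this
          omega
        rw [Finset.sum_eq_zero] at h2
        · exact (((isUnit_iff_ne_zero.2 hx).map ω).ne_zero) h2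
        · intro i hi
          rw [if_neg (h4 i hi), mul_zero]
    have h2 : (Finset.univ.filter fun x => F.eval x = 0).card ≤ m := by
      refine le_trans ?_ hm
      refine le_trans (Finset.card_le_card (t := F.roots.toFinset) ?_)
        ((Multiset.toFinset_card_le _).trans (card_roots' F))
      intro x hx
      rw [Multiset.mem_toFinset, mem_roots hF]
      exact (Finset.mem_filter.1 hx).2
    have h3 := Finset.card_filter_add_card_filter_not (s := (Finset.univ : Finset K))
      (fun x => F.eval x = 0)
    rw [Finset.card_univ, hE] at h3
    have h4 : E ^ 2 ≤ ∑ i ∈ Finset.range s, N i + m := by omega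
    have h5 : (E : ℝ) ^ 2 ≤ ∑ i ∈ Finset.range s, (N i : ℝ) + m := by exact_mod_cast h4
    linarith
  have hS : ∑ x, ω (F.eval x) = -∑ i ∈ Finset.range s, z ^ i * ((M - N i : ℝ) : ℂ) := by
    rw [hsum]
    have : ∑ i ∈ Finset.range s, z ^ i * ((M - N i : ℝ) : ℂ) =
        M * ∑ i ∈ Finset.range s, z ^ i - ∑ i ∈ Finset.range s, z ^ i * N i := by
      rw [Finset.mul_sum, ← Finset.sum_sub_distrib]
      refine Finset.sum_congr rfl fun i _ => ?_
      push_cast; ring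
    rw [this, hgeom]; ring
  rw [hS, norm_neg]
  calc _ ≤ ∑ i ∈ Finset.range s, (M - N i) := by
        refine norm_sum_le_of_le _ fun i _ => ?_
        rw [norm_mul, norm_pow, hznorm, one_pow, one_mul, Complex.norm_real,
          Real.norm_of_nonneg (sub_nonneg.2 (hNM i))]
    _ = s * M - ∑ i ∈ Finset.range s, (N i : ℝ) := by
        rw [Finset.sum_sub_distrib, Finset.sum_const, Finset.card_range, nsmul_eq_mul]
    _ ≤ _ := by rw [hsM]; linarith

section NormPoly

variable {F K : Type*} [Field F] [Field K] [Algebra F K] [FiniteDimensional F K]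

/-- The norm from `K[X]` to `F[X]` as a product over the Galois group. -/
theorem exists_normPoly [IsGalois F K] : ∃ N : K[X] →* F[X], ∀ f, (N f).map (algebraMap F K) =
    ∏ σ : Gal(K/F), f.map (σ : K →+* K) := by
  classical
  have hex : ∀ f : K[X], ∃ g : F[X], g.map (algebraMap F K) =
      ∏ σ : Gal(K/F), f.map (σ : K →+* K) := by
    intro f
    rw [← mem_lifts, lifts_iff_coeff_lifts]
    intro n
    rw [IsGalois.mem_range_algebraMap_iff_fixed]
    intro τ
    have : (∏ σ : Gal(K/F), f.map (σ : K →+* K)).map (τ : K →+* K) =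
        ∏ σ : Gal(K/F), f.map (σ : K →+* K) := by
      rw [Polynomial.map_prod]
      refine Fintype.prod_equiv (Equiv.mulLeft τ) _ _ fun σ => ?_
      rw [Polynomial.map_map]
      rfl
    conv_rhs => rw [← this]
    rw [coeff_map]; rfl
  choose N hN using hex
  have hinj := map_injective (algebraMap F K) (algebraMap F K).injective
  refine ⟨⟨⟨N, hinj ?_⟩, fun f g => hinj ?_⟩, hN⟩
  · rw [hN]; simp
  · simp only [Polynomial.map_mul, hN, Finset.prod_mul_distrib]

variable {N : K[X] →* F[X]}
  (hN : ∀ f, (N f).map (algebraMap F K) = ∏ σ : Gal(K/F), f.map (σ : K →+* K))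

include hN in
theorem normPoly_congr {M : F[X]} {f g : K[X]} (h : M.map (algebraMap F K) ∣ f - g) :
    M ∣ N f - N g := by
  rw [← map_dvd_map' (algebraMap F K), Polynomial.map_sub, hN, hN]
  have h1 : ∀ σ : Gal(K/F), M.map (algebraMap F K) ∣
      f.map (σ : K →+* K) - g.map (σ : K →+* K) := by
    intro σ
    have h2 := Polynomial.map_dvd (σ : K →+* K) h
    have h3 : (σ : K →+* K).comp (algebraMap F K) = algebraMap F K := by
      ext x; simp
    rwa [Polynomial.map_map, Polynomial.map_sub, h3] at h2
  simp only [← Ideal.mem_span_singleton, ← Ideal.Quotient.mk_eq_mk_iff_sub_mem] at h1 ⊢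
  rw [map_prod, map_prod]
  exact Finset.prod_congr rfl fun σ _ => h1 σ

include hN in
theorem aeval_normPoly (f : K[X]) (θ : K) :
    aeval θ (N f) = ∏ σ : Gal(K/F), σ (f.eval (σ⁻¹ θ)) := by
  rw [← eval_map_algebraMap, hN, eval_prod]
  refine Finset.prod_congr rfl fun σ _ => ?_
  conv_lhs => rw [← σ.apply_symm_apply θ]
  exact eval_map_apply (f := (σ : K →+* K)) _

include hN in
/-- The norm of `X - x` is a power of the minimal polynomial of `x`. -/
theorem normPoly_X_sub_C [IsGalois F K] (x : K) : ∃ e : ℕ, N (X - C x) = minpoly F x ^ e ∧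
    e * (minpoly F x).natDegree = Module.finrank F K := by
  have hmap : (N (X - C x)).map (algebraMap F K) = ∏ σ : Gal(K/F), (X - C (σ x)) := by
    rw [hN]; exact Finset.prod_congr rfl fun σ _ => by simp
  have hintegral : IsIntegral F x := Algebra.IsIntegral.isIntegral x
  have hmonic : (N (X - C x)).Monic := by
    rw [← monic_map_iff (f := algebraMap F K), hmap]
    exact monic_prod_of_monic _ _ fun σ _ => monic_X_sub_C _
  have hdeg : (N (X - C x)).natDegree = Module.finrank F K := by
    rw [← natDegree_map (algebraMap F K), hmap, natDegree_prod_of_monic _ _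
      fun σ _ => monic_X_sub_C _]
    simp only [natDegree_X_sub_C, Finset.sum_const, smul_eq_mul, mul_one, Finset.card_univ]
    rw [← IsGalois.card_aut_eq_finrank F K, Nat.card_eq_fintype_card]
  have hirr := minpoly.irreducible hintegral
  obtain ⟨e, he⟩ : ∃ e, Associated (N (X - C x)) (minpoly F x ^ e) := by
    classical
    refine ⟨(UniqueFactorizationMonoid.normalizedFactors (N (X - C x))).card, ?_⟩
    have h1 := UniqueFactorizationMonoid.prod_normalizedFactors hmonic.ne_zero
    have h2 : UniqueFactorizationMonoid.normalizedFactors (N (X - C x)) =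
        Multiset.replicate (UniqueFactorizationMonoid.normalizedFactors (N (X - C x))).card
          (minpoly F x) := by
      rw [Multiset.eq_replicate]
      refine ⟨rfl, fun r hr => ?_⟩
      have hri := UniqueFactorizationMonoid.irreducible_of_normalized_factor r hr
      have hrd := UniqueFactorizationMonoid.dvd_of_mem_normalizedFactors hr
      have hrm : r.Monic := by
        rw [← UniqueFactorizationMonoid.normalize_normalized_factor r hr]
        exact monic_normalize hri.ne_zero
      have h3 := Polynomial.map_dvd (algebraMap F K) hrd
      rw [hmap] at h3
      obtain ⟨σ, hσ⟩ : ∃ σ : Gal(K/F), aeval (σ x) r = 0 := by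
        by_contra! hne
        have h4 : IsCoprime (r.map (algebraMap F K)) (∏ σ : Gal(K/F), (X - C (σ x))) := by
          refine IsCoprime.prod_right fun σ _ => ?_
          refine ((irreducible_X_sub_C (σ x)).coprime_iff_not_dvd.2 fun h => hne σ ?_).symm
          rw [dvd_iff_isRoot, IsRoot, eval_map_algebraMap] at h
          exact h
        have h5 := h4.isUnit_of_dvd' dvd_rfl h3
        have h6 := natDegree_eq_zero_of_isUnit h5
        rw [natDegree_map] at h6
        exact hri.natDegree_pos.ne' h6
      have h7 := minpoly.eq_of_irreducible_of_monic hri hσ hrm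
      rw [h7]
      exact minpoly.algEquiv_eq σ x
    rw [h2, Multiset.prod_replicate] at h1
    exact h1.symm
  have he' := eq_of_monic_of_associated hmonic ((minpoly.monic hintegral).pow e) he
  refine ⟨e, he', ?_⟩
  rw [← hdeg, he', natDegree_pow]

end NormPoly

section Surjective

variable {F K : Type*} [Field F] [Field K] [Fintype K] [Algebra F K]

/-- The norm for the stabilizer of `θ` hits every nonzero element of `F(θ)`. -/
theorem exists_prod_stabilizer_eq [FiniteDimensional F K] [IsGalois F K] [DecidableEq K]
    (θ : K) (u : F[X]) :
    ∃ y : K, ∏ σ : Gal(K/F) with σ θ = θ, σ y = aeval θ u := by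
  classical
  let L := IntermediateField.adjoin F {θ}
  have : Fintype L := Fintype.ofFinite L
  have hmem : aeval θ u ∈ L := by
    have := IntermediateField.mem_adjoin_simple_self F θ
    have h2 := (aeval (⟨θ, this⟩ : L) u).2
    have h3 : ((aeval (⟨θ, this⟩ : L) u : L) : K) = aeval θ u :=
      (aeval_algebraMap_apply K (⟨θ, this⟩ : L) u).symm
    rwa [h3] at h2
  obtain ⟨y, hy⟩ := FiniteField.norm_surjective L K ⟨_, hmem⟩
  refine ⟨y, ?_⟩
  have h1 := Algebra.norm_eq_prod_automorphisms L y
  rw [hy] at h1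
  change aeval θ u = _ at h1
  rw [h1]
  symm
  refine Finset.prod_bij (fun σ _ => (IntermediateField.fixingSubgroupEquiv L).symm σ) ?_ ?_ ?_ ?_
  · intro σ _
    rw [Finset.mem_filter]
    refine ⟨Finset.mem_univ _, ?_⟩
    exact ((IntermediateField.fixingSubgroupEquiv L).symm σ).2
      ⟨θ, IntermediateField.mem_adjoin_simple_self F θ⟩
  · intro σ _ τ _ h
    exact (IntermediateField.fixingSubgroupEquiv L).symm.injective (Subtype.ext h)
  · intro σ hσ
    have hσ' : σ ∈ L.fixingSubgroup := by
      rw [IntermediateField.mem_fixingSubgroup_iff]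
      intro x hx
      have h2 : L ≤ IntermediateField.fixedField (Subgroup.zpowers σ) := by
        rw [IntermediateField.adjoin_simple_le_iff]
        rintro ⟨τ, hτ⟩
        obtain ⟨i, rfl⟩ := Subgroup.mem_zpowers_iff.1 hτ
        have : σ ∈ MulAction.stabilizer (Gal(K/F)) θ := (Finset.mem_filter.1 hσ).2
        exact zpow_mem this i
      exact h2 hx ⟨σ, Subgroup.mem_zpowers σ⟩
    exact ⟨IntermediateField.fixingSubgroupEquiv L ⟨σ, hσ'⟩, Finset.mem_univ _, by simp⟩
  · intro σ _
    rfl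

theorem exists_normPoly_eq [FiniteDimensional F K] [IsGalois F K] [DecidableEq K]
    {N : K[X] →* F[X]}
    (hN : ∀ f, (N f).map (algebraMap F K) = ∏ σ : Gal(K/F), f.map (σ : K →+* K))
    {M : F[X]} {S : Finset K} (hM : M.map (algebraMap F K) = ∏ θ ∈ S, (X - C θ))
    (u : F[X]) (hu : ∀ θ ∈ S, aeval θ u ≠ 0) :
    ∃ v : K → K, (∀ θ ∈ S, v θ ≠ 0) ∧ M ∣ N (Lagrange.interpolate S id v) - u := by
  classical
  choose y hy using fun θ : K => exists_prod_stabilizer_eq (F := F) θ u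
  let r : K → K := fun θ => (Quotient.mk (MulAction.orbitRel Gal(K/F) K) θ).out
  have hr1 : ∀ θ, ∃ τ : Gal(K/F), τ (r θ) = θ := by
    intro θ
    have := Quotient.mk_out (s := MulAction.orbitRel Gal(K/F) K) θ
    obtain ⟨τ, hτ⟩ := (MulAction.orbitRel Gal(K/F) K).symm this
    exact ⟨τ, hτ⟩
  have hr2 : ∀ θ (σ : Gal(K/F)), r (σ θ) = r θ := by
    intro θ σ
    have : (Quotient.mk (MulAction.orbitRel Gal(K/F) K) (σ θ)) =
        Quotient.mk (MulAction.orbitRel Gal(K/F) K) θ := Quotient.sound ⟨σ, rfl⟩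
    simp only [r, this]
  have hSroot : ∀ θ, θ ∈ S ↔ aeval θ M = 0 := by
    intro θ
    rw [← eval_map_algebraMap, hM, eval_prod, Finset.prod_eq_zero_iff]
    simp [sub_eq_zero]
  have hSσ : ∀ θ ∈ S, ∀ σ : Gal(K/F), σ θ ∈ S := by
    intro θ hθ σ
    rw [hSroot] at hθ ⊢
    have := aeval_algHom_apply (σ : K →ₐ[F] K) θ M
    rw [hθ, map_zero] at this
    exact this
  refine ⟨fun θ => if r θ = θ then y θ else 1, ?_, ?_⟩
  · intro θ hθ
    dsimp only
    split_ifs with h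
    · intro h0
      apply hu θ hθ
      rw [← hy θ, h0]
      refine Finset.prod_eq_zero (i := 1) (by simp) (by simp)
    · exact one_ne_zero
  · rw [← map_dvd_map' (algebraMap F K), hM]
    refine Finset.prod_dvd_of_coprime ?_ fun θ hθ => ?_
    · intro a _ b _ hab
      exact isCoprime_X_sub_C_of_isUnit_sub (sub_ne_zero.2 hab).isUnit
    · rw [dvd_iff_isRoot, IsRoot, eval_map_algebraMap, map_sub, sub_eq_zero, aeval_normPoly hN]
      obtain ⟨τ, hτ⟩ := hr1 θ
      have h1 : ∀ σ : Gal(K/F), σ (eval (σ⁻¹ θ) (Lagrange.interpolate S id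
          (fun θ => if r θ = θ then y θ else 1))) =
          if σ⁻¹ θ = r θ then σ (y (r θ)) else 1 := by
        intro σ
        have h2 := Lagrange.eval_interpolate_at_node (s := S) (v := id)
          (fun θ => if r θ = θ then y θ else 1) Function.injective_id.injOn (hSσ θ hθ σ⁻¹)
        rw [id] at h2
        rw [h2, hr2]
        by_cases h3 : r θ = σ⁻¹ θ
        · rw [if_pos h3, if_pos h3.symm, h3]
        · rw [if_neg h3, if_neg (Ne.symm h3), map_one]
      rw [Finset.prod_congr rfl fun σ _ => h1 σ, ← Finset.prod_filter]
      have h4 : aeval θ u = τ (aeval (r θ) u) := by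
        conv_lhs => rw [← hτ]
        exact aeval_algHom_apply (τ : K →ₐ[F] K) (r θ) u
      rw [h4, ← hy, map_prod]
      symm
      refine Finset.prod_bij (fun σ _ => τ * σ⁻¹⁻¹) ?_ ?_ ?_ ?_
      · intro σ hσ
        rw [Finset.mem_filter] at hσ ⊢
        refine ⟨Finset.mem_univ _, ?_⟩
        rw [inv_inv, mul_inv_rev, AlgEquiv.mul_apply]
        rw [AlgEquiv.aut_inv, AlgEquiv.aut_inv, AlgEquiv.symm_apply_eq, AlgEquiv.symm_apply_eq,
          hσ.2, hτ]
      · intro σ _ σ' _ h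
        simpa using h
      · intro σ hσ
        refine ⟨τ⁻¹ * σ, ?_, by simp⟩
        rw [Finset.mem_filter] at hσ ⊢
        refine ⟨Finset.mem_univ _, ?_⟩
        have h5 : θ = σ (r θ) := by
          have := hσ.2
          rwa [AlgEquiv.aut_inv, AlgEquiv.symm_apply_eq] at this
        rw [AlgEquiv.mul_apply, ← h5, AlgEquiv.aut_inv, AlgEquiv.symm_apply_eq, hτ]
      · intro σ _
        simp

end Surjective

theorem norm_sum_prod_hom_le {K : Type*} [Field K] [Fintype K] [DecidableEq K] (S : Finset K)
    {N E : ℕ} (hN : 0 < N) (Ψ : K → K →* ℂ) (hΨ : ∀ θ ∈ S, ∀ y ≠ 0, Ψ θ y ^ N = 1)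
    (hnt : ∃ θ ∈ S, ∃ y ≠ 0, Ψ θ y ≠ 1) (hE : Fintype.card K = E ^ 2)
    (hlarge : (S.card * N + 4) * (N * (S.card * N) + N + 2) ≤ E)
    (f : K → ℂ) (hf1 : ∀ x, ‖f x‖ ≤ 1) (hf : ∀ x ∉ S, f x = ∏ θ ∈ S, Ψ θ (θ - x)) :
    ‖∑ x, f x‖ ≤ N * (2 * (S.card * N) + 5) * E + 3 * (S.card * N) := by
  obtain ⟨γ, hγ⟩ := IsCyclic.exists_generator (α := Kˣ)
  set z : S → ℂ := fun θ => Ψ θ γ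
  set s := orderOf z with hs_def
  have hsN : s ∣ N := by
    apply orderOf_dvd_of_pow_eq_one
    ext θ
    exact hΨ θ θ.2 γ γ.ne_zero
  have hs : 0 < s := Nat.pos_of_dvd_of_pos hsN hN
  have hsle : s ≤ N := Nat.le_of_dvd hN hsN
  have hsQ : s ∣ Fintype.card K - 1 := by
    apply orderOf_dvd_of_pow_eq_one
    ext θ
    simp only [z, Pi.pow_apply, Pi.one_apply]
    rw [← map_pow, FiniteField.pow_card_sub_one_eq_one _ γ.ne_zero, map_one]
  obtain ⟨g, hsg⟩ := hsQ
  have hzs : ∀ θ, z θ ^ s = 1 := fun θ => congrFun (pow_orderOf_eq_one z) θ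
  have hpowgen : ∀ y : K, y ≠ 0 → ∃ j : ℕ, y = (γ : K) ^ j := by
    intro y hy
    obtain ⟨j, hj⟩ := mem_powers_iff_mem_zpowers.2 (hγ (Units.mk0 y hy))
    refine ⟨j, ?_⟩
    have := congrArg Units.val hj
    simpa using this.symm
  have hs1 : s ≠ 1 := by
    intro h
    rw [hs_def, orderOf_eq_one_iff] at h
    obtain ⟨θ, hθ, y, hy, hne⟩ := hnt
    apply hne
    obtain ⟨j, rfl⟩ := hpowgen y hy
    have : Ψ θ γ = 1 := congrFun h ⟨θ, hθ⟩
    rw [map_pow, this, one_pow]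
  have hζ := Complex.isPrimitiveRoot_exp s hs.ne'
  set ζ := Complex.exp (2 * Real.pi * Complex.I / s)
  have : NeZero s := ⟨hs.ne'⟩
  choose e he1 he2 using fun θ : S => hζ.eq_pow_of_pow_eq_one (hzs θ)
  -- the character ω
  have hζu : IsUnit ζ := hζ.isUnit hs.ne'
  have hroot : hζu.unit ∈ rootsOfUnity (Fintype.card Kˣ) ℂ := by
    rw [mem_rootsOfUnity, Units.ext_iff, Units.val_pow_eq_pow_val, IsUnit.unit_spec,
      Fintype.card_units, hsg, pow_mul, hζ.pow_eq_one, one_pow, Units.val_one]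
  let ω := MulChar.ofRootOfUnity hroot hγ
  have hω : ω γ = ζ := MulChar.ofRootOfUnity_spec hroot hγ
  have hΨω : ∀ θ (hθ : θ ∈ S) (y : K), y ≠ 0 → Ψ θ y = ω y ^ e ⟨θ, hθ⟩ := by
    intro θ hθ y hy
    obtain ⟨j, rfl⟩ := hpowgen y hy
    rw [map_pow, map_pow, hω, pow_right_comm, he2 ⟨θ, hθ⟩]
  let e' : K → ℕ := fun θ => if h : θ ∈ S then e ⟨θ, h⟩ else 0
  let F : K[X] := ∏ θ ∈ S, (C θ - X) ^ e' θ
  have hne : ∀ θ : K, (C θ - X : K[X]) ≠ 0 := fun θ => by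
    rw [← neg_sub, neg_ne_zero]; exact X_sub_C_ne_zero θ
  have hF0 : F ≠ 0 := Finset.prod_ne_zero_iff.2 fun θ _ => pow_ne_zero _ (hne θ)
  have hFdeg : F.natDegree ≤ S.card * N := by
    refine (natDegree_prod_le _ _).trans ?_
    rw [← smul_eq_mul]
    refine Finset.sum_le_card_nsmul _ _ _ fun θ hθ => ?_
    refine natDegree_pow_le.trans ?_
    have h1 : (C θ - X : K[X]).natDegree ≤ 1 := by
      rw [← neg_sub, natDegree_neg, natDegree_X_sub_C]
    have h2 : e' θ ≤ s := by
      simp only [e', dif_pos hθ]; exact (he1 _).le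
    nlinarith
  have hmultF : ∀ θ ∈ S, F.rootMultiplicity θ = e' θ := by
    intro θ hθ
    rw [← count_roots, roots_prod _ _ hF0, Multiset.count_bind]
    change (∑ θ' ∈ S, _) = _
    rw [Finset.sum_eq_single θ]
    · rw [roots_pow, ← neg_sub, roots_neg, roots_X_sub_C]
      simp
    · intro θ' _ hne'
      rw [roots_pow, ← neg_sub, roots_neg, roots_X_sub_C]
      simp [hne'.symm]
    · exact fun h => absurd hθ h
  have hmult : ∀ d, d ∣ s → (∀ θ, d ∣ F.rootMultiplicity θ) → d = 1 := by
    rintro d ⟨t, ht⟩ hd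
    have h1 : z ^ t = 1 := by
      ext θ
      have h2 := hd θ
      rw [hmultF θ θ.2] at h2
      simp only [e', dif_pos θ.2] at h2
      obtain ⟨w, hw⟩ := h2
      rw [Pi.pow_apply, ← he2 θ, Pi.one_apply, ← pow_mul]
      have : e θ * t = s * w := by
        rw [ht]
        change e ⟨θ, θ.2⟩ * t = _
        rw [hw]; ring
      rw [this, pow_mul, hζ.pow_eq_one, one_pow]
    have h2 := orderOf_dvd_of_pow_eq_one h1
    rw [← hs_def] at h2
    have h3 : 0 < t := by
      rcases Nat.eq_zero_or_pos t with rfl | h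
      · omega
      · exact h
    have h4 := Nat.le_of_dvd h3 h2
    have h5 : 0 < d := by
      rcases Nat.eq_zero_or_pos d with rfl | h
      · omega
      · exact h
    have : d * t ≤ 1 * t := by omega
    have := Nat.le_of_mul_le_mul_right this h3
    omega
  have hlarge' : (S.card * N + 4) * (s * (S.card * N) + s + 2) ≤ E := by
    refine le_trans ?_ hlarge
    gcongr
  have hmain := norm_sum_mulChar_eval_le hs hE hsg.symm hF0 hFdeg hmult hlarge' hγ ω
    (by rw [hω]; exact hζ.pow_eq_one) (by rw [hω]; exact hζ.ne_one (by omega))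
  have heq : ∀ x ∉ S, f x = ω (F.eval x) := by
    intro x hx
    rw [hf x hx, eval_prod, map_prod]
    refine Finset.prod_congr rfl fun θ hθ => ?_
    rw [hΨω θ hθ _ (sub_ne_zero.2 fun h : θ = x => hx (h ▸ hθ))]
    simp [e', dif_pos hθ]
  have hω1 : ∀ y, ‖ω y‖ ≤ 1 := by
    intro y
    by_cases hy : y = 0
    · rw [hy, MulChar.map_zero, norm_zero]
      exact zero_le_one
    · obtain ⟨j, rfl⟩ := hpowgen y hy
      rw [map_pow, hω, norm_pow, hζ.norm'_eq_one hs.ne', one_pow]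
  have hdiff : ‖∑ x, f x - ∑ x, ω (F.eval x)‖ ≤ 2 * S.card := by
    rw [← Finset.sum_sub_distrib, ← Finset.sum_subset (Finset.subset_univ S)]
    · refine (norm_sum_le_of_le (n := fun _ => (2 : ℝ)) _ fun x _ => ?_).trans ?_
      · exact (norm_sub_le _ _).trans (by linarith [hf1 x, hω1 (F.eval x)])
      · simp [mul_comm]
    · intro x _ hx
      rw [heq x hx, sub_self]
  have h1 := norm_add_le (∑ x, f x - ∑ x, ω (F.eval x)) (∑ x, ω (F.eval x))
  rw [sub_add_cancel] at h1
  have h2 : (s : ℝ) ≤ N := by exact_mod_cast hsle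
  have h3 : (S.card : ℝ) ≤ S.card * N := by
    have : (1 : ℝ) ≤ N := by exact_mod_cast hN
    nlinarith [(Nat.cast_nonneg S.card : (0 : ℝ) ≤ S.card)]
  have h4 : (s : ℝ) * (2 * (S.card * N) + 5) * E ≤ N * (2 * (S.card * N) + 5) * E := by
    gcongr
  push_cast at hmain
  linarith

theorem isCoprime_of_aeval_ne_zero {F K : Type*} [Field F] [Field K] [Algebra F K] {M f : F[X]}
    {S : Finset K} (hM : M.map (algebraMap F K) = ∏ θ ∈ S, (X - C θ)) :
    IsCoprime f M ↔ ∀ θ ∈ S, aeval θ f ≠ 0 := by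
  rw [← isCoprime_map (algebraMap F K), hM, IsCoprime.prod_right_iff]
  refine forall₂_congr fun θ _ => ?_
  rw [isCoprime_comm, (irreducible_X_sub_C θ).coprime_iff_not_dvd, dvd_iff_isRoot, IsRoot,
    eval_map_algebraMap]

theorem norm_sum_char_normPoly_le {F K : Type*} [Field F] [Field K] [Fintype K]
    [Algebra F K] [FiniteDimensional F K] [IsGalois F K] {N : K[X] →* F[X]}
    (hN : ∀ f, (N f).map (algebraMap F K) = ∏ σ : Gal(K/F), f.map (σ : K →+* K))
    {M : F[X]} {S : Finset K} (hM : M.map (algebraMap F K) = ∏ θ ∈ S, (X - C θ))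
    (χ : F[X] →* ℂ) (hper : ∀ f g, M ∣ f - g → χ f = χ g) {n E : ℕ} (hn : 0 < n)
    (hpow : ∀ f, IsCoprime f M → χ f ^ n = 1) (hle : ∀ f, ‖χ f‖ ≤ 1)
    (hnt : ∃ f, IsCoprime f M ∧ χ f ≠ 1) (hE : Fintype.card K = E ^ 2)
    (hlarge : (S.card * n + 4) * (n * (S.card * n) + n + 2) ≤ E) :
    ‖∑ x : K, χ (N (X - C x))‖ ≤ n * (2 * (S.card * n) + 5) * E + 3 * (S.card * n) := by
  classical
  let I : (K → K) → K[X] := fun v => Lagrange.interpolate S id v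
  have hI : ∀ v, ∀ θ ∈ S, (I v).eval θ = v θ := fun v θ hθ =>
    Lagrange.eval_interpolate_at_node (s := S) (v := id) v Function.injective_id.injOn hθ
  have hdvd : ∀ f g : K[X], (∀ θ ∈ S, f.eval θ = g.eval θ) → χ (N f) = χ (N g) := by
    intro f g h
    refine hper _ _ (normPoly_congr hN ?_)
    rw [hM]
    refine Finset.prod_dvd_of_coprime ?_ fun θ hθ => ?_
    · intro a _ b _ hab
      exact isCoprime_X_sub_C_of_isUnit_sub (sub_ne_zero.2 hab).isUnit
    · rw [dvd_iff_isRoot, IsRoot, eval_sub, h θ hθ, sub_self]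
  let Φ : (K → K) →* ℂ :=
    { toFun := fun v => χ (N (I v))
      map_one' := by
        rw [hdvd (I 1) 1 fun θ hθ => by rw [hI _ _ hθ]; simp, map_one, map_one]
      map_mul' := fun v w => by
        rw [← map_mul, ← map_mul]
        exact hdvd _ _ fun θ hθ => by rw [eval_mul, hI _ _ hθ, hI _ _ hθ, hI _ _ hθ]; rfl }
  have hΦ : ∀ v, Φ v = χ (N (I v)) := fun _ => rfl
  let Ψ : K → K →* ℂ := fun θ => Φ.comp (MonoidHom.mulSingle (fun _ => K) θ)
  have hΨ : ∀ θ y, Ψ θ y = Φ (Pi.mulSingle θ y) := fun _ _ => rfl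
  have hΦprod : ∀ v, Φ v = ∏ θ ∈ S, Ψ θ (v θ) := by
    intro v
    simp only [hΨ]
    rw [← map_prod]
    rw [hΦ, hΦ]
    refine hdvd _ _ fun θ hθ => ?_
    rw [hI _ _ hθ, hI _ _ hθ, Finset.prod_apply, Finset.prod_eq_single θ]
    · simp
    · intro b _ hb
      rw [Pi.mulSingle_eq_of_ne hb.symm]
    · exact fun h => absurd hθ h
  have hcop : ∀ v : K → K, (∀ θ ∈ S, v θ ≠ 0) → IsCoprime (N (I v)) M := by
    intro v hv
    rw [isCoprime_of_aeval_ne_zero hM]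
    intro θ hθ
    rw [aeval_normPoly hN, Finset.prod_ne_zero_iff]
    intro σ _
    rw [Ne, map_eq_zero]
    have hmem : σ⁻¹ θ ∈ S := by
      have hSroot : ∀ θ, θ ∈ S ↔ aeval θ M = 0 := by
        intro θ
        rw [← eval_map_algebraMap, hM, eval_prod, Finset.prod_eq_zero_iff]
        simp [sub_eq_zero]
      rw [hSroot] at hθ ⊢
      have := aeval_algHom_apply ((σ⁻¹ : Gal(K/F)) : K →ₐ[F] K) θ M
      rw [hθ, map_zero] at this
      exact this
    rw [hI _ _ hmem]
    exact hv _ hmem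
  refine norm_sum_prod_hom_le S hn Ψ ?_ ?_ hE hlarge _ (fun x => hle _) ?_
  · intro θ _ y hy
    rw [hΨ, hΦ]
    refine hpow _ (hcop _ fun θ' _ => ?_)
    by_cases h : θ' = θ
    · subst h; simpa using hy
    · rw [Pi.mulSingle_eq_of_ne h]; exact one_ne_zero
  · by_contra! hall
    obtain ⟨u, hu, hne⟩ := hnt
    apply hne
    obtain ⟨v, hv0, hv⟩ := exists_normPoly_eq hN hM u ((isCoprime_of_aeval_ne_zero hM).1 hu)
    rw [← hper _ _ hv]
    change Φ v = 1
    rw [hΦprod]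
    exact Finset.prod_eq_one fun θ hθ => hall θ hθ _ (hv0 θ hθ)
  · intro x _
    have := hΦprod fun θ => θ - x
    rw [← this, hΦ]
    exact hdvd _ _ fun θ hθ => by rw [hI _ _ hθ]; simp

/-- The monic polynomials of degree `n` over a finite field. -/
noncomputable def monicsOfDegree (F : Type*) [Field F] [Fintype F] (n : ℕ) : Finset F[X] := by
  classical
  exact (Finset.univ : Finset (Fin n → F)).image
    fun c => X ^ n + ((degreeLTEquiv F n).symm c : F[X])

theorem mem_monicsOfDegree {F : Type*} [Field F] [Fintype F] {n : ℕ} {f : F[X]} :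
    f ∈ monicsOfDegree F n ↔ f.Monic ∧ f.natDegree = n := by
  classical
  simp only [monicsOfDegree, Finset.mem_image, Finset.mem_univ, true_and]
  constructor
  · rintro ⟨c, rfl⟩
    have h := mem_degreeLT.1 ((degreeLTEquiv F n).symm c).2
    refine ⟨monic_X_pow_add h, ?_⟩
    rw [natDegree_add_eq_left_of_degree_lt] <;> simp [h]
  · rintro ⟨hf, rfl⟩
    have h : f - X ^ f.natDegree ∈ degreeLT F f.natDegree := by
      rw [mem_degreeLT]
      have h1 : f.degree = (X ^ f.natDegree : F[X]).degree := by
        rw [degree_X_pow, degree_eq_natDegree hf.ne_zero]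
      have := degree_sub_lt_left h1 hf.ne_zero (by simp [hf.leadingCoeff])
      rwa [degree_eq_natDegree hf.ne_zero] at this
    refine ⟨degreeLTEquiv F _ ⟨_, h⟩, ?_⟩
    simp

theorem card_monicsOfDegree (F : Type*) [Field F] [Fintype F] (n : ℕ) :
    (monicsOfDegree F n).card = Fintype.card F ^ n := by
  classical
  rw [monicsOfDegree, Finset.card_image_of_injective]
  · simp
  · intro a b h
    simpa using h

/-- The monic irreducible polynomials of degree `n` over a finite field. -/
noncomputable def primesOfDegree (F : Type*) [Field F] [Fintype F] (n : ℕ) : Finset F[X] := by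
  classical
  exact (monicsOfDegree F n).filter Irreducible

theorem mem_primesOfDegree {F : Type*} [Field F] [Fintype F] {n : ℕ} {f : F[X]} :
    f ∈ primesOfDegree F n ↔ f.Monic ∧ f.natDegree = n ∧ Irreducible f := by
  simp only [primesOfDegree, Finset.mem_filter, mem_monicsOfDegree, and_assoc]

/-- The Chebyshev-type sum over prime powers of degree `n`, twisted by `χ`. -/
noncomputable def psiSum (F : Type*) [Field F] [Fintype F] (n : ℕ) (χ : F[X] →* ℂ) : ℂ :=
  ∑ x ∈ n.divisorsAntidiagonal, x.1 * ∑ p ∈ primesOfDegree F x.1, χ p ^ x.2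

theorem card_filter_minpoly_eq {F K : Type*} [Field F] [Fintype F] [Field K] [Fintype K]
    [Algebra F K] [DecidableEq F[X]] {p : F[X]} (hp : p.Monic) (hi : Irreducible p)
    (hd : p.natDegree ∣ Module.finrank F K) :
    (Finset.univ.filter fun x : K => minpoly F x = p).card = p.natDegree := by
  classical
  have h1 := hi.natDegree_dvd_iff_dvd_X_pow_card_pow_sub_X.1 hd
  rw [← Module.natCard_eq_pow_finrank (K := F) (V := K)] at h1
  have h2 := Polynomial.map_dvd (algebraMap F K) h1
  simp only [Polynomial.map_sub, Polynomial.map_pow, map_X] at h2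
  have hsep : (p.map (algebraMap F K)).Separable :=
    (PerfectField.separable_of_irreducible hi).map
  have hspl : (p.map (algebraMap F K)).Splits := by
    refine Splits.of_dvd ?_ ?_ h2
    · have := (FiniteField.isSplittingField_sub K F).splits
      rw [Fintype.card_eq_nat_card] at this
      simpa only [Polynomial.map_sub, Polynomial.map_pow, map_X] using this
    · exact FiniteField.X_pow_card_sub_X_ne_zero K Finite.one_lt_card
  have h3 : (Finset.univ.filter fun x : K => minpoly F x = p) =
      (p.map (algebraMap F K)).roots.toFinset := by
    ext x
    rw [Finset.mem_filter, Multiset.mem_toFinset, mem_roots (map_ne_zero hp.ne_zero), IsRoot,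
      eval_map_algebraMap]
    constructor
    · rintro ⟨_, rfl⟩
      exact minpoly.aeval _ _
    · intro h
      exact ⟨Finset.mem_univ _, (minpoly.eq_of_irreducible_of_monic hi h hp).symm⟩
  rw [h3, Multiset.toFinset_card_of_nodup (nodup_roots hsep), ← hspl.natDegree_eq_card_roots,
    natDegree_map]

theorem sum_char_normPoly_eq_psiSum {F K : Type*} [Field F] [Fintype F] [Field K] [Fintype K]
    [Algebra F K] [FiniteDimensional F K] [IsGalois F K] {N : K[X] →* F[X]}
    (hN : ∀ f, (N f).map (algebraMap F K) = ∏ σ : Gal(K/F), f.map (σ : K →+* K))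
    (χ : F[X] →* ℂ) :
    ∑ x : K, χ (N (X - C x)) = psiSum F (Module.finrank F K) χ := by
  classical
  set n := Module.finrank F K with hn
  have hn0 : n ≠ 0 := Module.finrank_pos.ne'
  rw [psiSum]
  simp_rw [Finset.mul_sum]
  rw [Finset.sum_sigma']
  have hintegral : ∀ x : K, IsIntegral F x := fun x => Algebra.IsIntegral.isIntegral x
  rw [← Finset.sum_fiberwise_of_maps_to (s := Finset.univ)
    (t := n.divisorsAntidiagonal.sigma fun x => primesOfDegree F x.1)
    (g := fun x : K => (⟨((minpoly F x).natDegree, n / (minpoly F x).natDegree), minpoly F x⟩ :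
      (_ : ℕ × ℕ) × F[X]))]
  · refine Finset.sum_congr rfl ?_
    rintro ⟨⟨d, e⟩, p⟩ hx
    rw [Finset.mem_sigma, Nat.mem_divisorsAntidiagonal, mem_primesOfDegree] at hx
    obtain ⟨⟨h1, h2⟩, h3, h4, h5⟩ := hx
    dsimp only at h1 h2 h3 h4 h5 ⊢
    have hd : 0 < d := by rw [← h4]; exact h5.natDegree_pos
    have h6 : (Finset.univ.filter fun x : K =>
        (⟨((minpoly F x).natDegree, n / (minpoly F x).natDegree), minpoly F x⟩ :
        (_ : ℕ × ℕ) × F[X]) = ⟨(d, e), p⟩) = Finset.univ.filter fun x : K => minpoly F x = p := by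
      ext x
      simp only [Finset.mem_filter, Finset.mem_univ, true_and, Sigma.mk.injEq, heq_eq_eq,
        Prod.mk.injEq, and_iff_right_iff_imp]
      rintro rfl
      refine ⟨h4, ?_⟩
      rw [h4, ← h1, Nat.mul_div_cancel_left _ hd]
    rw [h6, Finset.sum_congr rfl (g := fun _ => χ p ^ e)]
    · rw [Finset.sum_const, card_filter_minpoly_eq h3 h5 (by rw [h4, ← hn, ← h1]; exact ⟨e, rfl⟩),
        h4, nsmul_eq_mul]
    · intro x hx
      obtain ⟨e', he, he'⟩ := normPoly_X_sub_C hN x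
      rw [(Finset.mem_filter.1 hx).2] at he he'
      rw [he, map_pow]
      congr 1
      rw [h4, ← hn, ← h1, mul_comm] at he'
      exact Nat.eq_of_mul_eq_mul_left hd he'
  · intro x _
    rw [Finset.mem_sigma, Nat.mem_divisorsAntidiagonal, mem_primesOfDegree]
    exact ⟨⟨Nat.mul_div_cancel' (minpoly.degree_dvd (hintegral x)), hn0⟩,
      minpoly.monic (hintegral x), rfl, minpoly.irreducible (hintegral x)⟩

theorem FiniteField.exists_extension (F : Type*) [Field F] [Fintype F] {n : ℕ} (hn : n ≠ 0) :
    ∃ (K : Type) (_ : Field K) (_ : Fintype K) (_ : Algebra F K), FiniteDimensional F K ∧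
      IsGalois F K ∧ Module.finrank F K = n := by
  obtain ⟨p, hp⟩ := CharP.exists F
  have : Fact (Nat.Prime p) := ⟨CharP.char_is_prime F p⟩
  have : NeZero n := ⟨hn⟩
  exact ⟨Extension F p n, inferInstance, Fintype.ofFinite _, inferInstance, inferInstance,
    inferInstance, finrank_extension F p n⟩

theorem norm_psiSum_le_card_pow {F : Type*} [Field F] [Fintype F] {n : ℕ} (hn : n ≠ 0)
    {χ : F[X] →* ℂ} (hle : ∀ f, ‖χ f‖ ≤ 1) : ‖psiSum F n χ‖ ≤ (Fintype.card F : ℝ) ^ n := by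
  obtain ⟨K, _, _, _, _, _, hK⟩ := FiniteField.exists_extension F hn
  obtain ⟨N, hN⟩ := exists_normPoly (F := F) (K := K)
  rw [← hK, ← sum_char_normPoly_eq_psiSum hN χ]
  refine (norm_sum_le_of_le (n := fun _ => (1 : ℝ)) _ fun x _ => hle _).trans ?_
  rw [Finset.sum_const, Finset.card_univ, Module.card_eq_pow_finrank (K := F) (V := K)]
  simp

theorem psiSum_one (F : Type*) [Field F] [Fintype F] {n : ℕ} (hn : n ≠ 0) :
    psiSum F n 1 = (Fintype.card F : ℂ) ^ n := by
  obtain ⟨K, _, _, _, _, _, hK⟩ := FiniteField.exists_extension F hn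
  obtain ⟨N, hN⟩ := exists_normPoly (F := F) (K := K)
  rw [← hK, ← sum_char_normPoly_eq_psiSum hN 1]
  simp [Module.card_eq_pow_finrank (K := F) (V := K)]

theorem splits_map_of_factorial_natDegree_dvd_finrank {F K : Type*} [Field F] [Fintype F] [Field K]
    [Fintype K] [Algebra F K] {M : F[X]} (hM : M ≠ 0)
    (hd : M.natDegree.factorial ∣ Module.finrank F K) : (M.map (algebraMap F K)).Splits := by
  classical
  have h0 := UniqueFactorizationMonoid.prod_normalizedFactors hM
  obtain ⟨u, hu⟩ := h0
  rw [← hu, Polynomial.map_mul, Polynomial.map_multiset_prod]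
  refine Splits.mul (Splits.multisetProd ?_) ?_
  · intro f hf
    obtain ⟨p, hp, rfl⟩ := Multiset.mem_map.1 hf
    have hi := UniqueFactorizationMonoid.irreducible_of_normalized_factor p hp
    have hdvd := UniqueFactorizationMonoid.dvd_of_mem_normalizedFactors hp
    have h1 := hi.natDegree_dvd_iff_dvd_X_pow_card_pow_sub_X.1
      ((Nat.dvd_factorial hi.natDegree_pos (natDegree_le_of_dvd hdvd hM)).trans hd)
    rw [← Module.natCard_eq_pow_finrank (K := F) (V := K)] at h1
    have h2 := Polynomial.map_dvd (algebraMap F K) h1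
    simp only [Polynomial.map_sub, Polynomial.map_pow, map_X] at h2
    refine Splits.of_dvd ?_ ?_ h2
    · have := (FiniteField.isSplittingField_sub K F).splits
      rw [Fintype.card_eq_nat_card] at this
      simpa only [Polynomial.map_sub, Polynomial.map_pow, map_X] using this
    · exact FiniteField.X_pow_card_sub_X_ne_zero K Finite.one_lt_card
  · have := u.isUnit.map (mapRingHom (algebraMap F K))
    rw [coe_mapRingHom] at this
    obtain ⟨c, -, hc⟩ := isUnit_iff.1 this
    rw [← hc]
    exact Splits.C c

theorem exists_norm_psiSum_le {F : Type*} [Field F] [Fintype F] {M : F[X]} (hM : M.Monic)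
    (hsq : Squarefree M) (χ : F[X] →* ℂ) (hper : ∀ f g, M ∣ f - g → χ f = χ g) {n : ℕ}
    (hn : 0 < n) (hpow : ∀ f, IsCoprime f M → χ f ^ n = 1) (hle : ∀ f, ‖χ f‖ ≤ 1)
    (hnt : ∃ f, IsCoprime f M ∧ χ f ≠ 1) :
    ∃ C : ℝ, ∀ j > 0, ‖psiSum F (2 * (M.natDegree.factorial * j)) χ‖ ≤
      C * (Fintype.card F : ℝ) ^ (M.natDegree.factorial * j) := by
  classical
  set d := M.natDegree with hd
  set A : ℕ := (d * n + 4) * (n * (d * n) + n + 2) with hA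
  refine ⟨n * (2 * (d * n) + 5) + 3 * (d * n) + A, fun j hj => ?_⟩
  set e := d.factorial * j with he
  have he0 : e ≠ 0 := (Nat.mul_pos d.factorial_pos hj).ne'
  have h2e : 2 * e ≠ 0 := by omega
  set E := Fintype.card F ^ e with hE
  have hE1 : (1 : ℝ) ≤ E := by
    rw [hE]; exact_mod_cast Nat.one_le_pow _ _ Fintype.card_pos
  rw [← Nat.cast_pow, ← hE]
  rcases lt_or_ge E A with hlt | hge
  · refine (norm_psiSum_le_card_pow h2e hle).trans ?_
    have h1 : ((Fintype.card F : ℝ)) ^ (2 * e) = E * E := by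
      rw [hE, two_mul, pow_add]; push_cast; ring
    rw [h1]
    have h2 : (E : ℝ) ≤ A := by exact_mod_cast hlt.le
    have h3 : (0 : ℝ) ≤ n * (2 * (d * n) + 5) + 3 * (d * n) := by positivity
    nlinarith
  · obtain ⟨K, _, _, _, _, _, hK⟩ := FiniteField.exists_extension F h2e
    obtain ⟨N, hN⟩ := exists_normPoly (F := F) (K := K)
    have hspl : (M.map (algebraMap F K)).Splits := by
      refine splits_map_of_factorial_natDegree_dvd_finrank hM.ne_zero ?_
      rw [hK, he]
      exact Dvd.intro_left (2 * j) (by ring)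
    have hnodup : (M.map (algebraMap F K)).roots.Nodup :=
      nodup_roots (PerfectField.separable_iff_squarefree.2 hsq).map
    have hS : M.map (algebraMap F K) =
        ∏ θ ∈ (M.map (algebraMap F K)).roots.toFinset, (X - C θ) := by
      conv_lhs => rw [hspl.eq_prod_roots_of_monic (hM.map _)]
      rw [Finset.prod_eq_multiset_prod, Multiset.toFinset_val, hnodup.dedup]
    have hcard : (M.map (algebraMap F K)).roots.toFinset.card = d := by
      rw [Multiset.toFinset_card_of_nodup hnodup, ← hspl.natDegree_eq_card_roots, natDegree_map]
    have := norm_sum_char_normPoly_le hN hS χ hper hn hpow hle hnt (E := E) ?_ ?_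
    · rw [sum_char_normPoly_eq_psiSum hN χ, hK, hcard] at this
      refine this.trans ?_
      have h2 : (0 : ℝ) ≤ A := by positivity
      have h3 : (0 : ℝ) ≤ 3 * (d * n) := by positivity
      nlinarith
    · rw [Module.card_eq_pow_finrank (K := F) (V := K), hK, hE, mul_comm, pow_mul]
    · rw [hcard]; exact hge

theorem sum_natDegree_prime_pow_dvd {F : Type*} [Field F] [Fintype F] [DecidableEq F[X]]
    [DecidableRel (· ∣ · : F[X] → F[X] → Prop)] {n : ℕ}
    {f : F[X]} (hf : f ∈ monicsOfDegree F n) :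
    ∑ y ∈ ((Finset.Icc 1 n).sigma fun j => j.divisorsAntidiagonal).sigma
      (fun x => (primesOfDegree F x.2.1).filter fun p => p ^ x.2.2 ∣ f), y.1.2.1 = n := by
  classical
  rw [mem_monicsOfDegree] at hf
  obtain ⟨hm, hn⟩ := hf
  have hf0 := hm.ne_zero
  have h1 : ∑ p ∈ (UniqueFactorizationMonoid.normalizedFactors f).toFinset,
      (UniqueFactorizationMonoid.normalizedFactors f).count p * p.natDegree = n := by
    rw [← hn]
    have hmon : ∀ p ∈ UniqueFactorizationMonoid.normalizedFactors f, p.Monic := by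
      intro p hp
      rw [← UniqueFactorizationMonoid.normalize_normalized_factor p hp]
      exact monic_normalize
        (UniqueFactorizationMonoid.irreducible_of_normalized_factor p hp).ne_zero
    have h2 := UniqueFactorizationMonoid.prod_normalizedFactors hf0
    have h3 := eq_of_monic_of_associated (monic_multiset_prod_of_monic _ id
      (by simpa using hmon)) hm (by simpa using h2)
    conv_rhs => rw [← h3, natDegree_multiset_prod_of_monic _ (by simpa using hmon)]
    rw [Multiset.map_id, Finset.sum_multiset_map_count]
    simp
  refine Eq.trans ?_ h1
  have h4 : ∀ p, (UniqueFactorizationMonoid.normalizedFactors f).count p * p.natDegree =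
      ∑ e ∈ Finset.Icc 1 ((UniqueFactorizationMonoid.normalizedFactors f).count p),
        p.natDegree := by
    intro p; simp
  rw [Finset.sum_congr rfl fun p _ => h4 p, Finset.sum_sigma']
  have hkey : ∀ p : F[X], p.Monic → Irreducible p → ∀ e : ℕ, p ^ e ∣ f ↔
      e ≤ (UniqueFactorizationMonoid.normalizedFactors f).count p := by
    intro p hp hi e
    rw [UniqueFactorizationMonoid.dvd_iff_normalizedFactors_le_normalizedFactors
      (pow_ne_zero _ hp.ne_zero) hf0, UniqueFactorizationMonoid.normalizedFactors_pow,
      UniqueFactorizationMonoid.normalizedFactors_irreducible hi, hp.normalize_eq_self,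
      Multiset.nsmul_singleton, ← Multiset.le_count_iff_replicate_le]
  refine Finset.sum_bij' (fun y _ => ⟨y.2, y.1.2.2⟩)
    (fun z _ => ⟨⟨z.1.natDegree * z.2, (z.1.natDegree, z.2)⟩, z.1⟩) ?_ ?_ ?_ ?_ ?_
  · rintro ⟨⟨j, d, e⟩, p⟩ hy
    simp only [Finset.mem_sigma, Finset.mem_Icc, Nat.mem_divisorsAntidiagonal, Finset.mem_filter,
      mem_primesOfDegree, Multiset.mem_toFinset] at hy ⊢
    obtain ⟨⟨⟨h5, h6⟩, h7, h8⟩, ⟨h9, h10, h11⟩, h12⟩ := hy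
    rw [hkey p h9 h11] at h12
    have he : 1 ≤ e := by
      rcases Nat.eq_zero_or_pos e with rfl | h
      · simp at h7; omega
      · exact h
    exact ⟨Multiset.count_pos.1 (by omega), he, h12⟩
  · rintro ⟨p, e⟩ hz
    simp only [Finset.mem_sigma, Finset.mem_Icc, Nat.mem_divisorsAntidiagonal, Finset.mem_filter,
      mem_primesOfDegree, Multiset.mem_toFinset] at hz ⊢
    obtain ⟨h5, h6, h7⟩ := hz
    have hi := UniqueFactorizationMonoid.irreducible_of_normalized_factor p h5
    have hpm : p.Monic := by
      rw [← UniqueFactorizationMonoid.normalize_normalized_factor p h5]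
      exact monic_normalize hi.ne_zero
    have hdvd := (hkey p hpm hi e).2 h7
    have h8 : 0 < p.natDegree * e := Nat.mul_pos hi.natDegree_pos h6
    refine ⟨⟨⟨h8, ?_⟩, trivial, h8.ne'⟩, ⟨hpm, trivial, hi⟩, hdvd⟩
    have := natDegree_le_of_dvd hdvd hf0
    rw [natDegree_pow, hn] at this
    rwa [mul_comm]
  · rintro ⟨⟨j, d, e⟩, p⟩ hy
    simp only [Finset.mem_sigma, Finset.mem_Icc, Nat.mem_divisorsAntidiagonal, Finset.mem_filter,
      mem_primesOfDegree] at hy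
    obtain ⟨⟨⟨h5, h6⟩, h7, h8⟩, ⟨h9, h10, h11⟩, h12⟩ := hy
    subst h10
    subst h7
    rfl
  · rintro ⟨p, e⟩ hz
    rfl
  · rintro ⟨⟨j, d, e⟩, p⟩ hy
    simp only [Finset.mem_sigma, Finset.mem_filter, mem_primesOfDegree] at hy
    exact hy.2.1.2.1.symm

/-- The coefficients of the `L`-series of `χ`. -/
noncomputable def lCoeff (F : Type*) [Field F] [Fintype F] (n : ℕ) (χ : F[X] →* ℂ) : ℂ :=
  ∑ f ∈ monicsOfDegree F n, χ f

theorem sum_monics_dvd {F : Type*} [Field F] [Fintype F]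
    [DecidableRel (· ∣ · : F[X] → F[X] → Prop)] {a n : ℕ} (ha : a ≤ n) {g : F[X]}
    (hg : g ∈ monicsOfDegree F a) (φ : F[X] → ℂ) :
    ∑ f ∈ monicsOfDegree F n with g ∣ f, φ f = ∑ f ∈ monicsOfDegree F (n - a), φ (g * f) := by
  rw [mem_monicsOfDegree] at hg
  symm
  refine Finset.sum_bij (fun f _ => g * f) ?_ ?_ ?_ ?_
  · intro f hf
    rw [mem_monicsOfDegree] at hf
    rw [Finset.mem_filter, mem_monicsOfDegree, hg.1.natDegree_mul hf.1, hg.2, hf.2]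
    exact ⟨⟨hg.1.mul hf.1, by omega⟩, dvd_mul_right _ _⟩
  · intro f _ f' _ h
    exact mul_left_cancel₀ hg.1.ne_zero h
  · intro f hf
    rw [Finset.mem_filter, mem_monicsOfDegree] at hf
    obtain ⟨⟨h1, h2⟩, f', rfl⟩ := hf
    have h3 := hg.1.of_mul_monic_left h1
    refine ⟨f', ?_, rfl⟩
    rw [hg.1.natDegree_mul h3, hg.2] at h2
    rw [mem_monicsOfDegree]
    exact ⟨h3, by omega⟩
  · intro f _; rfl

theorem lCoeff_newton {F : Type*} [Field F] [Fintype F] (n : ℕ) (χ : F[X] →* ℂ) :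
    n * lCoeff F n χ = ∑ j ∈ Finset.Icc 1 n, psiSum F j χ * lCoeff F (n - j) χ := by
  classical
  have h1 : ∀ j ∈ Finset.Icc 1 n, psiSum F j χ * lCoeff F (n - j) χ =
      ∑ x ∈ j.divisorsAntidiagonal, ∑ p ∈ primesOfDegree F x.1,
        ∑ f ∈ monicsOfDegree F n, if p ^ x.2 ∣ f then x.1 * χ f else 0 := by
    intro j hj
    rw [psiSum, Finset.sum_mul]
    refine Finset.sum_congr rfl fun x hx => ?_
    rw [Finset.mul_sum, Finset.sum_mul]
    refine Finset.sum_congr rfl fun p hp => ?_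
    rw [← Finset.sum_filter]
    rw [Nat.mem_divisorsAntidiagonal] at hx
    rw [mem_primesOfDegree] at hp
    rw [sum_monics_dvd (a := j) (Finset.mem_Icc.1 hj).2, lCoeff, Finset.mul_sum]
    · refine Finset.sum_congr rfl fun f _ => ?_
      rw [map_mul, map_pow]; ring
    · rw [mem_monicsOfDegree, natDegree_pow, hp.2.1, mul_comm]
      exact ⟨hp.1.pow _, hx.1⟩
  rw [Finset.sum_congr rfl h1, Finset.sum_sigma', Finset.sum_sigma', Finset.sum_comm, lCoeff,
    Finset.mul_sum]
  refine Finset.sum_congr rfl fun f hf => ?_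
  have h2 := sum_natDegree_prime_pow_dvd hf
  conv_lhs => rw [← h2]
  push_cast
  rw [Finset.sum_mul, ← Finset.sum_filter]
  refine Finset.sum_congr ?_ fun _ _ => rfl
  ext ⟨x, p⟩
  simp only [Finset.mem_sigma, Finset.mem_filter, and_assoc]

theorem lCoeff_zero (F : Type*) [Field F] [Fintype F] (χ : F[X] →* ℂ) : lCoeff F 0 χ = 1 := by
  have : monicsOfDegree F 0 = {1} := by
    ext f
    rw [mem_monicsOfDegree, Finset.mem_singleton]
    constructor
    · rintro ⟨h1, h2⟩
      exact h1.natDegree_eq_zero.1 h2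
    · rintro rfl
      exact ⟨monic_one, natDegree_one⟩
  rw [lCoeff, this, Finset.sum_singleton, map_one]

theorem lCoeff_eq_zero {F : Type*} [Field F] [Fintype F] {M : F[X]} (hM : M.Monic)
    (χ : F[X] →* ℂ) (hper : ∀ f g, M ∣ f - g → χ f = χ g)
    (hnt : ∃ f, IsCoprime f M ∧ χ f ≠ 1) {n : ℕ} (hn : M.natDegree ≤ n) : lCoeff F n χ = 0 := by
  classical
  obtain ⟨u, hu, hu1⟩ := hnt
  let T : F[X] → F[X] := fun f => M * (f /ₘ M) + (u * f) %ₘ M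
  have hT1 : ∀ f, M ∣ T f - u * f := by
    intro f
    refine ⟨f /ₘ M - (u * f) /ₘ M, ?_⟩
    have h1 := modByMonic_add_div (u * f) M
    linear_combination h1
  have hT2 : ∀ f ∈ monicsOfDegree F n, T f ∈ monicsOfDegree F n := by
    intro f hf
    rw [mem_monicsOfDegree] at hf ⊢
    have h1 : T f = f + ((u * f) %ₘ M - f %ₘ M) := by
      have h1 := modByMonic_add_div f M
      linear_combination h1
    have h2 : ((u * f) %ₘ M - f %ₘ M).degree < f.degree := by
      refine lt_of_lt_of_le (b := M.degree) ?_ ?_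
      · exact (degree_sub_le _ _).trans_lt (max_lt (degree_modByMonic_lt _ hM)
          (degree_modByMonic_lt _ hM))
      · rw [degree_eq_natDegree hM.ne_zero, degree_eq_natDegree hf.1.ne_zero, hf.2]
        exact_mod_cast hn
    rw [h1]
    exact ⟨hf.1.add_of_left h2, by rw [natDegree_add_eq_left_of_degree_lt h2, hf.2]⟩
  have hT3 : ∀ f g, T f = T g → f = g := by
    intro f g h
    have h0 := (div_modByMonic_unique (f := T f) (f /ₘ M) ((u * f) %ₘ M) hM
      ⟨add_comm _ _, degree_modByMonic_lt _ hM⟩).1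
    have h0' := (div_modByMonic_unique (f := T g) (g /ₘ M) ((u * g) %ₘ M) hM
      ⟨add_comm _ _, degree_modByMonic_lt _ hM⟩).1
    have h1 : f /ₘ M = g /ₘ M := by rw [← h0, ← h0', h]
    have h2 : M ∣ u * (f - g) := by
      have := dvd_sub (hT1 g) (hT1 f)
      rw [h] at this
      convert this using 1
      ring
    have h3 := hu.symm.dvd_of_dvd_mul_left h2
    have h4 : f %ₘ M = g %ₘ M := by
      rw [← sub_eq_zero, ← sub_modByMonic]
      exact (modByMonic_eq_zero_iff_dvd hM).2 h3
    rw [← modByMonic_add_div f M, ← modByMonic_add_div g M, h1, h4]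
  have h1 : lCoeff F n χ = χ u * lCoeff F n χ := by
    rw [lCoeff, Finset.mul_sum]
    symm
    refine Finset.sum_bij (fun f _ => T f) hT2 (fun f _ g _ h => hT3 f g h) ?_ ?_
    · intro b hb
      obtain ⟨a, ha, hab⟩ := Finset.surj_on_of_inj_on_of_card_le (fun f _ => T f) hT2
        (fun f g _ _ h => hT3 f g h) le_rfl b hb
      exact ⟨a, ha, hab.symm⟩
    · intro f _
      rw [hper _ _ (hT1 f), map_mul]
  have h2 : (χ u - 1) * lCoeff F n χ = 0 := by linear_combination -h1
  exact (mul_eq_zero.1 h2).resolve_left (sub_ne_zero.2 hu1)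

theorem exists_re_pow_ge {ι : Type*} [Fintype ι] (β : ι → ℂ) (n : ℕ) :
    ∃ j ≥ n, 1 ≤ j ∧ ∀ i, ‖β i‖ ^ j / 2 ≤ (β i ^ j).re := by
  let w : ℕ → ι → ℂ := fun j i => (β i / ‖β i‖) ^ j
  have hw : ∀ j, w j ∈ Metric.closedBall (0 : ι → ℂ) 1 := by
    intro j
    rw [mem_closedBall_zero_iff, pi_norm_le_iff_of_nonneg zero_le_one]
    intro i
    rw [norm_pow, norm_div, Complex.norm_real, norm_norm]
    exact pow_le_one₀ (by positivity) (div_self_le_one _)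
  obtain ⟨a, -, φ, hφ, hlim⟩ := (isCompact_closedBall (0 : ι → ℂ) 1).tendsto_subseq hw
  rw [Metric.tendsto_atTop] at hlim
  obtain ⟨N, hN⟩ := hlim (1 / 4) (by norm_num)
  set i₂ := N + n + 1 + φ N with hi₂
  refine ⟨φ i₂ - φ N, ?_, ?_, ?_⟩
  · have := hφ.id_le i₂
    simp only [id] at this
    omega
  · have := hφ.id_le i₂
    simp only [id] at this
    omega
  · intro i
    have hle : φ N < φ i₂ := hφ (by omega)
    set j := φ i₂ - φ N with hj
    rcases eq_or_ne (β i) 0 with h0 | h0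
    · rw [h0, norm_zero, zero_pow (by omega), zero_pow (by omega)]
      simp
    have hn0 : (‖β i‖ : ℂ) ≠ 0 := by exact_mod_cast norm_ne_zero_iff.2 h0
    have h1 : dist (w (φ i₂)) (w (φ N)) < 1 / 2 := by
      have := dist_triangle_right (w (φ i₂)) (w (φ N)) a
      have h2 := hN i₂ (by omega)
      have h3 := hN N le_rfl
      simp only [Function.comp] at h2 h3
      linarith
    have h2 := (dist_le_pi_dist (w (φ i₂)) (w (φ N)) i).trans_lt h1
    have h3 : w (φ i₂) i = w (φ N) i * w j i := by
      simp only [w]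
      rw [← pow_add]
      congr 1
      omega
    have hnw : ‖w (φ N) i‖ = 1 := by
      simp only [w]
      rw [norm_pow, norm_div, Complex.norm_real, norm_norm, div_self (norm_ne_zero_iff.2 h0),
        one_pow]
    rw [h3, dist_eq_norm, ← mul_sub_one, norm_mul, hnw, one_mul] at h2
    have h4 := (Complex.abs_re_le_norm (w j i - 1)).trans_lt h2
    rw [Complex.sub_re, Complex.one_re, abs_lt] at h4
    have h5 : β i ^ j = ((‖β i‖ ^ j : ℝ) : ℂ) * w j i := by
      simp only [w]
      push_cast
      rw [← mul_pow, mul_div_cancel₀ _ hn0]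
    rw [h5, Complex.re_ofReal_mul]
    have h6 : 0 ≤ ‖β i‖ ^ j := by positivity
    nlinarith

theorem norm_le_one_of_norm_sum_pow_le {ι : Type*} [Fintype ι] (β : ι → ℂ) {c : ℝ}
    (h : ∀ j > 0, ‖∑ i, β i ^ j‖ ≤ c) (i : ι) : ‖β i‖ ≤ 1 := by
  by_contra! hi
  obtain ⟨n, hn⟩ := pow_unbounded_of_one_lt (2 * c) hi
  obtain ⟨j, hjn, hj1, hj⟩ := exists_re_pow_ge β n
  have h1 := (Complex.re_le_norm _).trans (h j hj1)
  rw [Complex.re_sum] at h1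
  have h2 : (β i ^ j).re ≤ ∑ i, (β i ^ j).re :=
    Finset.single_le_sum (f := fun i => (β i ^ j).re)
      (fun i' _ => le_trans (by positivity) (hj i')) (Finset.mem_univ i)
  have h3 := hj i
  have h4 := pow_le_pow_right₀ hi.le hjn
  linarith

theorem exists_eq_prod_one_sub_C_mul_X (d : ℕ) (L : ℂ[X]) (hd : L.natDegree ≤ d)
    (h0 : L.coeff 0 = 1) : ∃ (r : ℕ) (α : Fin r → ℂ), r ≤ d ∧ L = ∏ i, (1 - C (α i) * X) := by
  induction d generalizing L with
  | zero =>
    refine ⟨0, Fin.elim0, le_rfl, ?_⟩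
    rw [eq_C_of_natDegree_le_zero hd, h0]
    simp
  | succ d ih =>
    by_cases hdeg : L.natDegree = 0
    · obtain ⟨r, α, hr, h⟩ := ih L (by omega) h0
      exact ⟨r, α, by omega, h⟩
    · obtain ⟨z, hz⟩ := IsAlgClosed.exists_root L (fun h => hdeg (natDegree_eq_of_degree_eq_some h))
      obtain ⟨Q, hQ⟩ := dvd_iff_isRoot.2 hz
      have hz0 : z ≠ 0 := by
        rintro rfl
        rw [IsRoot, ← coeff_zero_eq_eval_zero, h0] at hz
        exact one_ne_zero hz
      have hL : L = (1 - C z⁻¹ * X) * (C (-z) * Q) := by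
        rw [hQ]
        have : (C z⁻¹ : ℂ[X]) * C z = 1 := by rw [← C_mul, inv_mul_cancel₀ hz0, C_1]
        rw [C_neg]
        linear_combination (-X * Q) * this
      have hL0 : L ≠ 0 := by rintro rfl; simp at h0
      have hQ0 : Q ≠ 0 := by rintro rfl; simp at hQ; exact hL0 hQ
      have hQd : (C (-z) * Q).natDegree ≤ d := by
        rw [natDegree_C_mul (neg_ne_zero.2 hz0)]
        have := congrArg natDegree hQ
        rw [natDegree_mul (X_sub_C_ne_zero z) hQ0, natDegree_X_sub_C] at this
        omega
      have hQ1 : (C (-z) * Q).coeff 0 = 1 := by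
        rw [hL, mul_coeff_zero] at h0
        simpa using h0
      obtain ⟨r, α, hr, h⟩ := ih (C (-z) * Q) hQd hQ1
      refine ⟨r + 1, Fin.cons z⁻¹ α, by omega, ?_⟩
      rw [Fin.prod_univ_succ, hL, h]
      rfl

theorem newton_prod_one_sub_C_mul_X {ι : Type*} (α : ι → ℂ) (s : Finset ι) :
    PowerSeries.X * PowerSeries.derivative ℂ
      ((∏ i ∈ s, (1 - C (α i) * X) : ℂ[X]) : PowerSeries ℂ) =
    PowerSeries.mk (fun j => if j = 0 then 0 else - ∑ i ∈ s, α i ^ j) *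
      ((∏ i ∈ s, (1 - C (α i) * X) : ℂ[X]) : PowerSeries ℂ) := by
  classical
  induction s using Finset.induction_on with
  | empty =>
    have h0 : PowerSeries.mk (fun j => if j = 0 then (0 : ℂ) else - ∑ i ∈ ∅, α i ^ j) = 0 := by
      ext j; simp
    rw [h0, Finset.prod_empty, Polynomial.coe_one, PowerSeries.derivative_one]
    simp
  | insert a s ha ih =>
    have h1 : PowerSeries.mk (fun j => if j = 0 then (0 : ℂ) else - ∑ i ∈ insert a s, α i ^ j) =
        PowerSeries.mk (fun j => if j = 0 then (0 : ℂ) else - α a ^ j) +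
        PowerSeries.mk (fun j => if j = 0 then (0 : ℂ) else - ∑ i ∈ s, α i ^ j) := by
      ext j
      rw [map_add, PowerSeries.coeff_mk, PowerSeries.coeff_mk, PowerSeries.coeff_mk]
      split_ifs
      · simp
      · rw [Finset.sum_insert ha, neg_add]
    have h2 : PowerSeries.X * PowerSeries.derivative ℂ ((1 - C (α a) * X : ℂ[X]) : PowerSeries ℂ) =
        PowerSeries.mk (fun j => if j = 0 then (0 : ℂ) else - α a ^ j) *
          ((1 - C (α a) * X : ℂ[X]) : PowerSeries ℂ) := by
      rw [PowerSeries.derivative_coe]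
      have h3 : derivative (1 - C (α a) * X) = C (-α a) := by simp
      rw [h3]
      ext j
      rw [Polynomial.coe_sub, Polynomial.coe_mul, Polynomial.coe_one, Polynomial.coe_C,
        Polynomial.coe_C, Polynomial.coe_X, mul_sub, mul_one, mul_left_comm, map_sub,
        PowerSeries.coeff_C_mul]
      rcases j with _ | j
      · simp
      · rw [PowerSeries.coeff_succ_X_mul, PowerSeries.coeff_succ_mul_X, PowerSeries.coeff_mk,
          PowerSeries.coeff_mk, PowerSeries.coeff_C]
        rcases j with _ | j
        · simp
        · simp only [Nat.add_eq_zero_iff, one_ne_zero, and_false, if_false]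
          ring
    rw [Finset.prod_insert ha, Polynomial.coe_mul, Derivation.leibniz, h1]
    simp only [smul_eq_mul]
    linear_combination ((1 - C (α a) * X : ℂ[X]) : PowerSeries ℂ) * ih +
      ((∏ i ∈ s, (1 - C (α i) * X) : ℂ[X]) : PowerSeries ℂ) * h2

theorem eq_of_newton {l a b : ℕ → ℂ} (h0 : l 0 = 1)
    (ha : ∀ n, n * l n = ∑ j ∈ Finset.Icc 1 n, a j * l (n - j))
    (hb : ∀ n, n * l n = ∑ j ∈ Finset.Icc 1 n, b j * l (n - j)) (n : ℕ) (hn : 1 ≤ n) :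
    a n = b n := by
  induction n using Nat.strong_induction_on with
  | _ n ih =>
    obtain ⟨n, rfl⟩ : ∃ n', n = n' + 1 := ⟨n - 1, by omega⟩
    have h1 := ha (n + 1)
    rw [hb (n + 1), Finset.sum_Icc_succ_top (by omega), Finset.sum_Icc_succ_top (by omega),
      Nat.sub_self, h0] at h1
    have h2 : ∑ j ∈ Finset.Icc 1 n, b j * l (n + 1 - j) =
        ∑ j ∈ Finset.Icc 1 n, a j * l (n + 1 - j) := by
      refine Finset.sum_congr rfl fun j hj => ?_
      rw [Finset.mem_Icc] at hj
      rw [ih j (by omega) hj.1]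
    rw [h2] at h1
    linear_combination -h1

theorem exists_psiSum_eq {F : Type*} [Field F] [Fintype F] {M : F[X]} (hM : M.Monic)
    (χ : F[X] →* ℂ) (hper : ∀ f g, M ∣ f - g → χ f = χ g)
    (hnt : ∃ f, IsCoprime f M ∧ χ f ≠ 1) :
    ∃ (r : ℕ) (α : Fin r → ℂ), r ≤ M.natDegree ∧
      ∀ n, 1 ≤ n → psiSum F n χ = - ∑ i, α i ^ n := by
  classical
  let L : ℂ[X] := ∑ j ∈ Finset.range (M.natDegree + 1), monomial j (lCoeff F j χ)
  have hL : ∀ j, L.coeff j = lCoeff F j χ := by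
    intro j
    simp only [L, finsetSum_coeff, coeff_monomial, Finset.sum_ite_eq', Finset.mem_range]
    split_ifs with h
    · rfl
    · exact (lCoeff_eq_zero hM χ hper hnt (by omega)).symm
  obtain ⟨r, α, hr, hα⟩ := exists_eq_prod_one_sub_C_mul_X M.natDegree L
    (natDegree_le_iff_coeff_eq_zero.2 fun j hj => by
      rw [hL, lCoeff_eq_zero hM χ hper hnt hj.le]) (by rw [hL, lCoeff_zero])
  refine ⟨r, α, hr, fun n hn => ?_⟩
  refine eq_of_newton (l := fun j => lCoeff F j χ) (lCoeff_zero F χ) (fun n => lCoeff_newton n χ)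
    (b := fun n => - ∑ i, α i ^ n) (fun n => ?_) n hn
  have h1 := congrArg (PowerSeries.coeff n) (newton_prod_one_sub_C_mul_X α Finset.univ)
  rw [← hα] at h1
  have h2 : PowerSeries.coeff n (PowerSeries.X * PowerSeries.derivative ℂ (L : PowerSeries ℂ)) =
      n * lCoeff F n χ := by
    rcases n with _ | n
    · simp
    · rw [PowerSeries.coeff_succ_X_mul, PowerSeries.coeff_derivative, Polynomial.coeff_coe, hL]
      push_cast; ring
  rw [h2, PowerSeries.coeff_mul, Finset.Nat.sum_antidiagonal_eq_sum_range_succ_mk,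
    Finset.sum_range_succ'] at h1
  rw [h1]
  have h3 : Finset.Icc 1 n = (Finset.range n).image (· + 1) := by
    ext j
    simp only [Finset.mem_Icc, Finset.mem_image, Finset.mem_range]
    exact ⟨fun h => ⟨j - 1, by omega, by omega⟩, by rintro ⟨i, hi, rfl⟩; omega⟩
  rw [h3, Finset.sum_image (by intro a _ b _ h; simpa using h)]
  simp [hL]

theorem norm_psiSum_le {F : Type*} [Field F] [Fintype F] {M : F[X]} (hM : M.Monic)
    (hsq : Squarefree M) (χ : F[X] →* ℂ) (hper : ∀ f g, M ∣ f - g → χ f = χ g) {n : ℕ}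
    (hn : 0 < n) (hpow : ∀ f, IsCoprime f M → χ f ^ n = 1) (hle : ∀ f, ‖χ f‖ ≤ 1)
    (hnt : ∃ f, IsCoprime f M ∧ χ f ≠ 1) {e : ℕ} (he : 1 ≤ e) :
    ‖psiSum F (2 * e) χ‖ ≤ M.natDegree * (Fintype.card F : ℝ) ^ e := by
  obtain ⟨c, hc⟩ := exists_norm_psiSum_le hM hsq χ hper hn hpow hle hnt
  obtain ⟨r, α, hr, hα⟩ := exists_psiSum_eq hM χ hper hnt
  set a := M.natDegree.factorial with ha
  have ha0 : 0 < a := Nat.factorial_pos _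
  have hq0 : 0 < (Fintype.card F : ℝ) := by exact_mod_cast Fintype.card_pos
  have h1 : ∀ i, ‖α i ^ (2 * a) / ((Fintype.card F : ℝ) : ℂ) ^ a‖ ≤ 1 := by
    refine norm_le_one_of_norm_sum_pow_le (c := c) _ fun j hj => ?_
    simp_rw [div_pow, ← pow_mul]
    rw [← Finset.sum_div, norm_div, norm_pow, Complex.norm_real, Real.norm_of_nonneg hq0.le,
      div_le_iff₀ (by positivity), ← norm_neg, mul_assoc 2,
      ← hα _ (by have := Nat.mul_pos ha0 hj; omega)]
    exact hc j hj
  have h2 : ∀ i, ‖α i‖ ^ 2 ≤ Fintype.card F := by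
    intro i
    have := h1 i
    rw [norm_div, norm_pow, norm_pow, Complex.norm_real, Real.norm_of_nonneg hq0.le,
      div_le_one (by positivity), pow_mul] at this
    exact le_of_pow_le_pow_left₀ ha0.ne' hq0.le this
  rw [hα _ (by omega), norm_neg]
  refine (norm_sum_le_of_le (n := fun _ => (Fintype.card F : ℝ) ^ e) _ fun i _ => ?_).trans ?_
  · rw [norm_pow, pow_mul]
    exact pow_le_pow_left₀ (by positivity) (h2 i) _
  · rw [Finset.sum_const, Finset.card_univ, Fintype.card_fin, nsmul_eq_mul]
    gcongr

instance Polynomial.finite_quotient_span_singleton {F : Type*} [Field F] [Finite F] {M : F[X]}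
    [NeZero M] : Finite (F[X] ⧸ Ideal.span {M}) := by
  have : Module.Finite F (AdjoinRoot M) :=
    (AdjoinRoot.powerBasis (NeZero.ne M)).finite
  have : Finite (AdjoinRoot M) := Module.finite_of_finite F
  exact this

/-- Euler's totient function for polynomials. -/
noncomputable def polyTotient {F : Type*} [Field F] (M : F[X]) : ℕ :=
  Nat.card (F[X] ⧸ Ideal.span {M})ˣ

theorem isUnit_mk_iff_isCoprime {F : Type*} [Field F] {M f : F[X]} :
    IsUnit (Ideal.Quotient.mk (Ideal.span {M}) f) ↔ IsCoprime f M := by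
  constructor
  · intro h
    obtain ⟨g, hg⟩ := h.exists_left_inv
    obtain ⟨g, rfl⟩ := Ideal.Quotient.mk_surjective g
    rw [← map_mul, ← map_one (Ideal.Quotient.mk (Ideal.span {M})),
      Ideal.Quotient.mk_eq_mk_iff_sub_mem,
      Ideal.mem_span_singleton] at hg
    obtain ⟨c, hc⟩ := hg
    exact ⟨g, -c, by linear_combination hc⟩
  · rintro ⟨g, c, h⟩
    refine IsUnit.of_mul_eq_one (Ideal.Quotient.mk _ g) ?_
    rw [← map_mul, ← map_one (Ideal.Quotient.mk (Ideal.span {M})),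
      Ideal.Quotient.mk_eq_mk_iff_sub_mem, Ideal.mem_span_singleton]
    exact ⟨-c, by linear_combination h⟩

theorem MulChar.sum_inv_mul_eq {R : Type*} [CommRing R] [Finite R] [DecidableEq R]
    [Fintype (MulChar R ℂ)] (u : Rˣ) (b : R) :
    ∑ χ : MulChar R ℂ, χ (u⁻¹ : Rˣ) * χ b = if b = u then (Nat.card Rˣ : ℂ) else 0 := by
  have h1 : ∀ a : R, ∑ χ : MulChar R ℂ, χ a = if a = 1 then (Nat.card Rˣ : ℂ) else 0 := by
    intro a
    split_ifs with h
    · simp only [h, map_one, Finset.sum_const, Finset.card_univ, nsmul_eq_mul, mul_one]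
      rw [← MulChar.card_eq_card_units_of_hasEnoughRootsOfUnity R ℂ, Nat.card_eq_fintype_card]
    · obtain ⟨χ, hχ⟩ := MulChar.exists_apply_ne_one_of_hasEnoughRootsOfUnity R ℂ h
      refine eq_zero_of_mul_eq_self_left hχ ?_
      simp only [Finset.mul_sum, ← MulChar.mul_apply]
      exact Fintype.sum_bijective _ (Group.mulLeft_bijective χ) _ _ fun χ' ↦ rfl
  simp only [← map_mul, h1]
  have h2 : ((u⁻¹ : Rˣ) : R) * b = 1 ↔ b = u := by
    rw [Units.inv_mul_eq_iff_eq_mul, mul_one]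
  simp only [h2]

/-- The character of `F[X]` induced by a character modulo `M`. -/
noncomputable def MulChar.toPolynomialHom {F : Type*} [Field F] {M : F[X]}
    (χ : MulChar (F[X] ⧸ Ideal.span {M}) ℂ) : F[X] →* ℂ :=
  (χ : (F[X] ⧸ Ideal.span {M}) →* ℂ).comp (Ideal.Quotient.mk (Ideal.span {M}) : F[X] →* _)

theorem MulChar.toPolynomialHom_apply {F : Type*} [Field F] {M : F[X]}
    (χ : MulChar (F[X] ⧸ Ideal.span {M}) ℂ) (f : F[X]) :
    χ.toPolynomialHom f = χ (Ideal.Quotient.mk (Ideal.span {M}) f) := rfl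

theorem MulChar.norm_apply_le_one {R : Type*} [CommRing R] [Finite R] (χ : MulChar R ℂ) (a : R) :
    ‖χ a‖ ≤ 1 := by
  by_cases h : IsUnit a
  · have h1 : χ a ^ Nat.card Rˣ = 1 := by
      rw [← map_pow, ← h.unit_spec, ← Units.val_pow_eq_pow_val, pow_card_eq_one', Units.val_one,
        map_one]
    rw [Complex.norm_eq_one_of_pow_eq_one h1 Nat.card_pos.ne']
  · rw [χ.map_nonunit h, norm_zero]
    exact zero_le_one

theorem norm_psiSum_toPolynomialHom_le {F : Type*} [Field F] [Fintype F] {M : F[X]} (hM : M.Monic)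
    (hsq : Squarefree M) {χ : MulChar (F[X] ⧸ Ideal.span {M}) ℂ} (hχ : χ ≠ 1) {e : ℕ}
    (he : 1 ≤ e) :
    ‖psiSum F (2 * e) χ.toPolynomialHom‖ ≤ M.natDegree * (Fintype.card F : ℝ) ^ e := by
  have : NeZero M := ⟨hM.ne_zero⟩
  refine norm_psiSum_le hM hsq χ.toPolynomialHom ?_
    (n := Nat.card (F[X] ⧸ Ideal.span {M})ˣ) Nat.card_pos ?_ ?_ ?_ he
  · intro f g h
    rw [χ.toPolynomialHom_apply, χ.toPolynomialHom_apply]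
    congr 1
    rwa [Ideal.Quotient.mk_eq_mk_iff_sub_mem, Ideal.mem_span_singleton]
  · intro f hf
    have h := isUnit_mk_iff_isCoprime.2 hf
    rw [χ.toPolynomialHom_apply, ← map_pow, ← h.unit_spec, ← Units.val_pow_eq_pow_val,
      pow_card_eq_one', Units.val_one, map_one]
  · intro f
    exact χ.norm_apply_le_one _
  · obtain ⟨u, hu⟩ := MulChar.ne_one_iff.1 hχ
    obtain ⟨f, hf⟩ := Ideal.Quotient.mk_surjective (u : F[X] ⧸ Ideal.span {M})
    refine ⟨f, ?_, ?_⟩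
    · rw [← isUnit_mk_iff_isCoprime, hf]; exact u.isUnit
    · rw [χ.toPolynomialHom_apply, hf]; exact hu

theorem sum_natDegree_primes_dvd_le {F : Type*} [Field F] [Fintype F] {M : F[X]} (hM : M ≠ 0)
    (s : Finset F[X]) (hs : ∀ p ∈ s, p.Monic ∧ Irreducible p ∧ p ∣ M) :
    ∑ p ∈ s, p.natDegree ≤ M.natDegree := by
  classical
  have h1 : ∏ p ∈ s, p ∣ M := by
    refine Finset.prod_dvd_of_coprime ?_ fun p hp => (hs p hp).2.2
    intro p hp q hq hpq
    refine ((hs p hp).2.1.coprime_iff_not_dvd).2 fun h => hpq ?_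
    exact eq_of_monic_of_associated (hs p hp).1 (hs q hq).1
      ((hs p hp).2.1.associated_of_dvd (hs q hq).2.1 h)
  rw [← natDegree_prod_of_monic _ _ fun p hp => (hs p hp).1]
  exact natDegree_le_of_dvd h1 hM

theorem norm_psiSum_one_sub_le {F : Type*} [Field F] [Fintype F] {M : F[X]} (hM : M.Monic)
    {n : ℕ} (hn : n ≠ 0) :
    ‖psiSum F n (1 : MulChar (F[X] ⧸ Ideal.span {M}) ℂ).toPolynomialHom -
      (Fintype.card F : ℂ) ^ n‖ ≤ M.natDegree := by
  classical
  have : NeZero M := ⟨hM.ne_zero⟩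
  rw [← psiSum_one F hn, psiSum, psiSum, ← Finset.sum_sub_distrib]
  let s := n.divisors.biUnion fun d => (primesOfDegree F d).filter (· ∣ M)
  have hs : ∀ p ∈ s, p.Monic ∧ Irreducible p ∧ p ∣ M := by
    intro p hp
    simp only [s, Finset.mem_biUnion, Finset.mem_filter, mem_primesOfDegree] at hp
    obtain ⟨d, -, ⟨h1, -, h2⟩, h3⟩ := hp
    exact ⟨h1, h2, h3⟩
  have hle := sum_natDegree_primes_dvd_le hM.ne_zero s hs
  have hs2 : ∑ p ∈ s, p.natDegree =
      ∑ d ∈ n.divisors, ∑ p ∈ primesOfDegree F d with p ∣ M, d := by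
    rw [Finset.sum_biUnion]
    · refine Finset.sum_congr rfl fun d _ => Finset.sum_congr rfl fun p hp => ?_
      exact (mem_primesOfDegree.1 (Finset.mem_filter.1 hp).1).2.1
    · intro d _ d' _ hdd
      rw [Function.onFun, Finset.disjoint_left]
      intro p hp hp'
      rw [Finset.mem_filter, mem_primesOfDegree] at hp hp'
      exact hdd (hp.1.2.1.symm.trans hp'.1.2.1)
  have h1 : ∀ x ∈ n.divisorsAntidiagonal,
      ‖(x.1 : ℂ) * ∑ p ∈ primesOfDegree F x.1,
        (1 : MulChar (F[X] ⧸ Ideal.span {M}) ℂ).toPolynomialHom p ^ x.2 -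
        (x.1 : ℂ) * ∑ p ∈ primesOfDegree F x.1, (1 : F[X] →* ℂ) p ^ x.2‖ ≤
      (∑ p ∈ primesOfDegree F x.1 with p ∣ M, x.1 : ℕ) := by
    intro x hx
    rw [Nat.mem_divisorsAntidiagonal] at hx
    have hx2 : x.2 ≠ 0 := by rintro h; rw [h, mul_zero] at hx; exact hn hx.1.symm
    rw [← mul_sub, ← Finset.sum_sub_distrib, Finset.sum_filter]
    push_cast
    rw [Finset.mul_sum]
    refine norm_sum_le_of_le _ fun p hp => ?_
    rw [mem_primesOfDegree] at hp
    rw [MulChar.toPolynomialHom_apply]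
    split_ifs with h
    · have h2 : ¬ IsUnit (Ideal.Quotient.mk (Ideal.span {M}) p) := by
        rw [isUnit_mk_iff_isCoprime]
        exact fun h' => hp.2.2.not_isUnit (h'.isUnit_of_dvd' dvd_rfl h)
      rw [MulChar.map_nonunit _ h2, zero_pow hx2]
      simp
    · have h2 : IsUnit (Ideal.Quotient.mk (Ideal.span {M}) p) := by
        rw [isUnit_mk_iff_isCoprime]
        exact (hp.2.2.coprime_iff_not_dvd).2 h
      rw [MulChar.one_apply h2]
      simp
  refine (norm_sum_le_of_le _ h1).trans ?_
  rw [← Nat.cast_sum, Nat.cast_le]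
  refine le_trans (le_of_eq ?_) hle
  rw [hs2]
  rw [Nat.sum_divisorsAntidiagonal fun i _ => ∑ p ∈ primesOfDegree F i with p ∣ M, i]

theorem card_primesOfDegree_le (F : Type*) [Field F] [Fintype F] (d : ℕ) :
    d * (primesOfDegree F d).card ≤ Fintype.card F ^ d := by
  rcases eq_or_ne d 0 with rfl | hd
  · simp
  have h1 := psiSum_one F hd
  rw [psiSum] at h1
  simp only [MonoidHom.one_apply, one_pow, Finset.sum_const, nsmul_eq_mul, mul_one] at h1
  have h2 : ∑ x ∈ d.divisorsAntidiagonal, x.1 * (primesOfDegree F x.1).card =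
    Fintype.card F ^ d := by exact_mod_cast h1
  rw [← h2]
  have h3 : (d, 1) ∈ d.divisorsAntidiagonal := Nat.mem_divisorsAntidiagonal.2 ⟨mul_one d, hd⟩
  exact Finset.single_le_sum (f := fun x : ℕ × ℕ => x.1 * (primesOfDegree F x.1).card)
    (fun _ _ => Nat.zero_le _) h3

theorem card_primes_modEq_sub_le {F : Type*} [Field F] [Fintype F]
    [DecidableRel (· ∣ · : F[X] → F[X] → Prop)] {M : F[X]} (hM : M.Monic)
    (hsq : Squarefree M) {a : F[X]} (ha : IsCoprime a M) {e : ℕ} (he : 1 ≤ e) :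
    |(2 * e : ℝ) * ((primesOfDegree F (2 * e)).filter fun p => M ∣ p - a).card -
      (Fintype.card F : ℝ) ^ (2 * e) / polyTotient M| ≤
      (M.natDegree + 2 * e) * (Fintype.card F : ℝ) ^ e := by
  classical
  have : NeZero M := ⟨hM.ne_zero⟩
  set q := Fintype.card F with hq
  have hq1 : (1 : ℝ) ≤ q := by rw [hq]; exact_mod_cast Fintype.card_pos
  set n := 2 * e with hn
  have hn0 : n ≠ 0 := by omega
  let R := F[X] ⧸ Ideal.span {M}
  have := Fintype.ofFinite (MulChar R ℂ)
  obtain ⟨u, hu⟩ := isUnit_mk_iff_isCoprime.2 ha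
  set φ := polyTotient M with hφ
  have hφ0 : 0 < φ := Nat.card_pos
  let T : ℕ × ℕ → ℕ := fun x => x.1 * ((primesOfDegree F x.1).filter fun p => M ∣ p ^ x.2 - a).card
  have hkey : ∑ χ : MulChar R ℂ, χ (u⁻¹ : Rˣ) * psiSum F n χ.toPolynomialHom =
      φ * ∑ x ∈ n.divisorsAntidiagonal, (T x : ℂ) := by
    simp only [psiSum, Finset.mul_sum]
    rw [Finset.sum_comm]
    refine Finset.sum_congr rfl fun x _ => ?_
    rw [Finset.sum_comm]
    have h1 : ∀ p : F[X], ∑ χ : MulChar R ℂ, χ (u⁻¹ : Rˣ) * (x.1 * χ.toPolynomialHom p ^ x.2) =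
        if M ∣ p ^ x.2 - a then (φ * x.1 : ℂ) else 0 := by
      intro p
      have h2 := MulChar.sum_inv_mul_eq u (Ideal.Quotient.mk (Ideal.span {M}) p ^ x.2)
      rw [hu, ← map_pow, Ideal.Quotient.mk_eq_mk_iff_sub_mem, Ideal.mem_span_singleton] at h2
      have h3 : ∀ χ : MulChar R ℂ, χ (u⁻¹ : Rˣ) * (x.1 * χ.toPolynomialHom p ^ x.2) =
          x.1 * (χ (u⁻¹ : Rˣ) * χ (Ideal.Quotient.mk (Ideal.span {M}) (p ^ x.2))) := by
        intro χ
        rw [MulChar.toPolynomialHom_apply, map_pow, map_pow]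
        ring
      rw [Finset.sum_congr rfl fun χ _ => h3 χ, ← Finset.mul_sum, h2]
      split_ifs
      · rw [mul_comm]; rfl
      · simp
    rw [Finset.sum_congr rfl fun p _ => h1 p, ← Finset.sum_filter, Finset.sum_const]
    simp only [T]
    push_cast
    rw [nsmul_eq_mul]; ring
  have hmain : ‖(φ : ℂ) * ∑ x ∈ n.divisorsAntidiagonal, (T x : ℂ) - (q : ℂ) ^ n‖ ≤
      φ * (M.natDegree * (q : ℝ) ^ e) := by
    have h1 : (φ : ℂ) * ∑ x ∈ n.divisorsAntidiagonal, (T x : ℂ) - (q : ℂ) ^ n =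
        ∑ χ : MulChar R ℂ, (χ (u⁻¹ : Rˣ) * psiSum F n χ.toPolynomialHom -
          if χ = 1 then (q : ℂ) ^ n else 0) := by
      rw [Finset.sum_sub_distrib, hkey]
      simp
    have h2 : φ = Fintype.card (MulChar R ℂ) := by
      rw [← Nat.card_eq_fintype_card, MulChar.card_eq_card_units_of_hasEnoughRootsOfUnity R ℂ]
      rfl
    rw [h1, h2]
    refine (norm_sum_le_of_le (n := fun _ => M.natDegree * (q : ℝ) ^ e) _ fun χ _ => ?_).trans ?_
    · split_ifs with hχ
      · subst hχ
        rw [MulChar.one_apply (u⁻¹ : Rˣ).isUnit, one_mul]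
        refine (norm_psiSum_one_sub_le hM hn0).trans ?_
        exact le_mul_of_one_le_right (by positivity) (one_le_pow₀ hq1)
      · rw [sub_zero, norm_mul]
        have h3 := norm_psiSum_toPolynomialHom_le hM hsq hχ he
        have h4 := χ.norm_apply_le_one (u⁻¹ : Rˣ)
        calc _ ≤ 1 * (M.natDegree * (q : ℝ) ^ e) := by gcongr
          _ = _ := one_mul _
    · rw [Finset.sum_const, Finset.card_univ, nsmul_eq_mul]
  have hmem : (n, 1) ∈ n.divisorsAntidiagonal := Nat.mem_divisorsAntidiagonal.2 ⟨mul_one n, hn0⟩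
  have hsplit := Finset.add_sum_erase _ (fun x => T x) hmem
  have hTn : T (n, 1) = n * ((primesOfDegree F n).filter fun p => M ∣ p - a).card := by
    simp only [T, pow_one]
  have hrest : ∑ x ∈ n.divisorsAntidiagonal.erase (n, 1), T x ≤ n * q ^ e := by
    have h1 : ∀ x ∈ n.divisorsAntidiagonal.erase (n, 1), T x ≤ q ^ e := by
      rintro ⟨d, c⟩ hx
      rw [Finset.mem_erase, Nat.mem_divisorsAntidiagonal] at hx
      obtain ⟨hx1, hx2, -⟩ := hx
      dsimp only at hx2
      have hc : 2 ≤ c := by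
        rcases c with _ | _ | c
        · omega
        · exfalso; apply hx1; simp at hx2; rw [hx2]
        · omega
      have hde : d ≤ e := by nlinarith
      calc T (d, c) ≤ d * (primesOfDegree F d).card :=
            Nat.mul_le_mul_left _ (Finset.card_filter_le _ _)
        _ ≤ q ^ d := card_primesOfDegree_le F d
        _ ≤ q ^ e := Nat.pow_le_pow_right Fintype.card_pos hde
    refine (Finset.sum_le_card_nsmul _ _ _ h1).trans ?_
    rw [smul_eq_mul]
    refine Nat.mul_le_mul_right _ ?_
    refine (Finset.card_le_card (Finset.erase_subset _ _)).trans ?_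
    rw [← Nat.map_div_right_divisors, Finset.card_map]
    exact Nat.card_divisors_le_self n
  rw [hTn] at hsplit
  set P := ((primesOfDegree F n).filter fun p => M ∣ p - a).card with hP
  set Y := ∑ x ∈ n.divisorsAntidiagonal.erase (n, 1), T x with hY
  have h5 : (φ : ℂ) * ∑ x ∈ n.divisorsAntidiagonal, (T x : ℂ) - (q : ℂ) ^ n =
      ((φ * (n * P + Y : ℝ) - (q : ℝ) ^ n : ℝ) : ℂ) := by
    rw [← Nat.cast_sum, ← hsplit]; push_cast; ring
  rw [h5, Complex.norm_real, Real.norm_eq_abs] at hmain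
  have h6 : (Y : ℝ) ≤ n * (q : ℝ) ^ e := by exact_mod_cast hrest
  have h7 : (0 : ℝ) ≤ Y := Nat.cast_nonneg _
  have hφ' : (0 : ℝ) < φ := by exact_mod_cast hφ0
  have h8 : |(n * P + Y : ℝ) - (q : ℝ) ^ n / φ| ≤ M.natDegree * (q : ℝ) ^ e := by
    have h9 : (n * P + Y : ℝ) - (q : ℝ) ^ n / φ = (φ * (n * P + Y : ℝ) - (q : ℝ) ^ n) / φ := by
      field_simp
    rw [h9, abs_div, abs_of_pos hφ', div_le_iff₀ hφ']
    linarith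
  have h10 : (n : ℝ) = 2 * e := by rw [hn]; push_cast; ring
  rw [h10] at h8 h6
  rw [abs_le] at h8 ⊢
  constructor <;> nlinarith [h8.1, h8.2]

section SieveExpansion

variable {ι κ Ω : Type*}

/-- `P · I i - 1` at `some i`, and `1` at `none`, as coefficients in the basis `1, I i`. -/
def sieveConst (c : Option κ) : ℝ := c.elim 1 (fun _ => -1)

def sieveCoeff [DecidableEq κ] (P : ℝ) (c : Option κ) (i : κ) : ℝ := if c = some i then P else 0

def sieveAtom (P : ℝ) (I : κ → ℝ) (c : Option κ) : ℝ := c.elim 1 (fun i => P * I i - 1)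

def sieveMul [DecidableEq κ] (P : ℝ) (c c' : Option κ) (o : Option κ) : ℝ :=
  o.elim (sieveConst c * sieveConst c') fun l =>
    sieveConst c * sieveCoeff P c' l + sieveCoeff P c l * sieveConst c' +
      sieveCoeff P c l * sieveCoeff P c' l

def sieveGram [Fintype κ] [DecidableEq κ] (P : ℝ) (ν : κ → ℝ) (c c' : Option κ) : ℝ :=
  ∑ o, sieveMul P c c' o * o.elim 1 ν

def sieveSize (P : ℝ) (c : Option κ) : ℝ := c.elim 1 (fun _ => P + 1)

variable [Fintype κ] [DecidableEq κ]

theorem sieveAtom_eq (P : ℝ) (I : κ → ℝ) (c : Option κ) :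
    sieveAtom P I c = sieveConst c + ∑ l, sieveCoeff P c l * I l := by
  rcases c with _ | i
  · simp [sieveAtom, sieveConst, sieveCoeff]
  · simp [sieveAtom, sieveConst, sieveCoeff]; ring

theorem sieveAtom_mul (P : ℝ) {I : κ → ℝ}
    (hI : ∀ i j, I i * I j = if i = j then I i else 0) (c c' : Option κ) :
    sieveAtom P I c * sieveAtom P I c' = ∑ o, sieveMul P c c' o * o.elim 1 I := by
  rw [sieveAtom_eq, sieveAtom_eq, Fintype.sum_option]
  simp only [sieveMul, Option.elim_none, Option.elim_some, add_mul, mul_add, Finset.sum_add_distrib,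
    Finset.sum_mul_sum]
  have h1 : ∑ i, ∑ j, sieveCoeff P c i * I i * (sieveCoeff P c' j * I j) =
      ∑ l, sieveCoeff P c l * sieveCoeff P c' l * I l := by
    refine Finset.sum_congr rfl fun i _ => ?_
    rw [Finset.sum_eq_single i]
    · have := hI i i
      rw [if_pos rfl] at this
      linear_combination sieveCoeff P c i * sieveCoeff P c' i * this
    · intro j _ hj
      have := hI i j
      rw [if_neg hj.symm] at this
      linear_combination sieveCoeff P c i * sieveCoeff P c' j * this
    · simp
  rw [h1, Finset.mul_sum, Finset.sum_mul]
  have e1 : ∑ i, sieveCoeff P c i * I i * sieveConst c' =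
    ∑ i, sieveCoeff P c i * sieveConst c' * I i := Finset.sum_congr rfl fun _ _ => by ring
  have e2 : ∑ i, sieveConst c * (sieveCoeff P c' i * I i) =
    ∑ i, sieveConst c * sieveCoeff P c' i * I i := Finset.sum_congr rfl fun _ _ => by ring
  rw [e1, e2]; ring

theorem sum_abs_sieveMul_le {P : ℝ} (hP : 0 ≤ P) (c c' : Option κ) :
    ∑ o, |sieveMul P c c' o| ≤ sieveSize P c * sieveSize P c' := by
  rw [Fintype.sum_option]
  have h0 : ∀ c : Option κ, |sieveConst c| = 1 := by
    intro c; rcases c with _ | i <;> simp [sieveConst]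
  have h1 : ∀ c : Option κ, ∀ l, 0 ≤ sieveCoeff P c l := by
    intro c l; unfold sieveCoeff; split_ifs <;> simp [hP]
  have h2 : ∀ c : Option κ, 1 + ∑ l, sieveCoeff P c l = sieveSize P c := by
    intro c; rcases c with _ | i
    · simp [sieveCoeff, sieveSize]
    · simp [sieveCoeff, sieveSize]; ring
  have h3 : ∀ l, |sieveMul P c c' (some l)| ≤ sieveCoeff P c' l + sieveCoeff P c l +
      sieveCoeff P c l * sieveCoeff P c' l := by
    intro l
    simp only [sieveMul, Option.elim_some]
    refine (abs_add_le _ _).trans (add_le_add ((abs_add_le _ _).trans (add_le_add ?_ ?_)) ?_)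
    · rw [abs_mul, h0, one_mul, abs_of_nonneg (h1 _ _)]
    · rw [abs_mul, h0, mul_one, abs_of_nonneg (h1 _ _)]
    · rw [abs_of_nonneg (mul_nonneg (h1 _ _) (h1 _ _))]
  have h4 : |sieveMul P c c' none| = 1 := by
    simp [sieveMul, abs_mul, h0]
  have h5 : ∑ l, sieveCoeff P c l * sieveCoeff P c' l ≤
      (∑ l, sieveCoeff P c l) * ∑ l, sieveCoeff P c' l := by
    rw [Finset.sum_mul_sum]
    refine Finset.sum_le_sum fun l _ => ?_
    exact Finset.single_le_sum (f := fun j => sieveCoeff P c l * sieveCoeff P c' j)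
      (fun j _ => mul_nonneg (h1 _ _) (h1 _ _)) (Finset.mem_univ l)
  calc _ ≤ 1 + ∑ l, (sieveCoeff P c' l + sieveCoeff P c l +
      sieveCoeff P c l * sieveCoeff P c' l) := by
        rw [h4]; gcongr with l; exact h3 l
    _ ≤ 1 + (∑ l, sieveCoeff P c' l + ∑ l, sieveCoeff P c l +
      (∑ l, sieveCoeff P c l) * ∑ l, sieveCoeff P c' l) := by
        rw [Finset.sum_add_distrib, Finset.sum_add_distrib]; gcongr
    _ = _ := by rw [← h2, ← h2]; ring

variable [Fintype ι] [DecidableEq ι]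

theorem abs_sieve_sum_sub_le (S : Finset Ω) {I : ι → κ → Ω → ℝ}
    (hI : ∀ f ∈ S, ∀ p i j, I p i f * I p j f = if i = j then I p i f else 0)
    {P : ι → ℝ} (hP : ∀ p, 0 ≤ P p) (ν : ι → κ → ℝ) (T : Finset (ι → Option κ))
    (a : (ι → Option κ) → ℝ) {X err C : ℝ} (herr : 0 ≤ err)
    (hcount : ∀ D ∈ T, ∀ D' ∈ T, ∀ σ : ι → Option κ,
      (∀ p, D p = none → D' p = none → σ p = none) →
      |∑ f ∈ S, ∏ p, (σ p).elim 1 (fun i => I p i f) - X * ∏ p, (σ p).elim 1 (ν p)| ≤ err)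
    (hC : ∀ D ∈ T, ∏ p, sieveSize (P p) (D p) ≤ C) :
    |∑ f ∈ S, (∑ D ∈ T, a D * ∏ p, sieveAtom (P p) (fun i => I p i f) (D p)) ^ 2 -
      X * ∑ D ∈ T, ∑ D' ∈ T, a D * a D' * ∏ p, sieveGram (P p) (ν p) (D p) (D' p)| ≤
      err * (C * ∑ D ∈ T, |a D|) ^ 2 := by
  set J : (ι → Option κ) → ℝ := fun σ => ∑ f ∈ S, ∏ p, (σ p).elim 1 (fun i => I p i f) with hJ
  set N : (ι → Option κ) → ℝ := fun σ => ∏ p, (σ p).elim 1 (ν p) with hN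
  set A : (ι → Option κ) → (ι → Option κ) → (ι → Option κ) → ℝ :=
    fun D D' σ => ∏ p, sieveMul (P p) (D p) (D' p) (σ p) with hA
  have h1 : ∀ D D', ∑ f ∈ S, (∏ p, sieveAtom (P p) (fun i => I p i f) (D p)) *
      (∏ p, sieveAtom (P p) (fun i => I p i f) (D' p)) = ∑ σ, A D D' σ * J σ := by
    intro D D'
    simp only [hJ, Finset.mul_sum]
    rw [Finset.sum_comm]
    refine Finset.sum_congr rfl fun f hf => ?_
    rw [← Finset.prod_mul_distrib]
    rw [Finset.prod_congr rfl fun p _ => sieveAtom_mul (P p) (hI f hf p) (D p) (D' p),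
      Finset.prod_univ_sum, Fintype.piFinset_univ]
    simp only [hA, Finset.prod_mul_distrib]
  have h2 : ∀ D D', ∏ p, sieveGram (P p) (ν p) (D p) (D' p) = ∑ σ, A D D' σ * N σ := by
    intro D D'
    simp only [sieveGram]
    rw [Finset.prod_univ_sum, Fintype.piFinset_univ]
    simp only [hA, hN, Finset.prod_mul_distrib]
  have h3 : ∑ f ∈ S, (∑ D ∈ T, a D * ∏ p, sieveAtom (P p) (fun i => I p i f) (D p)) ^ 2 =
      ∑ D ∈ T, ∑ D' ∈ T, a D * a D' * ∑ σ, A D D' σ * J σ := by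
    simp only [← h1]
    simp only [sq, Finset.sum_mul_sum]
    rw [Finset.sum_comm]
    refine Finset.sum_congr rfl fun D _ => ?_
    rw [Finset.sum_comm]
    refine Finset.sum_congr rfl fun D' _ => ?_
    rw [Finset.mul_sum]
    exact Finset.sum_congr rfl fun _ _ => by ring
  have h4 : ∀ D ∈ T, ∀ D' ∈ T, |∑ σ, A D D' σ * J σ - X * ∑ σ, A D D' σ * N σ| ≤
      err * (C * C) := by
    intro D hD D' hD'
    have e1 : ∑ σ, A D D' σ * J σ - X * ∑ σ, A D D' σ * N σ =
        ∑ σ, A D D' σ * (J σ - X * N σ) := by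
      rw [Finset.mul_sum, ← Finset.sum_sub_distrib]
      exact Finset.sum_congr rfl fun _ _ => by ring
    rw [e1]
    have e2 : ∀ σ, |A D D' σ * (J σ - X * N σ)| ≤ |A D D' σ| * err := by
      intro σ
      rw [abs_mul]
      by_cases hσ : ∀ p, D p = none → D' p = none → σ p = none
      · exact mul_le_mul_of_nonneg_left (hcount D hD D' hD' σ hσ) (abs_nonneg _)
      · push Not at hσ
        obtain ⟨p, h5, h6, h7⟩ := hσ
        have : A D D' σ = 0 := by
          refine Finset.prod_eq_zero (Finset.mem_univ p) ?_
          obtain ⟨l, hl⟩ := Option.ne_none_iff_exists'.1 h7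
          simp [h5, h6, hl, sieveMul, sieveCoeff]
        rw [this]; simp
    have hs0 : ∀ p (c : Option κ), 0 ≤ sieveSize (P p) c := by
      intro p c; have := hP p
      rcases c with _ | i <;> simp [sieveSize]; positivity
    calc _ ≤ ∑ σ, |A D D' σ * (J σ - X * N σ)| := Finset.abs_sum_le_sum_abs _ _
      _ ≤ ∑ σ, |A D D' σ| * err := Finset.sum_le_sum fun σ _ => e2 σ
      _ = (∏ p, ∑ o, |sieveMul (P p) (D p) (D' p) o|) * err := by
        rw [← Finset.sum_mul, Finset.prod_univ_sum, Fintype.piFinset_univ]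
        simp only [hA, Finset.abs_prod]
      _ ≤ (∏ p, sieveSize (P p) (D p) * sieveSize (P p) (D' p)) * err := by
        gcongr with p
        exact sum_abs_sieveMul_le (hP p) _ _
      _ ≤ (C * C) * err := by
        rw [Finset.prod_mul_distrib]
        gcongr
        · exact Finset.prod_nonneg fun p _ => hs0 p _
        · exact (Finset.prod_nonneg fun p _ => hs0 p _).trans (hC D hD)
        · exact hC D hD
        · exact hC D' hD'
      _ = _ := mul_comm _ _
  simp only [h2]
  rw [h3]
  have h5 : ∑ D ∈ T, ∑ D' ∈ T, a D * a D' * ∑ σ, A D D' σ * J σ -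
      X * ∑ D ∈ T, ∑ D' ∈ T, a D * a D' * ∑ σ, A D D' σ * N σ =
      ∑ D ∈ T, ∑ D' ∈ T, a D * a D' * (∑ σ, A D D' σ * J σ - X * ∑ σ, A D D' σ * N σ) := by
    rw [Finset.mul_sum, ← Finset.sum_sub_distrib]
    refine Finset.sum_congr rfl fun D _ => ?_
    rw [Finset.mul_sum, ← Finset.sum_sub_distrib]
    exact Finset.sum_congr rfl fun _ _ => by ring
  rw [h5]
  calc _ ≤ ∑ D ∈ T, ∑ D' ∈ T,
        |a D * a D' * (∑ σ, A D D' σ * J σ - X * ∑ σ, A D D' σ * N σ)| :=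
        (Finset.abs_sum_le_sum_abs _ _).trans
          (Finset.sum_le_sum fun _ _ => Finset.abs_sum_le_sum_abs _ _)
    _ ≤ ∑ D ∈ T, ∑ D' ∈ T, |a D| * |a D'| * (err * (C * C)) := by
        refine Finset.sum_le_sum fun D hD => Finset.sum_le_sum fun D' hD' => ?_
        rw [abs_mul, abs_mul]
        exact mul_le_mul_of_nonneg_left (h4 D hD D' hD') (by positivity)
    _ = _ := by
        simp only [← Finset.sum_mul, ← Finset.mul_sum]
        ring

end SieveExpansion

section TensorQuadraticForm

variable {ι κ : Type*}

open Matrix in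
theorem Matrix.posSemidef_prod (s : Finset ι) {G : ι → Matrix κ κ ℝ}
    (hG : ∀ p ∈ s, (G p).PosSemidef) {τ : Type*} [Fintype τ] [DecidableEq τ] (D : ι → τ → κ) :
    (Matrix.of fun x y => ∏ p ∈ s, G p (D p x) (D p y)).PosSemidef := by
  classical
  induction s using Finset.induction_on with
  | empty =>
    simp only [Finset.prod_empty]
    have := Matrix.posSemidef_vecMulVec_self_star (R := ℝ) (fun _ : τ => (1 : ℝ))
    convert this using 1
    ext x y; simp [Matrix.vecMulVec]
  | insert p s hp ih =>
    have h1 := ih fun q hq => hG q (Finset.mem_insert_of_mem hq)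
    have h2 := (hG p (Finset.mem_insert_self _ _)).submatrix (D p)
    have e : (Matrix.of fun x y => ∏ p ∈ insert p s, G p (D p x) (D p y)) =
        (G p).submatrix (D p) (D p) ⊙
          Matrix.of fun x y => ∏ p ∈ s, G p (D p x) (D p y) := by
      ext x y
      simp [Finset.prod_insert hp]
    rw [e]
    exact h2.hadamard h1

open Matrix in
theorem Matrix.posSemidef_prod_sub_prod (s : Finset ι) {G G' : ι → Matrix κ κ ℝ}
    (hG : ∀ p ∈ s, (G' p).PosSemidef) (hGG : ∀ p ∈ s, (G p - G' p).PosSemidef)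
    {τ : Type*} [Fintype τ] [DecidableEq τ] (D : ι → τ → κ) :
    (Matrix.of fun x y => ∏ p ∈ s, G p (D p x) (D p y) -
      ∏ p ∈ s, G' p (D p x) (D p y)).PosSemidef := by
  classical
  induction s using Finset.induction_on with
  | empty =>
    simp only [Finset.prod_empty, sub_self]
    exact Matrix.PosSemidef.zero
  | insert p s hp ih =>
    have hG2 : ∀ q ∈ insert p s, (G q).PosSemidef := by
      intro q hq
      have := (hGG q hq).add (hG q hq)
      simpa using this
    have h1 := ih (fun q hq => hG q (Finset.mem_insert_of_mem hq))
      fun q hq => hGG q (Finset.mem_insert_of_mem hq)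
    have h2 := (hG p (Finset.mem_insert_self _ _)).submatrix (D p)
    have h3 := (hGG p (Finset.mem_insert_self _ _)).submatrix (D p)
    have h4 := Matrix.posSemidef_prod s (fun q hq => hG2 q (Finset.mem_insert_of_mem hq)) D
    have e : (Matrix.of fun x y => ∏ p ∈ insert p s, G p (D p x) (D p y) -
          ∏ p ∈ insert p s, G' p (D p x) (D p y)) =
        (G p - G' p).submatrix (D p) (D p) ⊙
          (Matrix.of fun x y => ∏ p ∈ s, G p (D p x) (D p y)) +
        (G' p).submatrix (D p) (D p) ⊙
          Matrix.of fun x y => ∏ p ∈ s, G p (D p x) (D p y) -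
            ∏ p ∈ s, G' p (D p x) (D p y) := by
      ext x y
      simp [Finset.prod_insert hp]
      ring
    rw [e]
    exact (h3.hadamard h4).add (h2.hadamard h1)

theorem sum_mul_prod_le_sum_mul_prod [Fintype ι] {G G' : ι → κ → κ → ℝ}
    (hG : ∀ p, (Matrix.of (G' p)).PosSemidef) (hGG : ∀ p, (Matrix.of (G p - G' p)).PosSemidef)
    (T : Finset (ι → κ)) (a : (ι → κ) → ℝ) :
    ∑ D ∈ T, ∑ D' ∈ T, a D * a D' * ∏ p, G' p (D p) (D' p) ≤
      ∑ D ∈ T, ∑ D' ∈ T, a D * a D' * ∏ p, G p (D p) (D' p) := by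
  classical
  have := Matrix.posSemidef_prod_sub_prod (Finset.univ : Finset ι)
    (G := fun p => Matrix.of (G p)) (G' := fun p => Matrix.of (G' p)) (fun p _ => hG p)
    (fun p _ => hGG p) (τ := T) (fun p x => x.1 p)
  have h := this.dotProduct_mulVec_nonneg (fun x : T => a x.1)
  simp only [dotProduct, Matrix.mulVec, Matrix.of_apply, star_trivial, Pi.star_apply] at h
  rw [← sub_nonneg, ← Finset.sum_sub_distrib]
  have e : ∀ f : (ι → κ) → ℝ, ∑ D ∈ T, f D = ∑ x : T, f x.1 :=
    fun f => (Finset.sum_coe_sort T f).symm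
  rw [e]
  refine h.trans_eq (Finset.sum_congr rfl fun x _ => ?_)
  rw [← Finset.sum_sub_distrib, e, Finset.mul_sum]
  refine Finset.sum_congr rfl fun y _ => ?_
  ring

end TensorQuadraticForm

section LocalForms

variable {ι κ : Type*} [Fintype κ] [DecidableEq κ]

theorem quadForm_sieveGram (P : ℝ) (ν : κ → ℝ) (x : Option κ → ℝ) :
    ∑ c, ∑ c', x c * x c' * sieveGram P ν c c' =
      (x none - ∑ i, x (some i)) ^ 2 +
        ∑ l, ν l * (2 * (x none - ∑ i, x (some i)) * (P * x (some l)) + (P * x (some l)) ^ 2) := by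
  have h1 : ∑ c, x c * sieveConst c = x none - ∑ i, x (some i) := by
    rw [Fintype.sum_option]; simp [sieveConst, sub_eq_add_neg]
  have h2 : ∀ l, ∑ c, x c * sieveCoeff P c l = P * x (some l) := by
    intro l; rw [Fintype.sum_option]; simp [sieveCoeff, mul_comm]
  have h3 : ∀ c c', x c * x c' * sieveGram P ν c c' =
      (x c * sieveConst c) * (x c' * sieveConst c') +
      ∑ l, ν l * ((x c * sieveConst c) * (x c' * sieveCoeff P c' l) +
        (x c * sieveCoeff P c l) * (x c' * sieveConst c') +
        (x c * sieveCoeff P c l) * (x c' * sieveCoeff P c' l)) := by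
    intro c c'
    simp only [sieveGram, Fintype.sum_option, sieveMul, Option.elim_none, Option.elim_some, mul_add,
      Finset.mul_sum]
    congr 1
    · ring
    · exact Finset.sum_congr rfl fun l _ => by ring
  simp only [h3, Finset.sum_add_distrib]
  congr 1
  · rw [← h1, sq, Finset.sum_mul_sum]
  · have h4 : ∀ c, ∑ c', ∑ l, ν l * ((x c * sieveConst c) * (x c' * sieveCoeff P c' l) +
        (x c * sieveCoeff P c l) * (x c' * sieveConst c') +
        (x c * sieveCoeff P c l) * (x c' * sieveCoeff P c' l)) =
        ∑ l, ν l * ∑ c', ((x c * sieveConst c) * (x c' * sieveCoeff P c' l) +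
        (x c * sieveCoeff P c l) * (x c' * sieveConst c') +
        (x c * sieveCoeff P c l) * (x c' * sieveCoeff P c' l)) := by
      intro c
      rw [Finset.sum_comm]
      exact Finset.sum_congr rfl fun l _ => by rw [Finset.mul_sum]
    simp only [h4]
    rw [Finset.sum_comm]
    refine Finset.sum_congr rfl fun l _ => ?_
    rw [← Finset.mul_sum]
    congr 1
    simp only [Finset.sum_add_distrib, ← Finset.mul_sum, ← Finset.sum_mul, h1, h2]
    ring

omit [Fintype κ] in
theorem sieveMul_comm (P : ℝ) (c c' o : Option κ) : sieveMul P c c' o = sieveMul P c' c o := by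
  rcases o with _ | l <;> simp [sieveMul] <;> ring

theorem sieveGram_comm (P : ℝ) (ν : κ → ℝ) (c c' : Option κ) :
    sieveGram P ν c c' = sieveGram P ν c' c := by
  simp only [sieveGram, sieveMul_comm P c c']

theorem posSemidef_of_quadForm {τ : Type*} [Fintype τ] {G : τ → τ → ℝ}
    (hs : ∀ x y, G x y = G y x) (h : ∀ x : τ → ℝ, 0 ≤ ∑ c, ∑ c', x c * x c' * G c c') :
    (Matrix.of G).PosSemidef := by
  refine Matrix.PosSemidef.of_dotProduct_mulVec_nonneg ?_ fun x => ?_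
  · ext i j; simp [hs j i]
  · refine (h x).trans_eq ?_
    simp only [dotProduct, Matrix.mulVec, Matrix.of_apply, star_trivial]
    refine Finset.sum_congr rfl fun c _ => ?_
    rw [Finset.mul_sum]
    exact Finset.sum_congr rfl fun _ _ => by ring

def sieveNorm (P : ℝ) (c : Option κ) : ℝ := c.elim 1 (fun _ => P)

theorem quadForm_diagonal {τ : Type*} [Fintype τ] [DecidableEq τ] (x v : τ → ℝ) :
    ∑ c, ∑ c', x c * x c' * (if c = c' then v c else 0) = ∑ c, v c * x c ^ 2 := by
  refine Finset.sum_congr rfl fun c _ => ?_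
  simp; ring

theorem sieve_main_le [Fintype ι] {P : ι → ℝ} (hP : ∀ p, Fintype.card κ ≤ P p) (hP0 : ∀ p, 0 < P p)
    (T : Finset (ι → Option κ)) (a : (ι → Option κ) → ℝ) :
    ∑ D ∈ T, ∑ D' ∈ T, a D * a D' *
        ∏ p, sieveGram (P p) (fun _ => 1 / P p) (D p) (D' p) ≤
      ∑ D ∈ T, a D ^ 2 * ∏ p, sieveNorm (P p) (D p) := by
  classical
  have key : ∀ p (x : Option κ → ℝ),
      ∑ c, ∑ c', x c * x c' * sieveGram (P p) (fun _ => 1 / P p) c c' =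
      x none ^ 2 - (∑ i, x (some i)) ^ 2 + P p * ∑ i, x (some i) ^ 2 := by
    intro p x
    rw [quadForm_sieveGram]
    have := (hP0 p).ne'
    have e : ∀ l, 1 / P p * (2 * (x none - ∑ i, x (some i)) * (P p * x (some l)) +
        (P p * x (some l)) ^ 2) = 2 * (x none - ∑ i, x (some i)) * x (some l) +
        P p * x (some l) ^ 2 := by
      intro l; field_simp
    simp only [e, Finset.sum_add_distrib, ← Finset.mul_sum]
    ring
  refine (sum_mul_prod_le_sum_mul_prod (ι := ι)
    (G := fun p c c' => if c = c' then sieveNorm (P p) c else 0)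
    (G' := fun p => sieveGram (P p) (fun _ => 1 / P p)) ?_ ?_ T a).trans_eq ?_
  · intro p
    refine posSemidef_of_quadForm (sieveGram_comm _ _) fun x => ?_
    rw [key]
    have h1 := sq_sum_le_card_mul_sum_sq (s := (Finset.univ : Finset κ)) (f := fun i => x (some i))
    have h2 : (Fintype.card κ : ℝ) * ∑ i, x (some i) ^ 2 ≤ P p * ∑ i, x (some i) ^ 2 :=
      mul_le_mul_of_nonneg_right (hP p) (Finset.sum_nonneg fun _ _ => sq_nonneg _)
    rw [Finset.card_univ] at h1
    nlinarith [sq_nonneg (x none)]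
  · intro p
    refine posSemidef_of_quadForm (fun c c' => ?_) fun x => ?_
    · simp only [Pi.sub_apply]
      rw [sieveGram_comm]
      by_cases h : c = c'
      · subst h; rfl
      · rw [if_neg h, if_neg (Ne.symm h)]
    · simp only [Pi.sub_apply, mul_sub, Finset.sum_sub_distrib]
      rw [key, quadForm_diagonal, Fintype.sum_option]
      simp only [sieveNorm, Option.elim_none, Option.elim_some, ← Finset.mul_sum]
      nlinarith [sq_nonneg (∑ i, x (some i))]
  · refine Finset.sum_congr rfl fun D hD => ?_
    rw [Finset.sum_eq_single D]
    · simp [sq]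
    · intro D' _ hne
      obtain ⟨p, hp⟩ := Function.ne_iff.1 hne
      rw [Finset.prod_eq_zero (Finset.mem_univ p), mul_zero]
      rw [if_neg (Ne.symm hp)]
    · exact fun h => absurd hD h

def primeWeight (P ε : ℝ) (K : ℝ) (m : κ) (e : Option κ) : ℝ :=
  e.elim (1 - ε) fun i => if i = m then 0 else P - 8 * K

def primeLin (m : κ) (e c : Option κ) : ℝ :=
  e.elim (c.elim 1 fun i => if i = m then -1 else 0) fun i => if c = some i then 1 else 0

theorem quadForm_primeLin (P ε K : ℝ) (m : κ) (x : Option κ → ℝ) :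
    ∑ c, ∑ c', x c * x c' *
      (∑ e, primeWeight P ε K m e * (primeLin m e c * primeLin m e c')) =
    (1 - ε) * (x none - x (some m)) ^ 2 +
      (P - 8 * K) * ∑ i ∈ Finset.univ.erase m, x (some i) ^ 2 := by
  have h1 : ∑ c, ∑ c', x c * x c' *
      (∑ e, primeWeight P ε K m e * (primeLin m e c * primeLin m e c')) =
      ∑ e, primeWeight P ε K m e * (∑ c, x c * primeLin m e c) ^ 2 := by
    have h2 : ∀ e, primeWeight P ε K m e * (∑ c, x c * primeLin m e c) ^ 2 =
        ∑ c, ∑ c', x c * x c' * (primeWeight P ε K m e * (primeLin m e c * primeLin m e c')) := by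
      intro e
      rw [sq, Finset.sum_mul_sum, Finset.mul_sum]
      refine Finset.sum_congr rfl fun c _ => ?_
      rw [Finset.mul_sum]
      exact Finset.sum_congr rfl fun c' _ => by ring
    simp only [h2, Finset.mul_sum]
    symm
    rw [Finset.sum_comm]
    refine Finset.sum_congr rfl fun c _ => ?_
    rw [Finset.sum_comm]
  rw [h1, Fintype.sum_option]
  congr 1
  · have : ∑ c, x c * primeLin m none c = x none - x (some m) := by
      rw [Fintype.sum_option]; simp [primeLin, sub_eq_add_neg]
    rw [this]; rfl
  · rw [← Finset.add_sum_erase _ _ (Finset.mem_univ m)]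
    have h0 : primeWeight P ε K m (some m) = 0 := by simp [primeWeight]
    rw [h0, zero_mul, zero_add, Finset.mul_sum]
    refine Finset.sum_congr rfl fun i hi => ?_
    have : ∑ c, x c * primeLin m (some i) c = x (some i) := by
      simp [primeLin]
    rw [this]
    simp [primeWeight, Finset.ne_of_mem_erase hi]

theorem prime_form_inequality {P ε K c C T : ℝ} (hP : 4 ≤ P) (hε : 1 ≤ ε * (2 * P ^ 2))
    (hCT : C ^ 2 ≤ K * T) (hT : 0 ≤ T) :
    (1 - ε) * c ^ 2 + (P - 8 * K) * T ≤
      (c - C) ^ 2 + 2 * P / (P - 1) * ((c - C) * C) + P ^ 2 / (P - 1) * T := by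
  have hP1 : 0 < P - 1 := by linarith
  have hε0 : 0 < ε := by
    by_contra h
    push Not at h
    nlinarith [sq_nonneg P]
  have h1 : (c - C) ^ 2 + 2 * P / (P - 1) * ((c - C) * C) + P ^ 2 / (P - 1) * T =
      c ^ 2 + 2 * c * (C / (P - 1)) - C ^ 2 * ((P + 1) / (P - 1)) + P ^ 2 / (P - 1) * T := by
    field_simp; ring
  have h2 : P * T ≤ P ^ 2 / (P - 1) * T := by
    refine mul_le_mul_of_nonneg_right ?_ hT
    rw [le_div_iff₀ hP1]; nlinarith
  have h3 : (P + 1) / (P - 1) ≤ 2 := by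
    rw [div_le_iff₀ hP1]; linarith
  have h4 : -(ε * c ^ 2) - (C / (P - 1)) ^ 2 / ε ≤ 2 * c * (C / (P - 1)) := by
    have : 0 ≤ (ε * c + C / (P - 1)) ^ 2 / ε := by positivity
    have e : (ε * c + C / (P - 1)) ^ 2 / ε =
      ε * c ^ 2 + 2 * c * (C / (P - 1)) + (C / (P - 1)) ^ 2 / ε := by field_simp; ring
    linarith
  have h5 : (C / (P - 1)) ^ 2 / ε ≤ 4 * C ^ 2 := by
    rw [div_pow, div_div, div_le_iff₀ (by positivity)]
    have : 1 ≤ 4 * ((P - 1) ^ 2 * ε) := by nlinarith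
    nlinarith [sq_nonneg C]
  have h6 : C ^ 2 * ((P + 1) / (P - 1)) ≤ C ^ 2 * 2 := mul_le_mul_of_nonneg_left h3 (sq_nonneg _)
  rw [h1]
  have h7 : 0 ≤ K * T := (sq_nonneg C).trans hCT
  nlinarith

theorem le_sieve_main_prime [Fintype ι] [DecidableEq ι] {P ε : ι → ℝ} {K : ℝ} (hP : ∀ p, 4 ≤ P p)
    (hK : Fintype.card κ ≤ K)
    (hPK : ∀ p, 8 * K ≤ P p) (hε : ∀ p, 1 ≤ ε p * (2 * P p ^ 2)) (hε1 : ∀ p, ε p ≤ 1)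
    (m : κ) (T : Finset (ι → Option κ)) (a : (ι → Option κ) → ℝ) :
    ∑ E : ι → Option κ, (∏ p, primeWeight (P p) (ε p) K m (E p)) *
        (∑ D ∈ T, a D * ∏ p, primeLin m (E p) (D p)) ^ 2 ≤
      ∑ D ∈ T, ∑ D' ∈ T, a D * a D' *
        ∏ p, sieveGram (P p) (fun i => if i = m then 0 else 1 / (P p - 1)) (D p) (D' p) := by
  refine le_trans (Eq.le ?_) (sum_mul_prod_le_sum_mul_prod (ι := ι)
    (G' := fun p c c' => ∑ e, primeWeight (P p) (ε p) K m e * (primeLin m e c * primeLin m e c'))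
    (G := fun p => sieveGram (P p) (fun i => if i = m then 0 else 1 / (P p - 1))) ?_ ?_ T a)
  · simp only [Finset.prod_univ_sum, Fintype.piFinset_univ, Finset.prod_mul_distrib, sq,
      Finset.sum_mul_sum]
    simp only [Finset.mul_sum]
    rw [Finset.sum_comm]
    refine Finset.sum_congr rfl fun D _ => ?_
    rw [Finset.sum_comm]
    refine Finset.sum_congr rfl fun D' _ => Finset.sum_congr rfl fun E _ => ?_
    ring
  · intro p
    refine posSemidef_of_quadForm (fun c c' => ?_) fun x => ?_
    · exact Finset.sum_congr rfl fun e _ => by ring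
    · rw [quadForm_primeLin]
      have h1 : 0 ≤ 1 - ε p := by linarith [hε1 p]
      have h2 : 0 ≤ P p - 8 * K := by linarith [hPK p]
      have h3 : 0 ≤ ∑ i ∈ Finset.univ.erase m, x (some i) ^ 2 :=
        Finset.sum_nonneg fun _ _ => sq_nonneg _
      positivity
  · intro p
    refine posSemidef_of_quadForm (fun c c' => ?_) fun x => ?_
    · simp only [Pi.sub_apply]
      rw [sieveGram_comm]
      congr 1
      exact Finset.sum_congr rfl fun e _ => by ring
    · simp only [Pi.sub_apply, mul_sub, Finset.sum_sub_distrib]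
      rw [quadForm_primeLin, quadForm_sieveGram, sub_nonneg]
      set Q := ∑ i ∈ Finset.univ.erase m, x (some i) ^ 2 with hQ
      set C := ∑ i ∈ Finset.univ.erase m, x (some i) with hC
      have hCQ : C ^ 2 ≤ K * Q := by
        have h1 := sq_sum_le_card_mul_sum_sq (s := Finset.univ.erase m)
          (f := fun i => x (some i))
        have h3 : 0 ≤ Q := Finset.sum_nonneg fun _ _ => sq_nonneg _
        refine h1.trans (mul_le_mul_of_nonneg_right (le_trans ?_ hK) h3)
        exact_mod_cast Finset.card_le_univ _
      refine (prime_form_inequality (c := x none - x (some m)) (hP p) (hε p) hCQ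
        (Finset.sum_nonneg fun _ _ => sq_nonneg _)).trans_eq ?_
      have e1 : x none - ∑ i, x (some i) = x none - x (some m) - C := by
        rw [← Finset.add_sum_erase _ _ (Finset.mem_univ m)]; ring
      rw [e1, ← Finset.add_sum_erase _ _ (Finset.mem_univ m), if_pos rfl, zero_mul, zero_add,
        add_assoc]
      congr 1
      have hP1 : P p - 1 ≠ 0 := by linarith [hP p]
      rw [Finset.sum_congr rfl fun i hi => by rw [if_neg (Finset.ne_of_mem_erase hi)]]
      simp only [mul_add, Finset.sum_add_distrib, mul_pow, ← Finset.mul_sum]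
      rw [← hC, ← hQ]
      field_simp

end LocalForms

section PolyNorm

variable {F : Type*} [Field F] [Fintype F]

noncomputable def polyNorm (f : F[X]) : ℝ := (Fintype.card F : ℝ) ^ f.natDegree

theorem polyNorm_pos (f : F[X]) : 0 < polyNorm f :=
  pow_pos (Nat.cast_pos.2 Fintype.card_pos) _

@[simp] theorem polyNorm_one : polyNorm (1 : F[X]) = 1 := by simp [polyNorm]

theorem polyNorm_mul {f g : F[X]} (hf : f ≠ 0) (hg : g ≠ 0) :
    polyNorm (f * g) = polyNorm f * polyNorm g := by
  simp [polyNorm, natDegree_mul hf hg, pow_add]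

theorem polyNorm_prod {ι : Type*} (s : Finset ι) {f : ι → F[X]} (hf : ∀ i ∈ s, (f i).Monic) :
    polyNorm (∏ i ∈ s, f i) = ∏ i ∈ s, polyNorm (f i) := by
  simp [polyNorm, natDegree_prod_of_monic s f hf, Finset.prod_pow_eq_pow_sum]

end PolyNorm

section Tuples

variable {F : Type*} [Field F] {κ : Type*} [DecidableEq κ] {Q : Finset F[X]}

noncomputable def tupleOf (D : Q → Option κ) (i : κ) : F[X] := ∏ p with D p = some i, p.1

noncomputable def ofTuple (t : κ → F[X]) (p : Q) : Option κ :=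
  open Classical in if h : ∃ i, p.1 ∣ t i then some h.choose else none

structure IsGoodTuple (Q : Finset F[X]) (t : κ → F[X]) : Prop where
  monic : ∀ i, (t i).Monic
  mem : ∀ i p, p.Monic → Irreducible p → p ∣ t i → p ∈ Q
  sq : ∀ i, ∀ p ∈ Q, ¬ p ^ 2 ∣ t i
  coprime : ∀ i j, i ≠ j → ∀ p ∈ Q, p ∣ t i → ¬ p ∣ t j

variable (hQ : ∀ p ∈ Q, p.Monic ∧ Irreducible p)
include hQ

theorem tupleOf_monic (D : Q → Option κ) (i : κ) : (tupleOf D i).Monic :=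
  monic_prod_of_monic _ _ fun p _ => (hQ p.1 p.2).1

theorem dvd_tupleOf_iff (D : Q → Option κ) (i : κ) (p : Q) :
    p.1 ∣ tupleOf D i ↔ D p = some i := by
  constructor
  · intro h
    obtain ⟨p', hp', hd⟩ := ((hQ p.1 p.2).2.prime.dvd_finsetProd_iff _).1 h
    rw [Finset.mem_filter] at hp'
    have : p = p' := Subtype.ext <| eq_of_monic_of_associated (hQ p.1 p.2).1 (hQ p'.1 p'.2).1
      ((hQ p.1 p.2).2.associated_of_dvd (hQ p'.1 p'.2).2 hd)
    rw [this]; exact hp'.2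
  · intro h
    exact Finset.dvd_prod_of_mem _ (by simp [h])

theorem tupleOf_injective : Function.Injective (tupleOf : (Q → Option κ) → κ → F[X]) := by
  intro D D' h
  funext p
  refine Option.ext fun i => ?_
  rw [← dvd_tupleOf_iff hQ, ← dvd_tupleOf_iff hQ, h]

theorem prod_sieveNorm_eq [Fintype F] [Fintype κ] (D : Q → Option κ) :
    ∏ p, sieveNorm (polyNorm p.1) (D p) = ∏ i, polyNorm (tupleOf D i) := by
  have h1 : ∀ i, polyNorm (tupleOf D i) = ∏ p : Q, if D p = some i then polyNorm p.1 else 1 := by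
    intro i
    rw [tupleOf, polyNorm_prod _ fun p _ => (hQ p.1 p.2).1, Finset.prod_filter]
  simp only [h1]
  rw [Finset.prod_comm]
  refine Finset.prod_congr rfl fun p _ => ?_
  rcases h : D p with _ | i <;> simp [sieveNorm]

omit [DecidableEq κ] hQ in
theorem IsGoodTuple.ofTuple_eq_some_iff {t : κ → F[X]} (ht : IsGoodTuple Q t) (p : Q) (i : κ) :
    ofTuple t p = some i ↔ p.1 ∣ t i := by
  unfold ofTuple
  constructor
  · intro h
    split_ifs at h with h'
    rw [← Option.some.inj h]
    exact h'.choose_spec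
  · intro h
    have h' : ∃ i, p.1 ∣ t i := ⟨i, h⟩
    rw [dif_pos h']
    congr 1
    by_contra hne
    exact ht.coprime _ _ hne p.1 p.2 h'.choose_spec h

theorem IsGoodTuple.tupleOf_ofTuple {t : κ → F[X]} (ht : IsGoodTuple Q t) :
    tupleOf (Q := Q) (ofTuple t) = t := by
  funext i
  have hdvd : tupleOf (Q := Q) (ofTuple t) i ∣ t i := by
    refine Finset.prod_dvd_of_coprime (fun p _ p' _ hne => ?_) fun p hp => ?_
    · refine ((hQ p.1 p.2).2.coprime_iff_not_dvd).2 fun h => hne ?_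
      exact Subtype.ext <| eq_of_monic_of_associated (hQ p.1 p.2).1 (hQ p'.1 p'.2).1
        ((hQ p.1 p.2).2.associated_of_dvd (hQ p'.1 p'.2).2 h)
    · rw [Finset.mem_filter, ht.ofTuple_eq_some_iff] at hp
      exact hp.2
  obtain ⟨s, hs⟩ := hdvd
  have hsm : s.Monic := (tupleOf_monic hQ _ i).of_mul_monic_left (hs ▸ ht.monic i)
  have hs1 : s = 1 := by
    by_contra hne
    obtain ⟨p, hpm, hpi, hps⟩ := exists_monic_irreducible_factor s
      (fun h => hne (hsm.eq_one_of_isUnit h))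
    have h1 : p ∣ t i := hs ▸ hps.mul_left _
    have h2 := ht.mem i p hpm hpi h1
    have h3 : p ∣ tupleOf (Q := Q) (ofTuple t) i :=
      (dvd_tupleOf_iff hQ _ i ⟨p, h2⟩).2 ((ht.ofTuple_eq_some_iff _ _).2 h1)
    exact ht.sq i p h2 (by rw [hs, _root_.sq]; exact mul_dvd_mul h3 hps)
  rw [hs, hs1, mul_one]

end Tuples

section Auxiliary

theorem Finset.sum_le_sum_of_injOn {α β : Type*} {s : Finset α} {t : Finset β} (e : α → β)
    (he : ∀ i ∈ s, e i ∈ t) (hinj : Set.InjOn e s) {f : α → ℝ} {g : β → ℝ}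
    (hfg : ∀ i ∈ s, f i ≤ g (e i)) (hg : ∀ j ∈ t, 0 ≤ g j) : ∑ i ∈ s, f i ≤ ∑ j ∈ t, g j := by
  classical
  calc ∑ i ∈ s, f i ≤ ∑ i ∈ s, g (e i) := Finset.sum_le_sum hfg
    _ = ∑ j ∈ s.image e, g j := (Finset.sum_image hinj).symm
    _ ≤ _ := Finset.sum_le_sum_of_subset_of_nonneg (Finset.image_subset_iff.2 he)
        fun j hj _ => hg j hj

theorem Finset.one_sub_sum_le_prod_one_sub {α : Type*} (s : Finset α) {f : α → ℝ}
    (h0 : ∀ i ∈ s, 0 ≤ f i) (h1 : ∀ i ∈ s, f i ≤ 1) : 1 - ∑ i ∈ s, f i ≤ ∏ i ∈ s, (1 - f i) := by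
  classical
  induction s using Finset.induction_on with
  | empty => simp
  | insert a s ha ih =>
    rw [Finset.sum_insert ha, Finset.prod_insert ha]
    have h2 := ih (fun i hi => h0 i (Finset.mem_insert_of_mem hi))
      fun i hi => h1 i (Finset.mem_insert_of_mem hi)
    have h3 := h0 a (Finset.mem_insert_self _ _)
    have h4 := h1 a (Finset.mem_insert_self _ _)
    have h5 : ∏ i ∈ s, (1 - f i) ≤ 1 := Finset.prod_le_one
      (fun i hi => sub_nonneg.2 (h1 i (Finset.mem_insert_of_mem hi)))
      (fun i hi => by linarith [h0 i (Finset.mem_insert_of_mem hi)])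
    nlinarith

variable {κ α : Type*} [Fintype κ] [DecidableEq κ]

theorem sum_piFinset_prod_mul_le {R : κ → Finset α} {φ ψ : κ → α → ℝ} {c : κ → ℝ}
    (hφ : ∀ i r, 0 ≤ φ i r) (hψ : ∀ i r, 0 ≤ ψ i r)
    (h : ∀ i, ∑ r ∈ R i, φ i r * ψ i r ≤ c i * ∑ r ∈ R i, φ i r) :
    ∑ t ∈ Fintype.piFinset R, (∏ i, φ i (t i)) * ∏ i, ψ i (t i) ≤
      (∏ i, c i) * ∏ i, ∑ r ∈ R i, φ i r := by
  rw [Finset.sum_congr rfl fun t _ => (Finset.prod_mul_distrib (f := fun i => φ i (t i))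
    (g := fun i => ψ i (t i))).symm]
  rw [← Finset.prod_univ_sum R (fun i r => φ i r * ψ i r), ← Finset.prod_mul_distrib]
  exact Finset.prod_le_prod (fun i _ => Finset.sum_nonneg fun r _ => mul_nonneg (hφ i r) (hψ i r))
    fun i _ => h i

theorem sum_piFinset_prod_mul_single_le {R : κ → Finset α} {φ : κ → α → ℝ} {ψ : α → ℝ} {c : ℝ}
    (hφ : ∀ i r, 0 ≤ φ i r) (hψ : ∀ r, 0 ≤ ψ r) (j : κ)
    (h : ∑ r ∈ R j, φ j r * ψ r ≤ c * ∑ r ∈ R j, φ j r) :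
    ∑ t ∈ Fintype.piFinset R, (∏ i, φ i (t i)) * ψ (t j) ≤ c * ∏ i, ∑ r ∈ R i, φ i r := by
  have := sum_piFinset_prod_mul_le (R := R) (φ := φ) (ψ := fun i r => if i = j then ψ r else 1)
    (c := fun i => if i = j then c else 1) hφ (fun i r => by split_ifs <;> simp [hψ])
    (fun i => by
      by_cases hij : i = j
      · subst hij; simpa using h
      · simp [hij])
  simpa using this

theorem sum_piFinset_prod_mul_pair_le {R : κ → Finset α} {φ : κ → α → ℝ} {ψ χ : α → ℝ} {c d : ℝ}
    (hφ : ∀ i r, 0 ≤ φ i r) (hψ : ∀ r, 0 ≤ ψ r) (hχ : ∀ r, 0 ≤ χ r) {j l : κ} (hjl : j ≠ l)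
    (h : ∑ r ∈ R j, φ j r * ψ r ≤ c * ∑ r ∈ R j, φ j r)
    (h' : ∑ r ∈ R l, φ l r * χ r ≤ d * ∑ r ∈ R l, φ l r) :
    ∑ t ∈ Fintype.piFinset R, (∏ i, φ i (t i)) * (ψ (t j) * χ (t l)) ≤
      c * d * ∏ i, ∑ r ∈ R i, φ i r := by
  have := sum_piFinset_prod_mul_le (R := R) (φ := φ)
    (ψ := fun i r => (if i = j then ψ r else 1) * (if i = l then χ r else 1))
    (c := fun i => (if i = j then c else 1) * (if i = l then d else 1)) hφ
    (fun i r => mul_nonneg (by split_ifs <;> simp [hψ]) (by split_ifs <;> simp [hχ]))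
    (fun i => by
      by_cases hij : i = j
      · subst hij; simpa [hjl] using h
      · by_cases hil : i = l
        · subst hil; simpa [hij] using h'
        · simp [hij, hil])
  simpa only [Finset.prod_mul_distrib, Finset.prod_ite_eq', Finset.mem_univ, if_true] using this

end Auxiliary

structure SieveData {F : Type*} [Field F] (Q R : Finset F[X]) (β : F[X] → ℝ) : Prop where
  prime : ∀ p ∈ Q, p.Monic ∧ Irreducible p
  monic : ∀ r ∈ R, r.Monic
  one_mem : 1 ∈ R
  mem_prime : ∀ r ∈ R, ∀ p, p.Monic → Irreducible p → p ∣ r → p ∈ Q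
  closed : ∀ d r, d.Monic → r.Monic → d * r ∈ R → r ∈ R
  beta_one : β 1 = 1
  one_le_beta : ∀ r, 1 ≤ β r
  beta_mono : ∀ d r, d.Monic → r.Monic → β r ≤ β (d * r)

section SieveWeights

variable {F : Type*} [Field F] [Fintype F] {κ : Type*} [Fintype κ] [DecidableEq κ]
  {Q R : Finset F[X]} {β : F[X] → ℝ}

noncomputable def sieveSupport (κ : Type*) [Fintype κ] [DecidableEq κ] (Q R : Finset F[X])
    (β : F[X] → ℝ) (L : ℝ) : Finset (Q → Option κ) :=
  open Classical in {D | (∀ i, tupleOf D i ∈ R) ∧ ∑ i, β (tupleOf D i) ≤ L}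

noncomputable def sieveWeight (β : F[X] → ℝ) (D : Q → Option κ) : ℝ :=
  (∏ p, sieveConst (D p)) * ∏ i, (β (tupleOf D i) * polyNorm (tupleOf D i))⁻¹

omit [Fintype F] in
theorem mem_sieveSupport {L : ℝ} {D : Q → Option κ} : D ∈ sieveSupport κ Q R β L ↔
    (∀ i, tupleOf D i ∈ R) ∧ ∑ i, β (tupleOf D i) ≤ L := by
  simp [sieveSupport]

omit [Fintype F] [Fintype κ] [DecidableEq κ] in
theorem abs_prod_sieveConst (D : Q → Option κ) : |∏ p, sieveConst (D p)| = 1 := by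
  rw [Finset.abs_prod]
  refine Finset.prod_eq_one fun p _ => ?_
  rcases D p with _ | i <;> simp [sieveConst]

omit [Fintype F] in
theorem sum_sieveSupport_le (sd : SieveData Q R β) (L : ℝ) {f : (κ → F[X]) → ℝ}
    (hf : ∀ t, 0 ≤ f t) :
    ∑ D ∈ sieveSupport κ Q R β L, f (tupleOf D) ≤ ∑ t ∈ Fintype.piFinset fun _ => R, f t := by
  refine Finset.sum_le_sum_of_injOn tupleOf (fun D hD => ?_)
    ((tupleOf_injective sd.prime).injOn) (fun _ _ => le_rfl) fun t _ => hf t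
  rw [Fintype.mem_piFinset]
  exact (mem_sieveSupport.1 hD).1

theorem SieveData.inv_nonneg (sd : SieveData Q R β) (r : F[X]) : 0 ≤ (β r * polyNorm r)⁻¹ :=
  _root_.inv_nonneg.2 (mul_nonneg (zero_le_one.trans (sd.one_le_beta r)) (polyNorm_pos r).le)

theorem sum_abs_sieveWeight_le (sd : SieveData Q R β) (L : ℝ) :
    ∑ D ∈ sieveSupport κ Q R β L, |sieveWeight β D| ≤
      (∑ r ∈ R, (β r * polyNorm r)⁻¹) ^ Fintype.card κ := by
  have h := sum_sieveSupport_le (κ := κ) sd L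
    (f := fun t => ∏ i, (β (t i) * polyNorm (t i))⁻¹)
    (fun t => Finset.prod_nonneg fun i _ => sd.inv_nonneg _)
  rw [← Finset.prod_univ_sum (fun _ => R) (fun _ r => (β r * polyNorm r)⁻¹), Finset.prod_const,
    Finset.card_univ] at h
  refine le_trans (Eq.le ?_) h
  refine Finset.sum_congr rfl fun D _ => ?_
  rw [sieveWeight, abs_mul, abs_prod_sieveConst, one_mul,
    abs_of_nonneg (Finset.prod_nonneg fun i _ => sd.inv_nonneg _)]

theorem sum_sieveWeight_sq_mul_le (sd : SieveData Q R β) (L : ℝ) :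
    ∑ D ∈ sieveSupport κ Q R β L,
        sieveWeight β D ^ 2 * ∏ p, sieveNorm (polyNorm p.1) (D p) ≤
      (∑ r ∈ R, (β r ^ 2 * polyNorm r)⁻¹) ^ Fintype.card κ := by
  have h := sum_sieveSupport_le (κ := κ) sd L
    (f := fun t => ∏ i, (β (t i) ^ 2 * polyNorm (t i))⁻¹)
    (fun t => Finset.prod_nonneg fun i _ =>
      _root_.inv_nonneg.2 (mul_nonneg (sq_nonneg _) (polyNorm_pos _).le))
  rw [← Finset.prod_univ_sum (fun _ => R) (fun _ r => (β r ^ 2 * polyNorm r)⁻¹),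
    Finset.prod_const, Finset.card_univ] at h
  refine le_trans (Eq.le ?_) h
  refine Finset.sum_congr rfl fun D _ => ?_
  rw [prod_sieveNorm_eq sd.prime, sieveWeight, mul_pow, ← sq_abs (∏ p, _), abs_prod_sieveConst,
    one_pow, one_mul, ← Finset.prod_pow, ← Finset.prod_mul_distrib]
  refine Finset.prod_congr rfl fun i _ => ?_
  have := (polyNorm_pos (tupleOf D i)).ne'
  rw [inv_pow, mul_pow, sq (polyNorm _), ← mul_assoc]
  field_simp

omit [Fintype F] in
theorem sum_natDegree_tupleOf_le {n L H : ℕ}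
    (hβ : ∀ r ∈ R, (r.natDegree : ℝ) ≤ H * β r) (hn : L * H ≤ n) (D : Q → Option κ)
    (hD : D ∈ sieveSupport κ Q R β L) :
    ∑ i, (tupleOf D i).natDegree ≤ n := by
  have h1 := mem_sieveSupport.1 hD
  have h2 : ((∑ i, (tupleOf D i).natDegree : ℕ) : ℝ) ≤ n := by
    push_cast
    calc _ ≤ ∑ i, H * β (tupleOf D i) := Finset.sum_le_sum fun i _ => hβ _ (h1.1 i)
      _ = H * ∑ i, β (tupleOf D i) := by rw [Finset.mul_sum]
      _ ≤ H * L := mul_le_mul_of_nonneg_left h1.2 (Nat.cast_nonneg _)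
      _ ≤ n := by exact_mod_cast (mul_comm H L ▸ hn)
  exact_mod_cast h2

theorem sum_filter_dvd_le {u : F[X] → ℝ} (hu : ∀ r, 0 ≤ u r) {d : F[X]}
    {R : Finset F[X]} (hR : ∀ r ∈ R, r.Monic) (hcl : ∀ r, r.Monic → d * r ∈ R → r ∈ R)
    (hd : d.Monic) (hud : ∀ r, r.Monic → u (d * r) ≤ (polyNorm d)⁻¹ * u r)
    [DecidablePred (d ∣ ·)] :
    ∑ r ∈ R, u r * (if d ∣ r then 1 else 0) ≤ (polyNorm d)⁻¹ * ∑ r ∈ R, u r := by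
  classical
  have h1 : ∑ r ∈ R, u r * (if d ∣ r then 1 else 0) = ∑ r ∈ R with d ∣ r, u r := by
    rw [Finset.sum_filter]
    exact Finset.sum_congr rfl fun r _ => by split_ifs <;> simp
  rw [h1, Finset.mul_sum]
  have h2 : (R.filter (d ∣ ·)) ⊆ R.image (d * ·) := by
    intro r hr
    rw [Finset.mem_filter] at hr
    obtain ⟨hr, s, rfl⟩ := hr
    have hs : s.Monic := hd.of_mul_monic_left (hR _ hr)
    exact Finset.mem_image_of_mem _ (hcl s hs hr)
  refine (Finset.sum_le_sum_of_subset_of_nonneg h2 fun r _ _ => hu r).trans ?_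
  rw [Finset.sum_image fun x _ y _ hxy => mul_left_cancel₀ hd.ne_zero hxy]
  exact Finset.sum_le_sum fun r hr => hud r (hR r hr)

end SieveWeights

section SieveLower

variable {F : Type*} [Field F] [Fintype F] {κ : Type*} [Fintype κ] [DecidableEq κ]
  {Q R : Finset F[X]} {β : F[X] → ℝ}

omit [Fintype κ] in
theorem sieveConst_mul_primeLin_nonneg (m : κ) (e c : Option κ) :
    0 ≤ sieveConst e * (sieveConst c * primeLin m e c) := by
  rcases e with _ | i <;> rcases c with _ | j <;> simp [sieveConst, primeLin] <;>
    split_ifs <;> simp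

omit [Fintype F] [Fintype κ] in
theorem IsGoodTuple.prod_local_eq_one {t : κ → F[X]} (ht : IsGoodTuple Q t) {m : κ}
    (hQ : ∀ p ∈ Q, p.Monic ∧ Irreducible p) (htm : t m = 1)
    {r : F[X]} (hr : IsGoodTuple Q (Function.update t m r)) (p : Q) :
    sieveConst (ofTuple t p) * (sieveConst (ofTuple (Function.update t m r) p) *
      primeLin m (ofTuple t p) (ofTuple (Function.update t m r) p)) = 1 := by
  rcases h : ofTuple t p with _ | i
  · rcases h' : ofTuple (Function.update t m r) p with _ | j
    · simp [sieveConst, primeLin]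
    · by_cases hj : j = m
      · simp [sieveConst, primeLin, hj]
      · rw [hr.ofTuple_eq_some_iff, Function.update_of_ne hj, ← ht.ofTuple_eq_some_iff, h] at h'
        cases h'
  · have hi : p.1 ∣ t i := (ht.ofTuple_eq_some_iff p i).1 h
    have him : i ≠ m := by
      rintro rfl
      rw [htm] at hi
      exact (hQ p.1 p.2).2.not_isUnit (isUnit_of_dvd_one hi)
    have : ofTuple (Function.update t m r) p = some i := by
      rw [hr.ofTuple_eq_some_iff, Function.update_of_ne him]; exact hi
    simp [this, sieveConst, primeLin]

open Classical in
theorem le_abs_sum_sieveWeight_mul (sd : SieveData Q R β) {L B : ℝ} (hB : ∀ r ∈ R, β r ≤ B)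
    {t : κ → F[X]} (ht : IsGoodTuple Q t) {m : κ} (htm : t m = 1) (htR : ∀ i, t i ∈ R)
    (htL : ∑ i, β (t i) ≤ L - B) :
    (∏ i, (β (t i) * polyNorm (t i))⁻¹) *
      ∑ r ∈ R with IsGoodTuple Q (Function.update t m r), (β r * polyNorm r)⁻¹ ≤
      |∑ D ∈ sieveSupport κ Q R β L, sieveWeight β D *
        ∏ p, primeLin m (ofTuple t p) (D p)| := by
  set s : ℝ := ∏ p : Q, sieveConst (ofTuple t p) with hs
  set T := sieveSupport κ Q R β L
  set v : F[X] → ℝ := fun r => (β r * polyNorm r)⁻¹ with hv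
  have hterm : ∀ D : Q → Option κ, s * (sieveWeight β D * ∏ p, primeLin m (ofTuple t p) (D p)) =
      (∏ p, sieveConst (ofTuple t p) * (sieveConst (D p) * primeLin m (ofTuple t p) (D p))) *
        ∏ i, v (tupleOf D i) := by
    intro D
    rw [Finset.prod_mul_distrib, Finset.prod_mul_distrib, sieveWeight]
    ring
  calc _ = ∑ r ∈ R with IsGoodTuple Q (Function.update t m r), (∏ i, v (t i)) * v r := by
        rw [Finset.mul_sum]
    _ ≤ ∑ D ∈ T, s * (sieveWeight β D * ∏ p, primeLin m (ofTuple t p) (D p)) := by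
        refine Finset.sum_le_sum_of_injOn (fun r => ofTuple (Function.update t m r)) ?_ ?_ ?_ ?_
        · intro r hr
          rw [Finset.mem_filter] at hr
          rw [mem_sieveSupport, hr.2.tupleOf_ofTuple sd.prime]
          constructor
          · intro i
            by_cases hi : i = m
            · subst hi; simpa using hr.1
            · rw [Function.update_of_ne hi]; exact htR i
          · have h1 : ∑ i, β (Function.update t m r i) ≤ β r + ∑ i, β (t i) := by
              rw [← Finset.add_sum_erase _ _ (Finset.mem_univ m), Function.update_self]
              rw [← Finset.add_sum_erase (a := m) Finset.univ (fun i => β (t i))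
                (Finset.mem_univ m)]
              have h2 : ∑ i ∈ Finset.univ.erase m, β (Function.update t m r i) =
                  ∑ i ∈ Finset.univ.erase m, β (t i) :=
                Finset.sum_congr rfl fun i hi => by
                  rw [Function.update_of_ne (Finset.ne_of_mem_erase hi)]
              rw [h2]
              linarith [sd.one_le_beta (t m)]
            linarith [hB r hr.1]
        · intro r hr r' hr' h
          have hr := (Finset.mem_filter.1 (Finset.mem_coe.1 hr)).2
          have hr' := (Finset.mem_filter.1 (Finset.mem_coe.1 hr')).2
          have h1 := congrArg (fun D => tupleOf D m) h
          simp only [hr.tupleOf_ofTuple sd.prime, hr'.tupleOf_ofTuple sd.prime] at h1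
          simpa using h1
        · intro r hr
          rw [Finset.mem_filter] at hr
          rw [hterm, hr.2.tupleOf_ofTuple sd.prime,
            Finset.prod_eq_one fun p _ => ht.prod_local_eq_one sd.prime htm hr.2 p, one_mul]
          rw [← Finset.mul_prod_erase (a := m) Finset.univ (fun i => v (t i)) (Finset.mem_univ m),
            ← Finset.mul_prod_erase (a := m) Finset.univ
              (fun i => v (Function.update t m r i)) (Finset.mem_univ m), Function.update_self]
          have h2 : ∏ i ∈ Finset.univ.erase m, v (Function.update t m r i) =
              ∏ i ∈ Finset.univ.erase m, v (t i) :=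
            Finset.prod_congr rfl fun i hi => by
              rw [Function.update_of_ne (Finset.ne_of_mem_erase hi)]
          have h3 : v (t m) = 1 := by simp [hv, htm, sd.beta_one]
          rw [h2, h3, one_mul, mul_comm]
        · intro D _
          rw [hterm]
          exact mul_nonneg (Finset.prod_nonneg fun p _ => sieveConst_mul_primeLin_nonneg _ _ _)
            (Finset.prod_nonneg fun i _ => sd.inv_nonneg _)
    _ = s * ∑ D ∈ T, sieveWeight β D * ∏ p, primeLin m (ofTuple t p) (D p) := by
        rw [Finset.mul_sum]
    _ ≤ |s * ∑ D ∈ T, sieveWeight β D * ∏ p, primeLin m (ofTuple t p) (D p)| := le_abs_self _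
    _ = _ := by rw [abs_mul, hs, abs_prod_sieveConst, one_mul]

theorem SieveData.inv_mul_le (sd : SieveData Q R β) {d r : F[X]} (hd : d.Monic) (hr : r.Monic) :
    (β (d * r) * polyNorm (d * r))⁻¹ ≤ (polyNorm d)⁻¹ * (β r * polyNorm r)⁻¹ := by
  rw [polyNorm_mul hd.ne_zero hr.ne_zero, ← mul_inv]
  have h1 := sd.one_le_beta r
  have h2 := sd.beta_mono d r hd hr
  have h3 := polyNorm_pos d
  have h4 := polyNorm_pos r
  refine inv_anti₀ (by positivity) ?_
  have : β r * (polyNorm d * polyNorm r) ≤ β (d * r) * (polyNorm d * polyNorm r) := by gcongr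
  linarith

theorem SieveData.sq_inv_mul_le (sd : SieveData Q R β) {d r : F[X]} (hd : d.Monic) (hr : r.Monic) :
    (β (d * r) ^ 2 * polyNorm (d * r))⁻¹ ≤ (polyNorm d)⁻¹ * (β r ^ 2 * polyNorm r)⁻¹ := by
  rw [polyNorm_mul hd.ne_zero hr.ne_zero, ← mul_inv]
  have h1 := sd.one_le_beta r
  have h2 := sd.beta_mono d r hd hr
  have h3 := polyNorm_pos d
  have h4 := polyNorm_pos r
  refine inv_anti₀ (by positivity) ?_
  have : β r ^ 2 * (polyNorm d * polyNorm r) ≤ β (d * r) ^ 2 * (polyNorm d * polyNorm r) := by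
    gcongr
  linarith

omit [Fintype F] [Fintype κ] in
open Classical in
theorem IsGoodTuple.update {t : κ → F[X]} (ht : IsGoodTuple Q t) (sd : SieveData Q R β) {m : κ}
    {r : F[X]} (hr : r ∈ R) (h1 : ∀ p ∈ Q, ¬ p ^ 2 ∣ r) (h2 : ∀ i, ∀ p ∈ Q, p ∣ t i → ¬ p ∣ r) :
    IsGoodTuple Q (Function.update t m r) := by
  constructor
  · intro i
    by_cases hi : i = m
    · subst hi; simpa using sd.monic r hr
    · rw [Function.update_of_ne hi]; exact ht.monic i
  · intro i p
    by_cases hi : i = m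
    · subst hi; simpa using sd.mem_prime r hr p
    · rw [Function.update_of_ne hi]; exact ht.mem i p
  · intro i p hp
    by_cases hi : i = m
    · subst hi; simpa using h1 p hp
    · rw [Function.update_of_ne hi]; exact ht.sq i p hp
  · intro i j hij p hp hpi hpj
    by_cases hi : i = m
    · subst hi
      rw [Function.update_self] at hpi
      rw [Function.update_of_ne (Ne.symm hij)] at hpj
      exact h2 _ p hp hpj hpi
    · rw [Function.update_of_ne hi] at hpi
      by_cases hj : j = m
      · subst hj
        rw [Function.update_self] at hpj
        exact h2 _ p hp hpi hpj
      · rw [Function.update_of_ne hj] at hpj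
        exact ht.coprime i j hij p hp hpi hpj

open Classical in
theorem le_sum_isGoodTuple_update (sd : SieveData Q R β) {t : κ → F[X]} (ht : IsGoodTuple Q t)
    (m : κ) :
    (∑ r ∈ R, (β r * polyNorm r)⁻¹) * (1 - (∑ p ∈ Q, (polyNorm (p ^ 2))⁻¹ +
      ∑ i, ∑ p ∈ Q, if p ∣ t i then (polyNorm p)⁻¹ else 0)) ≤
      ∑ r ∈ R with IsGoodTuple Q (Function.update t m r), (β r * polyNorm r)⁻¹ := by
  set v : F[X] → ℝ := fun r => (β r * polyNorm r)⁻¹ with hv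
  have hv0 : ∀ r, 0 ≤ v r := sd.inv_nonneg
  have hdvd : ∀ d : F[X], d.Monic → ∑ r ∈ R, v r * (if d ∣ r then 1 else 0) ≤
      (polyNorm d)⁻¹ * ∑ r ∈ R, v r := fun d hd =>
    sum_filter_dvd_le hv0 sd.monic (fun r hr h => sd.closed d r hd hr h) hd
      fun r hr => sd.inv_mul_le hd hr
  have hr : ∀ r ∈ R, v r * (1 - (∑ p ∈ Q, (if p ^ 2 ∣ r then 1 else 0) +
      ∑ i, ∑ p ∈ Q, if p ∣ t i then (if p ∣ r then 1 else 0) else 0)) ≤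
      if IsGoodTuple Q (Function.update t m r) then v r else 0 := by
    intro r hr
    have n1 : (0 : ℝ) ≤ ∑ p ∈ Q, (if p ^ 2 ∣ r then 1 else 0) :=
      Finset.sum_nonneg fun p _ => by split_ifs <;> simp
    have n2' : ∀ i, ∀ p ∈ Q, (0 : ℝ) ≤ if p ∣ t i then (if p ∣ r then 1 else 0) else 0 :=
      fun i p _ => by split_ifs <;> simp
    have n2 : (0 : ℝ) ≤ ∑ i, ∑ p ∈ Q, if p ∣ t i then (if p ∣ r then 1 else 0) else 0 :=
      Finset.sum_nonneg fun i _ => Finset.sum_nonneg (n2' i)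
    split_ifs with hg
    · have := hv0 r
      nlinarith
    · have hge : (1 : ℝ) ≤ ∑ p ∈ Q, (if p ^ 2 ∣ r then 1 else 0) +
          ∑ i, ∑ p ∈ Q, if p ∣ t i then (if p ∣ r then 1 else 0) else 0 := by
        by_contra hlt
        apply hg
        refine ht.update sd hr (fun p hp hd => hlt ?_) (fun i p hp hpi hd => hlt ?_)
        · have := Finset.single_le_sum (s := Q) (f := fun p => if p ^ 2 ∣ r then (1 : ℝ) else 0)
            (fun p _ => by split_ifs <;> simp) hp
          simp only [if_pos hd] at this
          linarith
        · have h1 := Finset.single_le_sum (n2' i) hp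
          have h2 := Finset.single_le_sum
            (f := fun i => ∑ p ∈ Q, if p ∣ t i then (if p ∣ r then (1 : ℝ) else 0) else 0)
            (fun i _ => Finset.sum_nonneg (n2' i)) (Finset.mem_univ i)
          rw [if_pos hpi, if_pos hd] at h1
          linarith
      have := hv0 r
      nlinarith
  rw [Finset.sum_filter]
  refine le_trans ?_ (Finset.sum_le_sum hr)
  simp only [mul_sub, mul_add, mul_one, Finset.sum_sub_distrib, Finset.sum_add_distrib,
    Finset.mul_sum (s := Q), Finset.mul_sum (s := Finset.univ)]
  refine sub_le_sub_left (add_le_add ?_ ?_) _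
  · rw [Finset.sum_comm]
    refine Finset.sum_le_sum fun p hp => ?_
    rw [mul_comm]
    exact hdvd _ ((sd.prime p hp).1.pow 2)
  · rw [Finset.sum_comm]
    refine Finset.sum_le_sum fun i _ => ?_
    rw [Finset.sum_comm]
    refine Finset.sum_le_sum fun p hp => ?_
    by_cases hpi : p ∣ t i
    · simp only [if_pos hpi]
      rw [mul_comm]
      exact hdvd _ (sd.prime p hp).1
    · simp [hpi]

end SieveLower

section SieveLowerMain

variable {F : Type*} [Field F] [Fintype F] {κ : Type*} [Fintype κ] [DecidableEq κ]
  {Q R : Finset F[X]} {β : F[X] → ℝ}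

open Classical in
theorem IsGoodTuple.exists_prod_primeWeight_eq (hQ : ∀ p ∈ Q, p.Monic ∧ Irreducible p)
    {t : κ → F[X]} (ht : IsGoodTuple Q t) {m : κ} (htm : t m = 1) {K : ℝ} (hK : 0 ≤ K)
    (hKQ : ∀ p ∈ Q, 8 * K ≤ polyNorm p) {ε : Q → ℝ} (hε0 : ∀ p, 0 ≤ ε p) (hε1 : ∀ p, ε p ≤ 1) :
    ∃ w : ℝ, 0 ≤ w ∧ w ≤ 1 ∧
      1 - (∑ p, ε p + ∑ i, ∑ p ∈ Q, if p ∣ t i then 8 * K * (polyNorm p)⁻¹ else 0) ≤ w ∧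
      ∏ p : Q, primeWeight (polyNorm p.1) (ε p) K m (ofTuple t p) =
        (∏ i, polyNorm (t i)) * w := by
  set δ : Q → ℝ := fun p => (ofTuple t p).elim (ε p) fun _ => 8 * K * (polyNorm p.1)⁻¹ with hδ
  have hr0 : ∀ p ∈ Q, 0 ≤ 8 * K * (polyNorm p)⁻¹ := fun p _ => by
    have := polyNorm_pos p; positivity
  have hr1 : ∀ p ∈ Q, 8 * K * (polyNorm p)⁻¹ ≤ 1 := fun p hp => by
    rw [← div_eq_mul_inv, div_le_one (polyNorm_pos p)]; exact hKQ p hp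
  have hδ0 : ∀ p, 0 ≤ δ p := by
    intro p
    rcases h : ofTuple t p with _ | i <;> simp only [hδ, h, Option.elim_none, Option.elim_some]
    · exact hε0 p
    · exact hr0 p.1 p.2
  have hδ1 : ∀ p, δ p ≤ 1 := by
    intro p
    rcases h : ofTuple t p with _ | i <;> simp only [hδ, h, Option.elim_none, Option.elim_some]
    · exact hε1 p
    · exact hr1 p.1 p.2
  refine ⟨∏ p, (1 - δ p), Finset.prod_nonneg fun p _ => sub_nonneg.2 (hδ1 p),
    Finset.prod_le_one (fun p _ => sub_nonneg.2 (hδ1 p)) fun p _ => by linarith [hδ0 p], ?_, ?_⟩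
  · refine le_trans ?_ (Finset.one_sub_sum_le_prod_one_sub _ (fun p _ => hδ0 p) fun p _ => hδ1 p)
    refine sub_le_sub_left ?_ _
    rw [Finset.sum_comm, ← Finset.sum_coe_sort Q, ← Finset.sum_add_distrib]
    refine Finset.sum_le_sum fun p _ => ?_
    have hn : ∀ i ∈ Finset.univ, (0 : ℝ) ≤ if p.1 ∣ t i then 8 * K * (polyNorm p.1)⁻¹ else 0 :=
      fun i _ => by split_ifs; exacts [hr0 p.1 p.2, le_rfl]
    rcases h : ofTuple t p with _ | i <;> simp only [hδ, h, Option.elim_none, Option.elim_some]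
    · linarith [Finset.sum_nonneg hn]
    · have := Finset.single_le_sum hn (Finset.mem_univ i)
      rw [if_pos ((ht.ofTuple_eq_some_iff p i).1 h)] at this
      linarith [hε0 p]
  · have h1 := prod_sieveNorm_eq hQ (ofTuple (Q := Q) t)
    rw [ht.tupleOf_ofTuple hQ] at h1
    rw [← h1, ← Finset.prod_mul_distrib]
    refine Finset.prod_congr rfl fun p _ => ?_
    rcases h : ofTuple t p with _ | i <;>
      simp only [hδ, h, Option.elim_none, Option.elim_some, sieveNorm, primeWeight]
    · ring
    · have him : i ≠ m := by
        rintro rfl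
        have := (ht.ofTuple_eq_some_iff p i).1 h
        rw [htm] at this
        exact (hQ p.1 p.2).2.not_isUnit (isUnit_of_dvd_one this)
      rw [if_neg him]
      have := (polyNorm_pos p.1).ne'
      field_simp

theorem one_sub_le_mul_of_le {w v a b : ℝ} (hw : 0 ≤ w) (hw1 : w ≤ 1) (hv : 0 ≤ v) (hb : 0 ≤ b)
    (h1 : 1 - a ≤ w) (h2 : 1 - 2 * b ≤ v) : 1 - a - 2 * b ≤ w * v := by
  by_cases h : 0 ≤ 1 - 2 * b
  · nlinarith
  · by_cases h' : 0 ≤ 1 - a - 2 * b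
    · nlinarith [mul_nonneg hw hv]
    · linarith [mul_nonneg hw hv]

open Classical in
/-- The defect of a tuple: it bounds the relative loss in the contribution of `t`, and is at
least `1` if `t` does not contribute. -/
noncomputable def tupleDefect (Q : Finset F[X]) (β : F[X] → ℝ) (K M : ℝ) (t : κ → F[X]) : ℝ :=
  (∑ i, ∑ p ∈ Q, (8 * K + 2) * (polyNorm p)⁻¹ * (if p ∣ t i then 1 else 0)) +
    (∑ i, ∑ p ∈ Q, if p ^ 2 ∣ t i then 1 else 0) +
    (∑ i, ∑ j ∈ Finset.univ.erase i, ∑ p ∈ Q,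
      (if p ∣ t i then 1 else 0) * (if p ∣ t j then 1 else 0)) +
    ∑ i, M⁻¹ * β (t i)

open Classical in
theorem sum_le_sum_primeWeight_mul (sd : SieveData Q R β) {L B : ℝ} (hB : ∀ r ∈ R, β r ≤ B)
    (hLB : 0 < L - B) (m : κ) {K : ℝ} (hK : 0 ≤ K)
    (hKQ : ∀ p ∈ Q, 8 * K ≤ polyNorm p) {ε : Q → ℝ} (hε0 : ∀ p, 0 ≤ ε p) (hε1 : ∀ p, ε p ≤ 1) :
    ∑ t ∈ Fintype.piFinset fun i => if i = m then {1} else R,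
        (∏ i, (β (t i) ^ 2 * polyNorm (t i))⁻¹) * ((∑ r ∈ R, (β r * polyNorm r)⁻¹) ^ 2 *
          (1 - ∑ p, ε p - 2 * (∑ p ∈ Q, (polyNorm (p ^ 2))⁻¹) - tupleDefect Q β K (L - B) t)) ≤
      ∑ E : Q → Option κ, (∏ p, primeWeight (polyNorm p.1) (ε p) K m (E p)) *
        (∑ D ∈ sieveSupport κ Q R β L, sieveWeight β D * ∏ p, primeLin m (E p) (D p)) ^ 2 := by
  set Z := ∑ r ∈ R, (β r * polyNorm r)⁻¹ with hZ
  set η := ∑ p ∈ Q, (polyNorm (p ^ 2))⁻¹ with hη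
  have hη0 : 0 ≤ η := Finset.sum_nonneg fun p _ => inv_nonneg.2 (polyNorm_pos _).le
  have hZ0 : 0 ≤ Z := Finset.sum_nonneg fun r _ => sd.inv_nonneg r
  have hε : 0 ≤ ∑ p, ε p := Finset.sum_nonneg fun p _ => hε0 p
  set S := Fintype.piFinset fun i => if i = m then {1} else R with hS
  have hSm : ∀ t ∈ S, t m = 1 ∧ ∀ i, t i ∈ R := by
    intro t ht
    rw [hS, Fintype.mem_piFinset] at ht
    have h1 : t m = 1 := by simpa using ht m
    refine ⟨h1, fun i => ?_⟩
    by_cases hi : i = m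
    · rw [hi, h1]; exact sd.one_mem
    · simpa [hi] using ht i
  have hQi : ∀ p ∈ Q, (0 : ℝ) ≤ (polyNorm p)⁻¹ := fun p _ => inv_nonneg.2 (polyNorm_pos _).le
  have n1 : ∀ t : κ → F[X], ∀ i, ∀ p ∈ Q,
      0 ≤ (8 * K + 2) * (polyNorm p)⁻¹ * (if p ∣ t i then 1 else 0) := fun t i p hp => by
    have := hQi p hp
    split_ifs <;> positivity
  have n2 : ∀ t : κ → F[X], ∀ i, ∀ p ∈ Q, (0 : ℝ) ≤ if p ^ 2 ∣ t i then 1 else 0 :=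
    fun t i p hp => by split_ifs <;> simp
  have n3 : ∀ t : κ → F[X], ∀ i j, ∀ p ∈ Q,
      (0 : ℝ) ≤ (if p ∣ t i then 1 else 0) * (if p ∣ t j then 1 else 0) :=
    fun t i j p hp => by split_ifs <;> simp
  have n4 : ∀ t : κ → F[X], ∀ i, 0 ≤ (L - B)⁻¹ * β (t i) := fun t i =>
    mul_nonneg (inv_nonneg.2 hLB.le) (zero_le_one.trans (sd.one_le_beta _))
  have s1 : ∀ t : κ → F[X], 0 ≤ ∑ i, ∑ p ∈ Q,
      (8 * K + 2) * (polyNorm p)⁻¹ * (if p ∣ t i then 1 else 0) :=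
    fun t => Finset.sum_nonneg fun i _ => Finset.sum_nonneg (n1 t i)
  have s2 : ∀ t : κ → F[X], (0 : ℝ) ≤ ∑ i, ∑ p ∈ Q, if p ^ 2 ∣ t i then 1 else 0 :=
    fun t => Finset.sum_nonneg fun i _ => Finset.sum_nonneg (n2 t i)
  have s3 : ∀ t : κ → F[X], (0 : ℝ) ≤ ∑ i, ∑ j ∈ Finset.univ.erase i, ∑ p ∈ Q,
      (if p ∣ t i then 1 else 0) * (if p ∣ t j then 1 else 0) :=
    fun t => Finset.sum_nonneg fun i _ => Finset.sum_nonneg fun j _ =>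
      Finset.sum_nonneg (n3 t i j)
  have s4 : ∀ t : κ → F[X], 0 ≤ ∑ i, (L - B)⁻¹ * β (t i) :=
    fun t => Finset.sum_nonneg fun i _ => n4 t i
  set good : (κ → F[X]) → Prop := fun t => IsGoodTuple Q t ∧ ∑ i, β (t i) ≤ L - B with hgood
  have hbad : ∀ t ∈ S, ¬ good t → 1 ≤ tupleDefect Q β K (L - B) t := by
    intro t ht hb
    by_contra hlt
    push Not at hlt
    unfold tupleDefect at hlt
    apply hb
    refine ⟨⟨fun i => sd.monic _ ((hSm t ht).2 i), fun i => sd.mem_prime _ ((hSm t ht).2 i),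
      fun i p hp hd => ?_, fun i j hij p hp hi hj => ?_⟩, ?_⟩
    · have h1 := Finset.single_le_sum (n2 t i) hp
      have h2 := Finset.single_le_sum
        (f := fun i => ∑ p ∈ Q, if p ^ 2 ∣ t i then (1 : ℝ) else 0)
        (fun i _ => Finset.sum_nonneg (n2 t i)) (Finset.mem_univ i)
      rw [if_pos hd] at h1
      linarith [s1 t, s3 t, s4 t]
    · have h1 := Finset.single_le_sum (n3 t i j) hp
      have h2 := Finset.single_le_sum
        (f := fun j => ∑ p ∈ Q, (if p ∣ t i then (1 : ℝ) else 0) * (if p ∣ t j then 1 else 0))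
        (fun j _ => Finset.sum_nonneg (n3 t i j))
        (Finset.mem_erase.2 ⟨Ne.symm hij, Finset.mem_univ j⟩)
      have h3 := Finset.single_le_sum
        (f := fun i => ∑ j ∈ Finset.univ.erase i,
          ∑ p ∈ Q, (if p ∣ t i then (1 : ℝ) else 0) * (if p ∣ t j then 1 else 0))
        (fun i _ => Finset.sum_nonneg fun j _ => Finset.sum_nonneg (n3 t i j))
        (Finset.mem_univ i)
      rw [if_pos hi, if_pos hj] at h1
      linarith [s1 t, s2 t, s4 t]
    · by_contra hgt
      push Not at hgt
      have h1 : 1 < ∑ i, (L - B)⁻¹ * β (t i) := by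
        rw [← Finset.mul_sum, inv_mul_eq_div, one_lt_div hLB]; exact hgt
      linarith [s1 t, s2 t, s3 t]
  calc _ ≤ ∑ t ∈ S with good t, (∏ i, (β (t i) ^ 2 * polyNorm (t i))⁻¹) *
        (Z ^ 2 * (1 - ∑ p, ε p - 2 * η - tupleDefect Q β K (L - B) t)) := by
        rw [Finset.sum_filter]
        refine Finset.sum_le_sum fun t ht => ?_
        split_ifs with hg
        · exact le_rfl
        · refine mul_nonpos_of_nonneg_of_nonpos (Finset.prod_nonneg fun i _ => ?_)
            (mul_nonpos_of_nonneg_of_nonpos (sq_nonneg _) ?_)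
          · exact inv_nonneg.2 (mul_nonneg (sq_nonneg _) (polyNorm_pos _).le)
          · linarith [hbad t ht hg]
    _ ≤ _ := by
        refine Finset.sum_le_sum_of_injOn (fun t => ofTuple t) (fun _ _ => Finset.mem_univ _)
          ?_ ?_ ?_
        · intro t ht t' ht' h
          have h1 := (Finset.mem_filter.1 (Finset.mem_coe.1 ht)).2.1
          have h2 := (Finset.mem_filter.1 (Finset.mem_coe.1 ht')).2.1
          rw [← h1.tupleOf_ofTuple sd.prime, ← h2.tupleOf_ofTuple sd.prime]
          exact congrArg tupleOf h
        · intro t ht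
          rw [Finset.mem_filter] at ht
          obtain ⟨htS, htg, htL⟩ := ht
          obtain ⟨htm, htR⟩ := hSm t htS
          obtain ⟨w, hw0, hw1, hw, hweq⟩ :=
            htg.exists_prod_primeWeight_eq sd.prime htm hK hKQ hε0 hε1
          rw [hweq]
          have hA := le_abs_sum_sieveWeight_mul sd hB htg htm htR htL
          have hI := le_sum_isGoodTuple_update sd htg m
          set I := ∑ r ∈ R with IsGoodTuple Q (Function.update t m r), (β r * polyNorm r)⁻¹
          set G := ∏ i, (β (t i) * polyNorm (t i))⁻¹ with hG
          set b := η + ∑ i, ∑ p ∈ Q, if p ∣ t i then (polyNorm p)⁻¹ else 0 with hb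
          have hG0 : 0 ≤ G := Finset.prod_nonneg fun i _ => sd.inv_nonneg _
          have hI0 : 0 ≤ I := Finset.sum_nonneg fun r _ => sd.inv_nonneg _
          have hb0 : 0 ≤ b := add_nonneg hη0 <| Finset.sum_nonneg fun i _ =>
            Finset.sum_nonneg fun p hp => by
              split_ifs
              exacts [hQi p hp, le_rfl]
          have hI2 : Z ^ 2 * (1 - 2 * b) ≤ I ^ 2 := by
            nlinarith [sq_nonneg (I - Z)]
          have hGI : (G * I) ^ 2 ≤ (∑ D ∈ sieveSupport κ Q R β L, sieveWeight β D *
              ∏ p, primeLin m (ofTuple t p) (D p)) ^ 2 := by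
            rw [← sq_abs (∑ D ∈ _, _)]
            exact pow_le_pow_left₀ (mul_nonneg hG0 hI0) hA 2
          have hNG : (∏ i, polyNorm (t i)) * G ^ 2 = ∏ i, (β (t i) ^ 2 * polyNorm (t i))⁻¹ := by
            rw [hG, ← Finset.prod_pow, ← Finset.prod_mul_distrib]
            refine Finset.prod_congr rfl fun i _ => ?_
            have := (polyNorm_pos (t i)).ne'
            have := (zero_lt_one.trans_le (sd.one_le_beta (t i))).ne'
            field_simp
          have hN0 : 0 ≤ ∏ i, polyNorm (t i) := Finset.prod_nonneg fun i _ => (polyNorm_pos _).le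
          have hdef : (∑ i, ∑ p ∈ Q, if p ∣ t i then 8 * K * (polyNorm p)⁻¹ else 0) +
              2 * (∑ i, ∑ p ∈ Q, if p ∣ t i then (polyNorm p)⁻¹ else 0) ≤
              tupleDefect Q β K (L - B) t := by
            have : (∑ i, ∑ p ∈ Q, if p ∣ t i then 8 * K * (polyNorm p)⁻¹ else 0) +
              2 * (∑ i, ∑ p ∈ Q, if p ∣ t i then (polyNorm p)⁻¹ else 0) =
              ∑ i, ∑ p ∈ Q, (8 * K + 2) * (polyNorm p)⁻¹ * (if p ∣ t i then 1 else 0) := by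
              simp only [Finset.mul_sum, ← Finset.sum_add_distrib]
              refine Finset.sum_congr rfl fun i _ => Finset.sum_congr rfl fun p _ => ?_
              split_ifs <;> ring
            unfold tupleDefect
            linarith [s2 t, s3 t, s4 t]
          have hkey : Z ^ 2 * (1 - ∑ p, ε p - 2 * η - tupleDefect Q β K (L - B) t) ≤
              w * I ^ 2 := by
            rcases hZ0.eq_or_lt with h0 | h0
            · rw [← h0]; have := mul_nonneg hw0 (sq_nonneg I); linarith
            · have h1 := one_sub_le_mul_of_le hw0 hw1 (v := I ^ 2 / Z ^ 2) (by positivity) hb0 hw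
                ((le_div_iff₀ (by positivity)).2 (by linarith))
              have h2 : 1 - ∑ p, ε p - 2 * η - tupleDefect Q β K (L - B) t ≤
                w * (I ^ 2 / Z ^ 2) := by
                rw [hb] at h1; linarith
              calc _ ≤ Z ^ 2 * (w * (I ^ 2 / Z ^ 2)) :=
                    mul_le_mul_of_nonneg_left h2 (sq_nonneg _)
                _ = _ := by field_simp
          rw [← hNG]
          calc _ ≤ ((∏ i, polyNorm (t i)) * G ^ 2) * (w * I ^ 2) :=
                mul_le_mul_of_nonneg_left hkey (mul_nonneg hN0 (sq_nonneg _))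
            _ = ((∏ i, polyNorm (t i)) * w) * (G * I) ^ 2 := by ring
            _ ≤ _ := mul_le_mul_of_nonneg_left hGI (mul_nonneg hN0 hw0)
        · intro E _
          refine mul_nonneg (Finset.prod_nonneg fun p _ => ?_) (sq_nonneg _)
          rcases E p with _ | i
          · simp [primeWeight, hε1]
          · simp only [primeWeight, Option.elim_some]
            split_ifs
            · exact le_rfl
            · linarith [hKQ p.1 p.2]

end SieveLowerMain

section SieveLowerBound

variable {F : Type*} [Field F] [Fintype F] {κ : Type*} [Fintype κ] [DecidableEq κ]
  {Q R : Finset F[X]} {β : F[X] → ℝ}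

omit [Fintype κ] in
open Classical in
theorem SieveData.sum_ite_dvd_le (sd : SieveData Q R β) (m i : κ) {d : F[X]} (hd : d.Monic) :
    ∑ r ∈ (if i = m then {1} else R), (β r ^ 2 * polyNorm r)⁻¹ * (if d ∣ r then 1 else 0) ≤
      (polyNorm d)⁻¹ * ∑ r ∈ (if i = m then {1} else R), (β r ^ 2 * polyNorm r)⁻¹ := by
  refine sum_filter_dvd_le (u := fun r => (β r ^ 2 * polyNorm r)⁻¹)
    (fun r => _root_.inv_nonneg.2 (mul_nonneg (sq_nonneg _) (polyNorm_pos _).le)) ?_ ?_ hd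
    fun r hr => sd.sq_inv_mul_le hd hr
  · split_ifs
    · simp
    · exact sd.monic
  · split_ifs
    · intro r hr h
      rw [Finset.mem_singleton] at h ⊢
      exact hr.eq_one_of_isUnit (IsUnit.of_mul_eq_one d (by rw [mul_comm]; exact h))
    · exact fun r hr h => sd.closed d r hd hr h

omit [Fintype F] in
theorem prod_sum_ite_singleton (m : κ) (φ : F[X] → ℝ) (h1 : φ 1 = 1) :
    ∏ i, ∑ r ∈ (if i = m then {1} else R), φ r = (∑ r ∈ R, φ r) ^ (Fintype.card κ - 1) := by
  rw [← Finset.mul_prod_erase _ _ (Finset.mem_univ m)]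
  rw [Finset.prod_congr rfl (g := fun _ => ∑ r ∈ R, φ r) fun i hi => by
    rw [if_neg (Finset.ne_of_mem_erase hi)]]
  simp [h1, Finset.card_erase_of_mem]

theorem sum_tupleDefect_le (sd : SieveData Q R β) (m : κ) {K M c : ℝ} (hK : 0 ≤ K) (hM : 0 < M)
    (hc : 1 ≤ c)
    (hZ : ∑ r ∈ R, (β r * polyNorm r)⁻¹ ≤ c * ∑ r ∈ R, (β r ^ 2 * polyNorm r)⁻¹) :
    ∑ t ∈ Fintype.piFinset fun i => if i = m then {1} else R,
        (∏ i, (β (t i) ^ 2 * polyNorm (t i))⁻¹) * tupleDefect Q β K M t ≤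
      (Fintype.card κ * (8 * K + 3 + Fintype.card κ) * (∑ p ∈ Q, (polyNorm (p ^ 2))⁻¹) +
        Fintype.card κ * c / M) *
        (∑ r ∈ R, (β r ^ 2 * polyNorm r)⁻¹) ^ (Fintype.card κ - 1) := by
  classical
  set S := Fintype.piFinset fun i => if i = m then {1} else R with hS
  set Φ : (κ → F[X]) → ℝ := fun t => ∏ i, (β (t i) ^ 2 * polyNorm (t i))⁻¹ with hΦ
  set φ : F[X] → ℝ := fun r => (β r ^ 2 * polyNorm r)⁻¹ with hφ
  set η := ∑ p ∈ Q, (polyNorm (p ^ 2))⁻¹ with hη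
  set k : ℝ := (Fintype.card κ : ℝ) with hk
  rw [← prod_sum_ite_singleton (R := R) m φ (by simp [hφ, sd.beta_one])]
  set W := ∏ i, ∑ r ∈ (if i = m then {1} else R), φ r with hW
  have hφ0 : ∀ (_ : κ) r, 0 ≤ φ r := fun _ r =>
    inv_nonneg.2 (mul_nonneg (sq_nonneg _) (polyNorm_pos _).le)
  have hW0 : 0 ≤ W := Finset.prod_nonneg fun i _ => Finset.sum_nonneg fun r _ => hφ0 i r
  have hη0 : 0 ≤ η := Finset.sum_nonneg fun p _ => inv_nonneg.2 (polyNorm_pos _).le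
  have single : ∀ i, ∀ d : F[X], d.Monic →
      ∑ t ∈ S, Φ t * (if d ∣ t i then 1 else 0) ≤ (polyNorm d)⁻¹ * W := fun i d hd =>
    sum_piFinset_prod_mul_single_le (φ := fun _ => φ) (ψ := fun r => if d ∣ r then 1 else 0) hφ0
      (fun r => by split_ifs <;> simp) i (sd.sum_ite_dvd_le m i hd)
  have hpp : ∀ p ∈ Q, (polyNorm (p ^ 2))⁻¹ = (polyNorm p)⁻¹ * (polyNorm p)⁻¹ := fun p hp => by
    have := (sd.prime p hp).1.ne_zero
    rw [sq, polyNorm_mul this this, mul_inv]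
  have b1 : ∑ t ∈ S, Φ t * (∑ i, ∑ p ∈ Q, (8 * K + 2) * (polyNorm p)⁻¹ *
      (if p ∣ t i then 1 else 0)) ≤ k * (8 * K + 2) * η * W := by
    simp only [Finset.mul_sum]
    rw [Finset.sum_comm]
    refine (Finset.sum_le_card_nsmul _ _ ((8 * K + 2) * η * W) fun i _ => ?_).trans (le_of_eq ?_)
    · rw [Finset.sum_comm, hη, Finset.mul_sum, Finset.sum_mul]
      refine Finset.sum_le_sum fun p hp => ?_
      have h1 := single i p (sd.prime p hp).1
      have h2 : 0 ≤ (polyNorm p)⁻¹ := inv_nonneg.2 (polyNorm_pos _).le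
      calc _ = ((8 * K + 2) * (polyNorm p)⁻¹) * ∑ t ∈ S, Φ t * (if p ∣ t i then 1 else 0) := by
            rw [Finset.mul_sum]; exact Finset.sum_congr rfl fun t _ => by ring
        _ ≤ ((8 * K + 2) * (polyNorm p)⁻¹) * ((polyNorm p)⁻¹ * W) :=
            mul_le_mul_of_nonneg_left h1 (by positivity)
        _ = _ := by rw [hpp p hp]; ring
    · rw [nsmul_eq_mul, Finset.card_univ]; ring
  have b2 : ∑ t ∈ S, Φ t * (∑ i, ∑ p ∈ Q, if p ^ 2 ∣ t i then 1 else 0) ≤ k * η * W := by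
    simp only [Finset.mul_sum]
    rw [Finset.sum_comm]
    refine (Finset.sum_le_card_nsmul _ _ (η * W) fun i _ => ?_).trans (le_of_eq ?_)
    · rw [Finset.sum_comm, hη, Finset.sum_mul]
      exact Finset.sum_le_sum fun p hp => single i (p ^ 2) ((sd.prime p hp).1.pow 2)
    · rw [nsmul_eq_mul, Finset.card_univ]; ring
  have b3 : ∑ t ∈ S, Φ t * (∑ i, ∑ j ∈ Finset.univ.erase i, ∑ p ∈ Q,
      (if p ∣ t i then 1 else 0) * (if p ∣ t j then 1 else 0)) ≤ k * k * η * W := by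
    simp only [Finset.mul_sum]
    rw [Finset.sum_comm]
    refine (Finset.sum_le_card_nsmul _ _ (k * η * W) fun i _ => ?_).trans (le_of_eq ?_)
    · rw [Finset.sum_comm]
      refine (Finset.sum_le_card_nsmul _ _ (η * W) fun j hj => ?_).trans ?_
      · rw [Finset.sum_comm, hη, Finset.sum_mul]
        refine Finset.sum_le_sum fun p hp => ?_
        rw [hpp p hp]
        exact sum_piFinset_prod_mul_pair_le (φ := fun _ => φ)
          (ψ := fun r => if p ∣ r then 1 else 0) (χ := fun r => if p ∣ r then 1 else 0) hφ0
          (fun r => by split_ifs <;> simp) (fun r => by split_ifs <;> simp)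
          (Finset.ne_of_mem_erase hj).symm (sd.sum_ite_dvd_le m i (sd.prime p hp).1)
          (sd.sum_ite_dvd_le m j (sd.prime p hp).1)
      · rw [nsmul_eq_mul, mul_assoc]
        refine mul_le_mul_of_nonneg_right ?_ (mul_nonneg hη0 hW0)
        rw [hk]
        exact_mod_cast Finset.card_le_univ _
    · rw [nsmul_eq_mul, Finset.card_univ]; ring
  have b4 : ∑ t ∈ S, Φ t * (∑ i, M⁻¹ * β (t i)) ≤ k * c / M * W := by
    simp only [Finset.mul_sum]
    rw [Finset.sum_comm]
    refine (Finset.sum_le_card_nsmul _ _ (c / M * W) fun i _ => ?_).trans (le_of_eq ?_)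
    · have hβ0 : ∀ r, 0 ≤ β r := fun r => zero_le_one.trans (sd.one_le_beta r)
      have h1 : ∑ t ∈ S, Φ t * β (t i) ≤ c * W := by
        refine sum_piFinset_prod_mul_single_le (φ := fun _ => φ) (ψ := β) hφ0 hβ0 i ?_
        split_ifs
        · simpa [hφ, sd.beta_one] using hc
        · refine le_trans (le_of_eq ?_) hZ
          refine Finset.sum_congr rfl fun r _ => ?_
          have := (polyNorm_pos r).ne'
          have := (zero_lt_one.trans_le (sd.one_le_beta r)).ne'
          simp only [hφ]
          field_simp
      calc _ = M⁻¹ * ∑ t ∈ S, Φ t * β (t i) := by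
            rw [Finset.mul_sum]; exact Finset.sum_congr rfl fun t _ => by ring
        _ ≤ M⁻¹ * (c * W) := mul_le_mul_of_nonneg_left h1 (inv_nonneg.2 hM.le)
        _ = _ := by ring
    · rw [nsmul_eq_mul, Finset.card_univ]; ring
  have : ∑ t ∈ S, Φ t * tupleDefect Q β K M t =
      ∑ t ∈ S, Φ t * (∑ i, ∑ p ∈ Q, (8 * K + 2) * (polyNorm p)⁻¹ *
        (if p ∣ t i then 1 else 0)) +
      ∑ t ∈ S, Φ t * (∑ i, ∑ p ∈ Q, if p ^ 2 ∣ t i then 1 else 0) +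
      ∑ t ∈ S, Φ t * (∑ i, ∑ j ∈ Finset.univ.erase i, ∑ p ∈ Q,
        (if p ∣ t i then 1 else 0) * (if p ∣ t j then 1 else 0)) +
      ∑ t ∈ S, Φ t * (∑ i, M⁻¹ * β (t i)) := by
    rw [← Finset.sum_add_distrib, ← Finset.sum_add_distrib, ← Finset.sum_add_distrib]
    refine Finset.sum_congr rfl fun t _ => ?_
    unfold tupleDefect
    ring
  rw [this]
  linarith

open Classical in
theorem half_mul_le_sum_primeWeight_mul (sd : SieveData Q R β) {L B : ℝ} (hB : ∀ r ∈ R, β r ≤ B)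
    (m : κ) (hKQ : ∀ p ∈ Q, 8 * Fintype.card κ ≤ polyNorm p) {ε : Q → ℝ}
    (hε0 : ∀ p, 0 ≤ ε p) (hε1 : ∀ p, ε p ≤ 1) (hε : ∑ p, ε p ≤ 1 / 8)
    (hη : 14 * (Fintype.card κ : ℝ) ^ 2 * ∑ p ∈ Q, (polyNorm (p ^ 2))⁻¹ ≤ 1 / 8)
    {c : ℝ} (hc : 1 ≤ c)
    (hZ : ∑ r ∈ R, (β r * polyNorm r)⁻¹ ≤ c * ∑ r ∈ R, (β r ^ 2 * polyNorm r)⁻¹)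
    (hLB : 4 * Fintype.card κ * c ≤ L - B) :
    (∑ r ∈ R, (β r * polyNorm r)⁻¹) ^ 2 *
        (∑ r ∈ R, (β r ^ 2 * polyNorm r)⁻¹) ^ (Fintype.card κ - 1) / 2 ≤
      ∑ E : Q → Option κ, (∏ p, primeWeight (polyNorm p.1) (ε p) (Fintype.card κ) m (E p)) *
        (∑ D ∈ sieveSupport κ Q R β L, sieveWeight β D * ∏ p, primeLin m (E p) (D p)) ^ 2 := by
  set k : ℝ := (Fintype.card κ : ℝ) with hk
  have hk1 : 1 ≤ k := by
    rw [hk]; exact_mod_cast Fintype.card_pos_iff.2 ⟨m⟩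
  have hM : 0 < L - B := by nlinarith
  refine le_trans ?_ (sum_le_sum_primeWeight_mul sd hB hM m (by linarith) hKQ hε0 hε1)
  have h1 := sum_tupleDefect_le sd m (K := k) (by linarith) hM hc hZ
  have hW := prod_sum_ite_singleton (R := R) m (fun r => (β r ^ 2 * polyNorm r)⁻¹)
    (by simp [sd.beta_one])
  rw [Finset.prod_univ_sum (fun i => if i = m then {1} else R)
    (fun _ r => (β r ^ 2 * polyNorm r)⁻¹)] at hW
  rw [← hk] at h1
  set W := (∑ r ∈ R, (β r ^ 2 * polyNorm r)⁻¹) ^ (Fintype.card κ - 1) with hWdef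
  set Z := ∑ r ∈ R, (β r * polyNorm r)⁻¹
  set η := ∑ p ∈ Q, (polyNorm (p ^ 2))⁻¹
  set S := Fintype.piFinset fun i => if i = m then {1} else R
  have hη0 : 0 ≤ η := Finset.sum_nonneg fun p _ => inv_nonneg.2 (polyNorm_pos _).le
  have hW0 : 0 ≤ W := pow_nonneg (Finset.sum_nonneg fun r _ =>
    inv_nonneg.2 (mul_nonneg (sq_nonneg _) (polyNorm_pos _).le)) _
  have h2 : k * c / (L - B) ≤ 1 / 4 := by
    rw [div_le_iff₀ hM]; linarith
  have h3 : k * (8 * k + 3 + k) * η + 2 * η ≤ 1 / 8 := by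
    have : k * (8 * k + 3 + k) + 2 ≤ 14 * k ^ 2 := by nlinarith
    nlinarith
  have : ∑ t ∈ S, (∏ i, (β (t i) ^ 2 * polyNorm (t i))⁻¹) * (Z ^ 2 *
      (1 - ∑ p, ε p - 2 * η - tupleDefect Q β k (L - B) t)) =
      Z ^ 2 * (W * (1 - ∑ p, ε p - 2 * η) -
        ∑ t ∈ S, (∏ i, (β (t i) ^ 2 * polyNorm (t i))⁻¹) * tupleDefect Q β k (L - B) t) := by
    rw [← hW, Finset.sum_mul, ← Finset.sum_sub_distrib, Finset.mul_sum S]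
    exact Finset.sum_congr rfl fun t _ => by ring
  rw [this, mul_div_assoc]
  refine mul_le_mul_of_nonneg_left ?_ (sq_nonneg _)
  nlinarith

end SieveLowerBound

section Totient

variable {F : Type*} [Field F]

theorem polyTotient_mul {M N : F[X]} (h : IsCoprime M N) :
    polyTotient (M * N) = polyTotient M * polyTotient N := by
  have h' : IsCoprime (Ideal.span {M}) (Ideal.span {N}) := by
    rwa [Ideal.isCoprime_span_singleton_iff]
  have e := Ideal.quotientMulEquivQuotientProd _ _ h'
  rw [Ideal.span_singleton_mul_span_singleton] at e
  unfold polyTotient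
  rw [Nat.card_congr ((Units.mapEquiv e.toMulEquiv).trans MulEquiv.prodUnits).toEquiv,
    Nat.card_prod]

theorem polyTotient_one : polyTotient (1 : F[X]) = 1 := by
  unfold polyTotient
  rw [Ideal.span_singleton_one]
  exact Nat.card_unique

theorem polyTotient_prod {ι : Type*} [DecidableEq ι] (s : Finset ι) {f : ι → F[X]}
    (h : (s : Set ι).Pairwise fun i j => IsCoprime (f i) (f j)) :
    polyTotient (∏ i ∈ s, f i) = ∏ i ∈ s, polyTotient (f i) := by
  induction s using Finset.induction_on with
  | empty => simpa using polyTotient_one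
  | insert a s ha ih =>
    rw [Finset.prod_insert ha, Finset.prod_insert ha, polyTotient_mul, ih]
    · exact h.mono (by simp)
    · refine IsCoprime.prod_right fun i hi => h (by simp) (by simp [hi]) ?_
      rintro rfl
      exact ha hi

theorem polyTotient_of_irreducible [Fintype F] {p : F[X]} (hp : Irreducible p) :
    (polyTotient p : ℝ) = polyNorm p - 1 := by
  have : NeZero p := ⟨hp.ne_zero⟩
  have : (Ideal.span {p}).IsMaximal := PrincipalIdealRing.isMaximal_of_irreducible hp
  let := Ideal.Quotient.field (Ideal.span {p})
  have h1 : Nat.card (F[X] ⧸ Ideal.span {p}) = Fintype.card F ^ p.natDegree := by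
    have h2 := (AdjoinRoot.powerBasis hp.ne_zero).finrank
    have : Module.Finite F (AdjoinRoot p) := (AdjoinRoot.powerBasis hp.ne_zero).finite
    have h3 := Module.natCard_eq_pow_finrank (K := F) (V := AdjoinRoot p)
    rw [h2, AdjoinRoot.powerBasis_dim, Nat.card_eq_fintype_card (α := F)] at h3
    exact h3
  unfold polyTotient
  rw [Nat.card_units, h1, Nat.cast_sub (Nat.one_le_pow _ _ Fintype.card_pos)]
  simp [polyNorm]

theorem polyTotient_pos [Finite F] {M : F[X]} (hM : M ≠ 0) : 0 < polyTotient M := by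
  have : NeZero M := ⟨hM⟩
  exact Nat.card_pos

open Classical in
theorem card_monics_modEq [Fintype F] {M : F[X]} (hM : M.Monic) (c : F[X]) {n : ℕ}
    (hn : M.natDegree ≤ n) :
    ((monicsOfDegree F n).filter fun f => M ∣ f - c).card = Fintype.card F ^ (n - M.natDegree) := by
  rw [← card_monicsOfDegree]
  have hdeg : ∀ g : F[X], g.Monic → g.natDegree = n - M.natDegree →
      (c %ₘ M).degree < (M * g).degree := fun g hg hgn => by
    refine (degree_modByMonic_lt c hM).trans_le ?_
    rw [mul_comm, hM.degree_mul, add_comm]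
    exact le_add_of_nonneg_right (zero_le_degree_iff.2 hg.ne_zero)
  refine Finset.card_bij' (fun f _ => f /ₘ M) (fun g _ => c %ₘ M + M * g) ?_ ?_ ?_ ?_
  · intro f hf
    rw [Finset.mem_filter, mem_monicsOfDegree] at hf
    obtain ⟨⟨hf, hfn⟩, -⟩ := hf
    rw [mem_monicsOfDegree]
    refine ⟨?_, by rw [natDegree_divByMonic f hM, hfn]⟩
    rw [Monic, leadingCoeff_divByMonic_of_monic hM, hf]
    rw [degree_eq_natDegree hM.ne_zero, degree_eq_natDegree hf.ne_zero, hfn]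
    exact_mod_cast hn
  · intro g hg
    rw [mem_monicsOfDegree] at hg
    have h1 := hdeg g hg.1 hg.2
    rw [Finset.mem_filter, mem_monicsOfDegree]
    refine ⟨⟨(hM.mul hg.1).add_of_right h1, ?_⟩, ?_⟩
    · rw [natDegree_add_eq_right_of_degree_lt h1, hM.natDegree_mul hg.1, hg.2]
      omega
    · have := modByMonic_add_div c M
      exact ⟨g - c /ₘ M, by linear_combination this⟩
  · intro f hf
    rw [Finset.mem_filter] at hf
    have h1 : c %ₘ M = f %ₘ M := by
      have := (modByMonic_eq_zero_iff_dvd hM).2 hf.2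
      rw [sub_modByMonic, sub_eq_zero] at this
      exact this.symm
    rw [h1, modByMonic_add_div]
  · intro g hg
    exact (div_modByMonic_unique g (c %ₘ M) hM ⟨rfl, degree_modByMonic_lt c hM⟩).1

end Totient

section SieveModulus

variable {F : Type*} [Field F] {κ : Type*} {Q : Finset F[X]} {W a : F[X]} {h : κ → F[X]}

structure IsSieveProblem (Q : Finset F[X]) (W a : F[X]) (h : κ → F[X]) : Prop where
  prime : ∀ p ∈ Q, p.Monic ∧ Irreducible p
  monic : W.Monic
  squarefree : Squarefree W
  not_dvd : ∀ p ∈ Q, ¬ p ∣ W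
  not_dvd_sub : ∀ p ∈ Q, ∀ i j, i ≠ j → ¬ p ∣ h i - h j
  coprime : ∀ i, IsCoprime (a + h i) W

noncomputable def sieveModulus (σ : Q → Option κ) : F[X] := ∏ p, (σ p).elim 1 fun _ => p.1

namespace IsSieveProblem

variable (sp : IsSieveProblem Q W a h) (σ : Q → Option κ)
include sp

theorem monic_sieveModulus : (sieveModulus σ).Monic :=
  monic_prod_of_monic _ _ fun p _ => by
    rcases σ p
    exacts [monic_one, (sp.prime p.1 p.2).1]

theorem isCoprime_of_ne {p p' : Q} (hne : p ≠ p') : IsCoprime p.1 p'.1 := by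
  rw [(sp.prime p.1 p.2).2.coprime_iff_not_dvd]
  intro hd
  exact hne <| Subtype.ext <| eq_of_monic_of_associated (sp.prime p.1 p.2).1 (sp.prime p'.1 p'.2).1
    ((sp.prime p.1 p.2).2.associated_of_dvd (sp.prime p'.1 p'.2).2 hd)

theorem pairwise_isCoprime : Pairwise fun p p' : Q =>
    IsCoprime ((σ p).elim 1 fun _ => p.1) ((σ p').elim 1 fun _ => p'.1) := by
  intro p p' hne
  rcases σ p with _ | i
  · exact isCoprime_one_left
  rcases σ p' with _ | j
  · exact isCoprime_one_right
  exact sp.isCoprime_of_ne hne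

theorem isCoprime_elim (p : Q) : IsCoprime ((σ p).elim 1 fun _ => p.1) W := by
  rcases σ p with _ | i
  · exact isCoprime_one_left
  · exact (sp.prime p.1 p.2).2.coprime_iff_not_dvd.2 (sp.not_dvd p.1 p.2)

theorem isCoprime_sieveModulus : IsCoprime W (sieveModulus σ) :=
  IsCoprime.prod_right fun p _ => (sp.isCoprime_elim σ p).symm

theorem squarefree_mul_sieveModulus : Squarefree (W * sieveModulus σ) := by
  rw [squarefree_mul_iff]
  refine ⟨(sp.isCoprime_sieveModulus σ).isRelPrime, sp.squarefree, ?_⟩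
  refine Finset.squarefree_prod_of_pairwise_isCoprime
    (fun p _ p' _ hne => (sp.pairwise_isCoprime σ hne).isRelPrime) fun p _ => ?_
  rcases σ p
  exacts [squarefree_one, (sp.prime p.1 p.2).2.squarefree]

theorem exists_residue : ∃ c : F[X], W ∣ c - a ∧ (∀ p i, σ p = some i → p.1 ∣ c + h i) ∧
    ∀ f, (W ∣ f - a ∧ ∀ p i, σ p = some i → p.1 ∣ f + h i) ↔ W * sieveModulus σ ∣ f - c := by
  obtain ⟨c, hc⟩ := Ideal.exists_forall_sub_mem_ideal (ι := Option Q)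
    (I := fun o => o.elim (Ideal.span {W}) fun p => Ideal.span {(σ p).elim 1 fun _ => p.1})
    (by
      rintro (_ | p) (_ | p') hne
      · exact absurd rfl hne
      · simpa [Function.onFun, Ideal.isCoprime_span_singleton_iff] using
          (sp.isCoprime_elim σ p').symm
      · simpa [Function.onFun, Ideal.isCoprime_span_singleton_iff] using sp.isCoprime_elim σ p
      · simpa [Function.onFun, Ideal.isCoprime_span_singleton_iff] using
          sp.pairwise_isCoprime σ (fun h => hne (by rw [h])))
    fun o => o.elim a fun p => (σ p).elim 0 fun i => -h i
  have h1 : W ∣ c - a := by simpa [Ideal.mem_span_singleton] using hc none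
  have h2 : ∀ p i, σ p = some i → p.1 ∣ c + h i := by
    intro p i hp
    simpa [Ideal.mem_span_singleton, hp] using hc (some p)
  refine ⟨c, h1, h2, fun f => ⟨fun ⟨hf, hfp⟩ => ?_, fun hf => ⟨?_, fun p i hp => ?_⟩⟩⟩
  · refine (sp.isCoprime_sieveModulus σ).mul_dvd ?_ ?_
    · have := dvd_sub hf h1
      rwa [sub_sub_sub_cancel_right] at this
    · refine Finset.prod_dvd_of_coprime (fun p _ p' _ hne => sp.pairwise_isCoprime σ hne)
        fun p _ => ?_
      rcases hp : σ p with _ | i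
      · exact one_dvd _
      · have := dvd_sub (hfp p i hp) (h2 p i hp)
        rwa [add_sub_add_right_eq_sub] at this
  · have := dvd_add ((dvd_mul_right _ _).trans hf) h1
    rwa [sub_add_sub_cancel] at this
  · have h3 : p.1 ∣ sieveModulus σ := by
      have := Finset.dvd_prod_of_mem (fun p : Q => (σ p).elim 1 fun _ => p.1) (Finset.mem_univ p)
      simp only [hp, Option.elim_some] at this
      exact this
    have := dvd_add ((h3.trans (dvd_mul_left _ _)).trans hf) (h2 p i hp)
    rwa [show f - c + (c + h i) = f + h i by ring] at this

open Classical in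
theorem sum_prod_elim_eq_card (S : Finset F[X]) :
    ∃ c : F[X], W ∣ c - a ∧ (∀ p i, σ p = some i → p.1 ∣ c + h i) ∧
      ∑ f ∈ S with W ∣ f - a, ∏ p, (σ p).elim 1 (fun i => if p.1 ∣ f + h i then (1 : ℝ) else 0) =
        (S.filter fun f => W * sieveModulus σ ∣ f - c).card := by
  obtain ⟨c, h1, h2, h3⟩ := sp.exists_residue σ
  refine ⟨c, h1, h2, ?_⟩
  rw [Finset.card_eq_sum_ones, Nat.cast_sum, Finset.sum_filter, Finset.sum_filter]
  refine Finset.sum_congr rfl fun f _ => ?_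
  rw [← h3 f]
  by_cases hf : W ∣ f - a
  · by_cases hf' : ∀ p i, σ p = some i → p.1 ∣ f + h i
    · rw [if_pos hf, if_pos ⟨hf, hf'⟩, Finset.prod_eq_one, Nat.cast_one]
      intro p _
      rcases hp : σ p with _ | i
      · rfl
      · exact if_pos (hf' p i hp)
    · rw [if_pos hf, if_neg fun h => hf' h.2]
      push Not at hf'
      obtain ⟨p, i, hp, hd⟩ := hf'
      exact Finset.prod_eq_zero (Finset.mem_univ p) (by simp [hp, hd])
  · rw [if_neg hf, if_neg fun h => hf h.1]

theorem polyNorm_sieveModulus [Fintype F] :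
    polyNorm (sieveModulus σ) = ∏ p, (σ p).elim 1 fun _ => polyNorm p.1 := by
  rw [sieveModulus, polyNorm_prod]
  · refine Finset.prod_congr rfl fun p _ => ?_
    rcases σ p <;> simp
  · intro p _
    rcases σ p
    exacts [monic_one, (sp.prime p.1 p.2).1]

theorem polyTotient_sieveModulus [Fintype F] :
    (polyTotient (sieveModulus σ) : ℝ) = ∏ p, (σ p).elim 1 fun _ => (polyNorm p.1 - 1) := by
  classical
  rw [sieveModulus, polyTotient_prod _ fun p _ p' _ hne => sp.pairwise_isCoprime σ hne,
    Nat.cast_prod]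
  refine Finset.prod_congr rfl fun p _ => ?_
  rcases σ p
  · simp [polyTotient_one]
  · exact polyTotient_of_irreducible (sp.prime p.1 p.2).2

theorem natDegree_sieveModulus_le [Fintype κ] [DecidableEq κ] {D D' : Q → Option κ}
    (hσ : ∀ p, D p = none → D' p = none → σ p = none) :
    (sieveModulus σ).natDegree ≤ ∑ i, (tupleOf D i).natDegree + ∑ i, (tupleOf D' i).natDegree := by
  have h1 : sieveModulus σ ∣ (∏ i, tupleOf D i) * ∏ i, tupleOf D' i := by
    refine Finset.prod_dvd_of_coprime (fun p _ p' _ hne => sp.pairwise_isCoprime σ hne)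
      fun p _ => ?_
    rcases hp : σ p with _ | i
    · exact one_dvd _
    · rcases hD : D p with _ | j
      · rcases hD' : D' p with _ | j
        · rw [hσ p hD hD'] at hp; cases hp
        · exact (((dvd_tupleOf_iff sp.prime D' j p).2 hD').trans
            (Finset.dvd_prod_of_mem _ (Finset.mem_univ j))).trans (dvd_mul_left _ _)
      · exact (((dvd_tupleOf_iff sp.prime D j p).2 hD).trans
            (Finset.dvd_prod_of_mem _ (Finset.mem_univ j))).trans (dvd_mul_right _ _)
  have m1 : ∀ D : Q → Option κ, (∏ i, tupleOf D i).Monic := fun D =>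
    monic_prod_of_monic _ _ fun i _ => tupleOf_monic sp.prime D i
  have h2 := natDegree_le_of_dvd h1 ((m1 D).mul (m1 D')).ne_zero
  rwa [(m1 D).natDegree_mul (m1 D'), natDegree_prod_of_monic _ _ fun i _ =>
    tupleOf_monic sp.prime D i, natDegree_prod_of_monic _ _ fun i _ =>
    tupleOf_monic sp.prime D' i] at h2

end IsSieveProblem

end SieveModulus

section SieveSums

variable {F : Type*} [Field F] [Fintype F] {κ : Type*} {Q : Finset F[X]} {W a : F[X]}
  {h : κ → F[X]}

open Classical in
noncomputable def sieveSum (h : κ → F[X]) (T : Finset (Q → Option κ)) (w : (Q → Option κ) → ℝ)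
    (f : F[X]) : ℝ :=
  ∑ D ∈ T, w D * ∏ p : Q,
    sieveAtom (polyNorm p.1) (fun i => if p.1 ∣ f + h i then (1 : ℝ) else 0) (D p)

variable [DecidableEq κ]

omit [Fintype F] in
open Classical in
theorem IsSieveProblem.indicator_mul (sp : IsSieveProblem Q W a h) (f : F[X]) (p : Q) (i j : κ) :
    (if p.1 ∣ f + h i then (1 : ℝ) else 0) * (if p.1 ∣ f + h j then (1 : ℝ) else 0) =
      if i = j then (if p.1 ∣ f + h i then (1 : ℝ) else 0) else 0 := by
  by_cases hij : i = j
  · subst hij; simp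
  · rw [if_neg hij]
    by_cases hi : p.1 ∣ f + h i
    · by_cases hj : p.1 ∣ f + h j
      · have := dvd_sub hi hj
        rw [add_sub_add_left_eq_sub] at this
        exact absurd this (sp.not_dvd_sub p.1 p.2 i j hij)
      · simp [hj]
    · simp [hi]

variable [Fintype κ]

theorem IsSieveProblem.prod_sieveSize_le (sp : IsSieveProblem Q W a h)
    (hQ2 : ∀ p ∈ Q, 2 ≤ polyNorm p)
    {n₀ : ℕ} {D : Q → Option κ} (hD : ∑ i, (tupleOf D i).natDegree ≤ n₀) :
    ∏ p : Q, sieveSize (polyNorm p.1) (D p) ≤ (Fintype.card F : ℝ) ^ (2 * n₀) := by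
  have h1 : ∏ p : Q, sieveSize (polyNorm p.1) (D p) ≤
      ∏ p : Q, sieveNorm (polyNorm p.1) (D p) ^ 2 := by
    refine Finset.prod_le_prod (fun p _ => ?_) fun p _ => ?_ <;> rcases D p with _ | i <;>
      simp only [sieveSize, sieveNorm, Option.elim_none, Option.elim_some]
    · exact zero_le_one
    · linarith [polyNorm_pos p.1]
    · simp
    · nlinarith [hQ2 p.1 p.2]
  refine h1.trans ?_
  rw [Finset.prod_pow, prod_sieveNorm_eq sp.prime]
  simp only [polyNorm]
  rw [Finset.prod_pow_eq_pow_sum, ← pow_mul]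
  refine pow_le_pow_right₀ ?_ (by omega)
  exact_mod_cast Fintype.card_pos

open Classical in
theorem IsSieveProblem.sum_sieveSum_sq_le (sp : IsSieveProblem Q W a h)
    (hκ : ∀ p ∈ Q, Fintype.card κ ≤ polyNorm p) {T : Finset (Q → Option κ)}
    (w : (Q → Option κ) → ℝ) {n₀ n : ℕ} (hT : ∀ D ∈ T, ∑ i, (tupleOf D i).natDegree ≤ n₀)
    (hn : W.natDegree + 2 * n₀ ≤ n) :
    ∑ f ∈ monicsOfDegree F n with W ∣ f - a, sieveSum h T w f ^ 2 ≤
      (Fintype.card F : ℝ) ^ n / polyNorm W *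
        ∑ D ∈ T, w D ^ 2 * ∏ p : Q, sieveNorm (polyNorm p.1) (D p) := by
  have hq : (0 : ℝ) < Fintype.card F := Nat.cast_pos.2 Fintype.card_pos
  have key := abs_sieve_sum_sub_le ((monicsOfDegree F n).filter fun f => W ∣ f - a)
    (I := fun (p : Q) i f => if p.1 ∣ f + h i then (1 : ℝ) else 0)
    (fun f _ p i j => sp.indicator_mul f p i j) (P := fun p => polyNorm p.1)
    (fun p => (polyNorm_pos _).le) (fun p _ => 1 / polyNorm p.1) T w
    (X := (Fintype.card F : ℝ) ^ n / polyNorm W) (err := 0) le_rfl ?_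
    (fun D hD => Finset.single_le_sum (f := fun D : Q → Option κ =>
      ∏ p : Q, sieveSize (polyNorm p.1) (D p)) (fun D _ => Finset.prod_nonneg fun p _ => ?_) hD)
  · have h2 := sieve_main_le (κ := κ) (ι := Q) (P := fun p => polyNorm p.1)
      (fun p => hκ p.1 p.2) (fun p => polyNorm_pos _) T w
    rw [zero_mul] at key
    have h3 := abs_nonpos_iff.1 key
    rw [sub_eq_zero] at h3
    refine (le_of_eq ?_).trans ((le_of_eq h3).trans (mul_le_mul_of_nonneg_left h2
      (div_nonneg (pow_nonneg hq.le _) (polyNorm_pos _).le)))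
    rfl
  · intro D hD D' hD' σ hσ
    obtain ⟨c, -, -, hc⟩ := sp.sum_prod_elim_eq_card σ (monicsOfDegree F n)
    have hM := sp.monic.mul (sp.monic_sieveModulus σ)
    have hdeg : (W * sieveModulus σ).natDegree ≤ n := by
      rw [sp.monic.natDegree_mul (sp.monic_sieveModulus σ)]
      have := sp.natDegree_sieveModulus_le σ hσ
      have := hT D hD
      have := hT D' hD'
      omega
    rw [hc, card_monics_modEq hM c hdeg]
    refine le_of_eq (abs_eq_zero.2 (sub_eq_zero.2 ?_))
    have h1 : ∏ p : Q, (σ p).elim 1 (fun _ => 1 / polyNorm p.1) =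
        (polyNorm (sieveModulus σ))⁻¹ := by
      rw [sp.polyNorm_sieveModulus, ← Finset.prod_inv_distrib]
      refine Finset.prod_congr rfl fun p _ => ?_
      rcases σ p <;> simp
    rw [h1, div_mul_eq_mul_div, ← div_eq_mul_inv, div_div, mul_comm (polyNorm _),
      ← polyNorm_mul sp.monic.ne_zero (sp.monic_sieveModulus σ).ne_zero]
    rw [polyNorm, Nat.cast_pow, pow_sub₀ _ hq.ne' hdeg, div_eq_mul_inv]
  · have := polyNorm_pos p.1
    rcases D p <;> simp only [sieveSize, Option.elim_none, Option.elim_some] <;> positivity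

open Classical in
theorem IsSieveProblem.le_sum_sieveSum_sq_prime (sp : IsSieveProblem Q W a h)
    {T : Finset (Q → Option κ)} (w : (Q → Option κ) → ℝ) {n₀ e : ℕ}
    (hT : ∀ D ∈ T, ∑ i, (tupleOf D i).natDegree ≤ n₀) (he : 1 ≤ e)
    (hQ4 : ∀ p ∈ Q, 4 ≤ polyNorm p) (hκ : ∀ p ∈ Q, 8 * Fintype.card κ ≤ polyNorm p)
    {ε : Q → ℝ} (hε : ∀ p, 1 ≤ ε p * (2 * polyNorm p.1 ^ 2)) (hε1 : ∀ p, ε p ≤ 1)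
    (hQn : ∀ p ∈ Q, p.natDegree < 2 * e) (m : κ) (hm : (h m).natDegree < 2 * e) :
    (Fintype.card F : ℝ) ^ (2 * e) / (2 * e * polyTotient W) *
        (∑ E : Q → Option κ, (∏ p, primeWeight (polyNorm p.1) (ε p) (Fintype.card κ) m (E p)) *
          (∑ D ∈ T, w D * ∏ p, primeLin m (E p) (D p)) ^ 2) -
        (W.natDegree + 2 * n₀ + 2 * e) * (Fintype.card F : ℝ) ^ e *
          ((Fintype.card F : ℝ) ^ (2 * n₀) * ∑ D ∈ T, |w D|) ^ 2 ≤
      ∑ f ∈ monicsOfDegree F (2 * e) with W ∣ f - a ∧ Irreducible (f + h m),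
        sieveSum h T w f ^ 2 := by
  have hq : (0 : ℝ) < Fintype.card F := Nat.cast_pos.2 Fintype.card_pos
  have he0 : (0 : ℝ) < 2 * e := by positivity
  have he1 : (1 : ℝ) ≤ 2 * e := by
    have : (1 : ℝ) ≤ e := by exact_mod_cast he
    linarith
  set S := (monicsOfDegree F (2 * e)).filter fun f => Irreducible (f + h m) with hS
  have hSW : (monicsOfDegree F (2 * e)).filter (fun f => W ∣ f - a ∧ Irreducible (f + h m)) =
      S.filter fun f => W ∣ f - a := by
    rw [hS, Finset.filter_filter]
    exact Finset.filter_congr fun f _ => and_comm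
  have hshift : ∀ f : F[X], f.Monic → f.natDegree = 2 * e →
      (f + h m).Monic ∧ (f + h m).natDegree = 2 * e := fun f hf hfn => by
    rw [← hfn] at hm
    have := degree_lt_degree hm
    exact ⟨hf.add_of_left this, by rw [natDegree_add_eq_left_of_natDegree_lt hm, hfn]⟩
  have hshift' : ∀ f : F[X], f.Monic → f.natDegree = 2 * e →
      (f - h m).Monic ∧ (f - h m).natDegree = 2 * e := fun f hf hfn => by
    rw [← hfn] at hm
    have := degree_lt_degree hm
    exact ⟨hf.sub_of_left this, by rw [natDegree_sub_eq_left_of_natDegree_lt hm, hfn]⟩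
  have hcard : ∀ (M c : F[X]), (S.filter fun f => M ∣ f - c).card =
      ((primesOfDegree F (2 * e)).filter fun p => M ∣ p - (c + h m)).card := fun M c => by
    refine Finset.card_bij' (fun f _ => f + h m) (fun f _ => f - h m) ?_ ?_
      (fun f _ => add_sub_cancel_right _ _) (fun f _ => sub_add_cancel _ _)
    · intro f hf
      rw [Finset.mem_filter, hS, Finset.mem_filter, mem_monicsOfDegree] at hf
      obtain ⟨⟨⟨h1, h2⟩, h3⟩, h4⟩ := hf
      rw [Finset.mem_filter, mem_primesOfDegree, add_sub_add_right_eq_sub]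
      exact ⟨⟨(hshift f h1 h2).1, (hshift f h1 h2).2, h3⟩, h4⟩
    · intro f hf
      rw [Finset.mem_filter, mem_primesOfDegree] at hf
      obtain ⟨⟨h1, h2, h3⟩, h4⟩ := hf
      rw [Finset.mem_filter, hS, Finset.mem_filter, mem_monicsOfDegree, sub_add_cancel]
      exact ⟨⟨hshift' f h1 h2, h3⟩, by rwa [sub_sub, add_comm (h m)]⟩
  set err : ℝ := (W.natDegree + 2 * n₀ + 2 * e) * (Fintype.card F : ℝ) ^ e with herr
  set X : ℝ := (Fintype.card F : ℝ) ^ (2 * e) / (2 * e * polyTotient W) with hX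
  have herr0 : 0 ≤ err := by positivity
  have key := abs_sieve_sum_sub_le (S.filter fun f => W ∣ f - a)
    (I := fun (p : Q) i f => if p.1 ∣ f + h i then (1 : ℝ) else 0)
    (fun f _ p i j => sp.indicator_mul f p i j) (P := fun p => polyNorm p.1)
    (fun p => (polyNorm_pos _).le) (fun p i => if i = m then 0 else 1 / (polyNorm p.1 - 1)) T w
    (X := X) herr0 ?_
    (fun D hD => sp.prod_sieveSize_le (fun p hp => by linarith [hQ4 p hp]) (hT D hD))
  · have h2 := le_sieve_main_prime (κ := κ) (ι := Q) (P := fun p => polyNorm p.1) (ε := ε)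
      (K := Fintype.card κ) (fun p => hQ4 p.1 p.2) le_rfl (fun p => hκ p.1 p.2) hε hε1 m T w
    have h3 := mul_le_mul_of_nonneg_left h2 (show 0 ≤ X by positivity)
    have h4 := (abs_le.1 key).1
    rw [hSW]
    unfold sieveSum
    linarith
  · intro D hD D' hD' σ hσ
    by_cases hσm : ∃ p, σ p = some m
    · obtain ⟨p, hp⟩ := hσm
      rw [Finset.prod_eq_zero (Finset.mem_univ p) (by simp [hp]), Finset.sum_eq_zero]
      · simpa using herr0
      · intro f hf
        refine Finset.prod_eq_zero (Finset.mem_univ p) ?_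
        rw [Finset.mem_filter, hS, Finset.mem_filter, mem_monicsOfDegree] at hf
        obtain ⟨⟨⟨h1, h2⟩, h3⟩, -⟩ := hf
        simp only [hp, Option.elim_some]
        refine if_neg fun hd => ?_
        have h4 := eq_of_monic_of_associated (sp.prime p.1 p.2).1 (hshift f h1 h2).1
          ((sp.prime p.1 p.2).2.associated_of_dvd h3 hd)
        have h5 := hQn p.1 p.2
        rw [h4, (hshift f h1 h2).2] at h5
        exact lt_irrefl _ h5
    · push Not at hσm
      obtain ⟨c, hcW, hcp, hc⟩ := sp.sum_prod_elim_eq_card σ S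
      rw [hc, hcard]
      have hco : IsCoprime (c + h m) (W * sieveModulus σ) := by
        refine IsCoprime.mul_right ?_ (IsCoprime.prod_right fun p _ => ?_)
        · obtain ⟨d, hd⟩ := hcW
          have := (sp.coprime m).add_mul_left_left d
          rwa [← hd, show a + h m + (c - a) = c + h m by ring] at this
        · rcases hp : σ p with _ | i
          · exact isCoprime_one_right
          · refine ((sp.prime p.1 p.2).2.coprime_iff_not_dvd.2 fun hd => ?_).symm
            have h1 := dvd_sub (hcp p i hp) hd
            rw [add_sub_add_left_eq_sub] at h1
            exact sp.not_dvd_sub p.1 p.2 i m (fun him => hσm p (him ▸ hp)) h1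
      have h1 := card_primes_modEq_sub_le (sp.monic.mul (sp.monic_sieveModulus σ))
        (sp.squarefree_mul_sieveModulus σ) hco he
      have hν : ∏ p : Q, (σ p).elim 1 (fun i => if i = m then 0 else 1 / (polyNorm p.1 - 1)) =
          (polyTotient (sieveModulus σ) : ℝ)⁻¹ := by
        rw [sp.polyTotient_sieveModulus, ← Finset.prod_inv_distrib]
        refine Finset.prod_congr rfl fun p _ => ?_
        rcases hp : σ p with _ | i
        · simp
        · have : i ≠ m := fun him => hσm p (him ▸ hp)
          simp [this]
      rw [polyTotient_mul (sp.isCoprime_sieveModulus σ), Nat.cast_mul] at h1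
      rw [hν, hX]
      set N : ℝ := (((primesOfDegree F (2 * e)).filter fun p =>
        W * sieveModulus σ ∣ p - (c + h m)).card : ℝ)
      have hdeg : ((W * sieveModulus σ).natDegree : ℝ) ≤ W.natDegree + 2 * n₀ := by
        rw [sp.monic.natDegree_mul (sp.monic_sieveModulus σ)]
        have := sp.natDegree_sieveModulus_le σ hσ
        have := hT D hD
        have := hT D' hD'
        exact_mod_cast (by omega : W.natDegree + (sieveModulus σ).natDegree ≤ W.natDegree + 2 * n₀)
      have h2 : |N - (Fintype.card F : ℝ) ^ (2 * e) / (2 * e * polyTotient W) *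
          (polyTotient (sieveModulus σ) : ℝ)⁻¹| ≤
          |2 * e * N - (Fintype.card F : ℝ) ^ (2 * e) /
            (polyTotient W * polyTotient (sieveModulus σ))| := by
        have h3 : 2 * e * N - (Fintype.card F : ℝ) ^ (2 * e) /
            (polyTotient W * polyTotient (sieveModulus σ)) = 2 * e *
            (N - (Fintype.card F : ℝ) ^ (2 * e) / (2 * e * polyTotient W) *
          (polyTotient (sieveModulus σ) : ℝ)⁻¹) := by
          have := polyTotient_pos sp.monic.ne_zero
          have := polyTotient_pos (sp.monic_sieveModulus σ).ne_zero
          field_simp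
        rw [h3, abs_mul, abs_of_pos he0]
        exact le_mul_of_one_le_left (abs_nonneg _) he1
      refine h2.trans (h1.trans ?_)
      rw [herr]
      gcongr

end SieveSums

section Pigeonhole

variable {F : Type*} [Field F] [Fintype F] {κ : Type*} [Fintype κ] [DecidableEq κ]
  {Q R : Finset F[X]} {W a : F[X]} {h : κ → F[X]} {β : F[X] → ℝ}

open Classical in
theorem exists_le_card_filter_of_sum_lt {Ω κ : Type*} [Fintype κ] {S : Finset Ω} {P : Ω → κ → Prop}
    {A : Ω → ℝ} (hA : ∀ f ∈ S, 0 ≤ A f) {M : ℕ}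
    (hM : ((M : ℝ) - 1) * ∑ f ∈ S, A f < ∑ i, ∑ f ∈ S with P f i, A f) :
    ∃ f ∈ S, M ≤ (Finset.univ.filter fun i => P f i).card := by
  by_contra! hlt
  refine absurd hM (not_lt.2 ?_)
  simp only [Finset.sum_filter]
  rw [Finset.sum_comm, Finset.mul_sum]
  refine Finset.sum_le_sum fun f hf => ?_
  rw [← Finset.sum_filter, Finset.sum_const, nsmul_eq_mul]
  refine mul_le_mul_of_nonneg_right ?_ (hA f hf)
  have : ((Finset.univ.filter fun i => P f i).card : ℝ) + 1 ≤ M := by exact_mod_cast hlt f hf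
  linarith

open Classical in
theorem exists_many_irreducible (sp : IsSieveProblem Q W a h) (sd : SieveData Q R β)
    {L H n₀ e M : ℕ} {B c : ℝ} {ε : Q → ℝ}
    (hM : 1 ≤ M) (hk0 : 0 < Fintype.card κ) (hQ4 : ∀ p ∈ Q, 4 ≤ polyNorm p)
    (hκ : ∀ p ∈ Q, 8 * Fintype.card κ ≤ polyNorm p) (hQn : ∀ p ∈ Q, p.natDegree < 2 * e)
    (hhn : ∀ i, (h i).natDegree < 2 * e) (hε0 : ∀ p, 0 ≤ ε p) (hε1 : ∀ p, ε p ≤ 1)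
    (hεP : ∀ p, 1 ≤ ε p * (2 * polyNorm p.1 ^ 2)) (hε : ∑ p, ε p ≤ 1 / 8)
    (hη : 14 * (Fintype.card κ : ℝ) ^ 2 * ∑ p ∈ Q, (polyNorm (p ^ 2))⁻¹ ≤ 1 / 8)
    (hB : ∀ r ∈ R, β r ≤ B) (hβ : ∀ r ∈ R, (r.natDegree : ℝ) ≤ H * β r) (hLH : L * H ≤ n₀)
    (hn : W.natDegree + 2 * n₀ ≤ 2 * e) (he : 1 ≤ e) (hc : 1 ≤ c)
    (hLB : 4 * Fintype.card κ * c ≤ L - B)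
    (hZ : ∑ r ∈ R, (β r * polyNorm r)⁻¹ ≤ c * ∑ r ∈ R, (β r ^ 2 * polyNorm r)⁻¹)
    (hmain : 2 * M * (2 * e * polyTotient W) * ∑ r ∈ R, (β r ^ 2 * polyNorm r)⁻¹ ≤
      Fintype.card κ * (∑ r ∈ R, (β r * polyNorm r)⁻¹) ^ 2 * polyNorm W)
    (herr : Fintype.card κ * ((W.natDegree + 2 * n₀ + 2 * e) * (Fintype.card F : ℝ) ^ e *
      ((Fintype.card F : ℝ) ^ (2 * n₀) *
        (∑ r ∈ R, (β r * polyNorm r)⁻¹) ^ Fintype.card κ) ^ 2) * polyNorm W <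
      (Fintype.card F : ℝ) ^ (2 * e)) :
    ∃ f ∈ monicsOfDegree F (2 * e),
      M ≤ (Finset.univ.filter fun i => Irreducible (f + h i)).card := by
  set T := sieveSupport κ Q R β L with hT
  have hTn : ∀ D ∈ T, ∑ i, (tupleOf D i).natDegree ≤ n₀ :=
    fun D hD => sum_natDegree_tupleOf_le hβ hLH D hD
  set k := Fintype.card κ with hk
  set q := (Fintype.card F : ℝ) with hq
  set V := ∑ r ∈ R, (β r ^ 2 * polyNorm r)⁻¹ with hV
  set Z := ∑ r ∈ R, (β r * polyNorm r)⁻¹ with hZdef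
  have hq0 : 0 < q := Nat.cast_pos.2 Fintype.card_pos
  have hW0 := polyNorm_pos W
  have hφ0 : (0 : ℝ) < polyTotient W := Nat.cast_pos.2 (polyTotient_pos sp.monic.ne_zero)
  have he0 : (0 : ℝ) < 2 * e := by positivity
  have hV1 : 1 ≤ V := by
    have := Finset.single_le_sum (f := fun r => (β r ^ 2 * polyNorm r)⁻¹)
      (fun r _ => inv_nonneg.2 (mul_nonneg (sq_nonneg _) (polyNorm_pos _).le)) sd.one_mem
    rwa [sd.beta_one, polyNorm_one, one_pow, mul_one, inv_one] at this
  set E := (W.natDegree + 2 * n₀ + 2 * e) * q ^ e * (q ^ (2 * n₀) * Z ^ k) ^ 2 with hE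
  set S := (monicsOfDegree F (2 * e)).filter fun f => W ∣ f - a with hS
  have h1 : ∑ f ∈ S, sieveSum h T (sieveWeight β) f ^ 2 ≤ q ^ (2 * e) / polyNorm W * V ^ k :=
    (sp.sum_sieveSum_sq_le (fun p hp => by
      have := hκ p hp
      have : (0 : ℝ) ≤ k := Nat.cast_nonneg _
      linarith) _ hTn hn).trans
      (mul_le_mul_of_nonneg_left (sum_sieveWeight_sq_mul_le sd _) (by positivity))
  have h2 : ∀ m, q ^ (2 * e) / (2 * e * polyTotient W) * (Z ^ 2 * V ^ (k - 1) / 2) - E ≤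
      ∑ f ∈ S with Irreducible (f + h m), sieveSum h T (sieveWeight β) f ^ 2 := by
    intro m
    have h3 := sp.le_sum_sieveSum_sq_prime (sieveWeight β) hTn he hQ4 hκ hεP hε1 hQn m (hhn m)
    rw [← Finset.filter_filter] at h3
    refine le_trans (sub_le_sub (mul_le_mul_of_nonneg_left
      (half_mul_le_sum_primeWeight_mul sd hB m hκ
      hε0 hε1 hε hη hc hZ hLB) (by positivity)) ?_) h3
    rw [hE]
    have := sum_abs_sieveWeight_le (κ := κ) sd (L : ℝ)
    gcongr
  have hlt : ((M : ℝ) - 1) * ∑ f ∈ S, sieveSum h T (sieveWeight β) f ^ 2 <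
      ∑ i, ∑ f ∈ S with Irreducible (f + h i), sieveSum h T (sieveWeight β) f ^ 2 := by
    have h3 : k * (q ^ (2 * e) / (2 * e * polyTotient W) * (Z ^ 2 * V ^ (k - 1) / 2) - E) ≤
        ∑ i, ∑ f ∈ S with Irreducible (f + h i), sieveSum h T (sieveWeight β) f ^ 2 := by
      have := Finset.card_nsmul_le_sum Finset.univ _ _ fun m _ => h2 m
      rwa [nsmul_eq_mul, Finset.card_univ] at this
    have h4 : M * (q ^ (2 * e) / polyNorm W * V ^ k) ≤
        k * (q ^ (2 * e) / (2 * e * polyTotient W) * (Z ^ 2 * V ^ (k - 1) / 2)) := by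
      have h5 : V ^ k = V * V ^ (k - 1) := by rw [← pow_succ', Nat.sub_add_cancel hk0]
      have h6 : M * (q ^ (2 * e) / polyNorm W * V ^ k) =
          (2 * M * (2 * e * polyTotient W) * V) *
            (q ^ (2 * e) * V ^ (k - 1) / (2 * (2 * e * polyTotient W) * polyNorm W)) := by
        rw [h5]; field_simp
      have h7 : k * (q ^ (2 * e) / (2 * e * polyTotient W) * (Z ^ 2 * V ^ (k - 1) / 2)) =
          (k * Z ^ 2 * polyNorm W) *
            (q ^ (2 * e) * V ^ (k - 1) / (2 * (2 * e * polyTotient W) * polyNorm W)) := by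
        field_simp
      rw [h6, h7]
      exact mul_le_mul_of_nonneg_right hmain (by positivity)
    have h8 : k * E < q ^ (2 * e) / polyNorm W * V ^ k := by
      have : k * E < q ^ (2 * e) / polyNorm W := (lt_div_iff₀ hW0).2 herr
      exact this.trans_le (le_mul_of_one_le_right (by positivity) (one_le_pow₀ hV1))
    have hM1 : (0 : ℝ) ≤ M - 1 := sub_nonneg.2 (by exact_mod_cast hM)
    calc ((M : ℝ) - 1) * ∑ f ∈ S, sieveSum h T (sieveWeight β) f ^ 2 ≤
          (M - 1) * (q ^ (2 * e) / polyNorm W * V ^ k) := mul_le_mul_of_nonneg_left h1 hM1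
      _ < _ := by linarith
  obtain ⟨f, hf, hfM⟩ := exists_le_card_filter_of_sum_lt (S := S)
    (P := fun f i => Irreducible (f + h i)) (A := fun f => sieveSum h T (sieveWeight β) f ^ 2)
    (fun f _ => sq_nonneg _) hlt
  exact ⟨f, (Finset.mem_filter.1 hf).1, hfM⟩

end Pigeonhole

section SmallPrimes

variable (F : Type*) [Field F] [Fintype F]

open Classical in
noncomputable def primesBetween (u v : ℕ) : Finset F[X] :=
  (Finset.Ico u v).biUnion (primesOfDegree F)

variable {F}

theorem mem_primesBetween {u v : ℕ} {p : F[X]} : p ∈ primesBetween F u v ↔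
    (p.Monic ∧ Irreducible p) ∧ u ≤ p.natDegree ∧ p.natDegree < v := by
  simp only [primesBetween, Finset.mem_biUnion, Finset.mem_Ico, mem_primesOfDegree]
  constructor
  · rintro ⟨d, hd, h1, rfl, h2⟩
    exact ⟨⟨h1, h2⟩, hd⟩
  · rintro ⟨⟨h1, h2⟩, hd⟩
    exact ⟨_, hd, h1, rfl, h2⟩

theorem sum_primesBetween (u v : ℕ) (g : F[X] → ℝ) :
    ∑ p ∈ primesBetween F u v, g p = ∑ d ∈ Finset.Ico u v, ∑ p ∈ primesOfDegree F d, g p := by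
  classical
  rw [primesBetween, Finset.sum_biUnion]
  intro d _ d' _ hne
  refine Finset.disjoint_left.2 fun p hp hp' => hne ?_
  rw [← (mem_primesOfDegree.1 hp).2.1, (mem_primesOfDegree.1 hp').2.1]

theorem sum_Ico_inv_mul_pred_le {w : ℕ} (hw : 1 ≤ w) (v : ℕ) :
    ∑ d ∈ Finset.Ico (w + 1) v, ((d : ℝ) * (d - 1))⁻¹ ≤ (w : ℝ)⁻¹ := by
  have hw0 : (0 : ℝ) < w := by exact_mod_cast hw
  rcases le_total v (w + 1) with h | h
  · rw [Finset.Ico_eq_empty_of_le h]; simp [hw0.le]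
  have key : ∑ d ∈ Finset.Ico (w + 1) v, ((d : ℝ) * (d - 1))⁻¹ = (w : ℝ)⁻¹ - ((v : ℝ) - 1)⁻¹ := by
    induction v, h using Nat.le_induction with
    | base => simp
    | succ v hv ih =>
      rw [Finset.sum_Ico_succ_top hv, ih]
      have h1 : (w : ℝ) + 1 ≤ v := by exact_mod_cast hv
      have h2 : (v : ℝ) - 1 ≠ 0 := by linarith
      have h3 : (v : ℝ) ≠ 0 := by linarith
      push_cast
      rw [add_sub_cancel_right]
      field_simp
      ring
  rw [key]
  have h1 : (w : ℝ) + 1 ≤ v := by exact_mod_cast h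
  have : (0 : ℝ) ≤ ((v : ℝ) - 1)⁻¹ := inv_nonneg.2 (by linarith)
  linarith

theorem sum_primesBetween_le {w : ℕ} (hw : 1 ≤ w) (v : ℕ) {g : F[X] → ℝ}
    (hg : ∀ p ∈ primesBetween F (w + 1) v, g p ≤ (polyNorm p * (p.natDegree - 1))⁻¹) :
    ∑ p ∈ primesBetween F (w + 1) v, g p ≤ (w : ℝ)⁻¹ := by
  refine (Finset.sum_le_sum hg).trans ?_
  rw [sum_primesBetween]
  refine (Finset.sum_le_sum fun d hd => ?_).trans (sum_Ico_inv_mul_pred_le hw v)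
  rw [Finset.mem_Ico] at hd
  have h1 : (w : ℝ) + 1 ≤ d := by exact_mod_cast hd.1
  have h2 : (1 : ℝ) ≤ w := by exact_mod_cast hw
  have hd0 : (0 : ℝ) < d := by linarith
  have hd1 : (0 : ℝ) < (d : ℝ) - 1 := by linarith
  have hq : (0 : ℝ) < (Fintype.card F : ℝ) ^ d := pow_pos (Nat.cast_pos.2 Fintype.card_pos) _
  have hc : (d : ℝ) * (primesOfDegree F d).card ≤ (Fintype.card F : ℝ) ^ d := by
    exact_mod_cast card_primesOfDegree_le F d
  rw [Finset.sum_congr rfl (g := fun _ => ((Fintype.card F : ℝ) ^ d * (d - 1))⁻¹) fun p hp => by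
    rw [polyNorm, (mem_primesOfDegree.1 hp).2.1]]
  rw [Finset.sum_const, nsmul_eq_mul]
  rw [← div_eq_mul_inv, ← one_div, div_le_div_iff₀ (by positivity) (by positivity)]
  nlinarith

variable (F) in
noncomputable def primorialPoly (w : ℕ) : F[X] := ∏ p ∈ primesBetween F 0 (w + 1), p

theorem isCoprime_of_mem_primesBetween {u v : ℕ} {p p' : F[X]} (hp : p ∈ primesBetween F u v)
    (hp' : p' ∈ primesBetween F u v) (hne : p ≠ p') : IsCoprime p p' := by
  obtain ⟨⟨h1, h2⟩, -⟩ := mem_primesBetween.1 hp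
  obtain ⟨⟨h1', h2'⟩, -⟩ := mem_primesBetween.1 hp'
  rw [h2.coprime_iff_not_dvd]
  exact fun hd => hne (eq_of_monic_of_associated h1 h1' (h2.associated_of_dvd h2' hd))

theorem monic_primorialPoly (w : ℕ) : (primorialPoly F w).Monic :=
  monic_prod_of_monic _ _ fun _ hp => (mem_primesBetween.1 hp).1.1

theorem squarefree_primorialPoly (w : ℕ) : Squarefree (primorialPoly F w) :=
  Finset.squarefree_prod_of_pairwise_isCoprime
    (fun _ hp _ hp' hne => (isCoprime_of_mem_primesBetween hp hp' hne).isRelPrime)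
    fun _ hp => (mem_primesBetween.1 hp).1.2.squarefree

theorem dvd_primorialPoly_iff {w : ℕ} {p : F[X]} (hp : p.Monic) (hpi : Irreducible p) :
    p ∣ primorialPoly F w ↔ p.natDegree ≤ w := by
  constructor
  · intro h
    obtain ⟨p', hp', hd⟩ := (hpi.prime.dvd_finsetProd_iff _).1 h
    obtain ⟨⟨h1, h2⟩, -, h3⟩ := mem_primesBetween.1 hp'
    rw [eq_of_monic_of_associated hp h1 (hpi.associated_of_dvd h2 hd)]
    omega
  · intro h
    exact Finset.dvd_prod_of_mem _ (mem_primesBetween.2 ⟨⟨hp, hpi⟩, Nat.zero_le _, by omega⟩)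

theorem exists_isCoprime_primorialPoly {κ : Type*} {h : κ → F[X]}
    (hadm : ∀ p : F[X], p.Monic → Irreducible p → ∃ b, ∀ i, ¬ p ∣ h i - b) (w : ℕ) :
    ∃ a, ∀ i, IsCoprime (a + h i) (primorialPoly F w) := by
  have : ∀ p : primesBetween F 0 (w + 1), ∃ b, ∀ i, ¬ p.1 ∣ h i - b := fun p =>
    hadm p.1 (mem_primesBetween.1 p.2).1.1 (mem_primesBetween.1 p.2).1.2
  choose b hb using this
  obtain ⟨a, ha⟩ := Ideal.exists_forall_sub_mem_ideal
    (I := fun p : primesBetween F 0 (w + 1) => Ideal.span {p.1})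
    (fun p p' hne => by
      rw [Function.onFun, Ideal.isCoprime_span_singleton_iff]
      exact isCoprime_of_mem_primesBetween p.2 p'.2 fun h => hne (Subtype.ext h)) fun p => - b p
  refine ⟨a, fun i => IsCoprime.prod_right fun p hp => ?_⟩
  refine ((mem_primesBetween.1 hp).1.2.coprime_iff_not_dvd.2 fun hd => ?_).symm
  have h1 := Ideal.mem_span_singleton.1 (ha ⟨p, hp⟩)
  have h2 := dvd_sub hd h1
  rw [show a + h i - (a - -b ⟨p, hp⟩) = h i - b ⟨p, hp⟩ by ring] at h2
  exact hb ⟨p, hp⟩ i h2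

open Classical in
theorem card_monics_isCoprime {M : F[X]} (hM : M.Monic) {n : ℕ} (hn : M.natDegree ≤ n) :
    ((monicsOfDegree F n).filter fun f => IsCoprime f M).card =
      polyTotient M * Fintype.card F ^ (n - M.natDegree) := by
  have : NeZero M := ⟨hM.ne_zero⟩
  let := Fintype.ofFinite (F[X] ⧸ Ideal.span {M})ˣ
  have hfib : ∀ f ∈ (monicsOfDegree F n).filter fun f => IsCoprime f M,
      Ideal.Quotient.mk (Ideal.span {M}) f ∈
        Finset.univ.image fun u : (F[X] ⧸ Ideal.span {M})ˣ => (u : F[X] ⧸ Ideal.span {M}) := by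
    intro f hf
    obtain ⟨u, hu⟩ := isUnit_mk_iff_isCoprime.2 (Finset.mem_filter.1 hf).2
    exact Finset.mem_image.2 ⟨u, Finset.mem_univ _, hu⟩
  rw [Finset.card_eq_sum_card_fiberwise hfib,
    Finset.sum_image fun u _ v _ huv => Units.ext huv]
  rw [Finset.sum_congr rfl (g := fun _ => Fintype.card F ^ (n - M.natDegree)), Finset.sum_const,
    Finset.card_univ, smul_eq_mul, ← Nat.card_eq_fintype_card]
  · rfl
  · intro u _
    obtain ⟨c, hc⟩ := Ideal.Quotient.mk_surjective (u : F[X] ⧸ Ideal.span {M})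
    rw [← card_monics_modEq hM c hn, Finset.filter_filter]
    congr 1
    refine Finset.filter_congr fun f _ => ?_
    rw [← isUnit_mk_iff_isCoprime, ← hc, Ideal.Quotient.mk_eq_mk_iff_sub_mem,
      Ideal.mem_span_singleton]
    refine ⟨fun h => h.2, fun h => ⟨?_, h⟩⟩
    have : Ideal.Quotient.mk (Ideal.span {M}) f = Ideal.Quotient.mk (Ideal.span {M}) c := by
      rwa [Ideal.Quotient.mk_eq_mk_iff_sub_mem, Ideal.mem_span_singleton]
    rw [this, hc]
    exact u.isUnit

end SmallPrimes

section BlockSums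

theorem sum_range_mul_eq (f : ℕ → ℝ) (B H : ℕ) :
    ∑ j ∈ Finset.range (B * H), f j =
      ∑ b ∈ Finset.range B, ∑ i ∈ Finset.range H, f (b * H + i) := by
  induction B with
  | zero => simp
  | succ B ih => rw [add_mul, one_mul, Finset.sum_range_add, ih, Finset.sum_range_succ]

theorem sum_inv_succ_sq_le (B : ℕ) :
    ∑ b ∈ Finset.range B, (((b : ℝ) + 1) ^ 2)⁻¹ ≤ 2 := by
  have key : ∑ b ∈ Finset.range (B + 1), (((b : ℝ) + 1) ^ 2)⁻¹ ≤ 2 - ((B : ℝ) + 1)⁻¹ := by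
    induction B with
    | zero => norm_num
    | succ B ih =>
      rw [Finset.sum_range_succ]
      have h0 : (0 : ℝ) < B + 1 := by positivity
      have : (((B : ℝ) + 1 + 1) ^ 2)⁻¹ ≤ ((B : ℝ) + 1)⁻¹ - ((B : ℝ) + 1 + 1)⁻¹ := by
        rw [inv_sub_inv h0.ne' (by positivity), inv_eq_one_div, div_le_div_iff₀ (by positivity)
          (by positivity)]
        nlinarith
      push_cast
      linarith
  rw [Finset.sum_range_succ] at key
  have h1 : (0 : ℝ) ≤ (((B : ℝ) + 1) ^ 2)⁻¹ := by positivity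
  have h2 : (0 : ℝ) ≤ ((B : ℝ) + 1)⁻¹ := by positivity
  linarith

theorem sum_range_ite_lt_le (d H m : ℕ) (hm : 0 ≤ m) :
    ∑ i ∈ Finset.range H, (if m + i < d then (1 : ℝ) else 0) ≤ d := by
  rw [Finset.sum_boole]
  have : (Finset.range H).filter (fun i => m + i < d) ⊆ Finset.range d := fun i hi =>
    Finset.mem_range.2 (by have := (Finset.mem_filter.1 hi).2; omega)
  exact_mod_cast (Finset.card_le_card this).trans_eq (Finset.card_range d)

variable {x : ℕ → ℝ} {t : ℝ} {d H : ℕ}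

theorem block_sum_bounds (h0 : ∀ j, 0 ≤ x j) (h1 : ∀ j, x j ≤ 1) (ht : 0 < t)
    (hx : ∀ j, d ≤ j → x j = t) (hdH : 2 * d ≤ H) (htH : d ≤ t * H) (m : ℕ) :
    t * H / 2 ≤ ∑ i ∈ Finset.range H, x (m + i) ∧
      ∑ i ∈ Finset.range H, x (m + i) ≤ 2 * (t * H) := by
  have hs := sum_range_ite_lt_le d H m (Nat.zero_le m)
  have hd : (2 : ℝ) * d ≤ H := by exact_mod_cast hdH
  constructor
  · have : ∑ i ∈ Finset.range H, (t - t * if m + i < d then (1 : ℝ) else 0) ≤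
        ∑ i ∈ Finset.range H, x (m + i) := by
      refine Finset.sum_le_sum fun i _ => ?_
      split_ifs with h
      · simpa using h0 _
      · rw [hx _ (not_lt.1 h)]; simp
    rw [Finset.sum_sub_distrib, ← Finset.mul_sum, Finset.sum_const, Finset.card_range,
      nsmul_eq_mul] at this
    nlinarith
  · have : ∑ i ∈ Finset.range H, x (m + i) ≤
        ∑ i ∈ Finset.range H, (t + if m + i < d then (1 : ℝ) else 0) := by
      refine Finset.sum_le_sum fun i _ => ?_
      split_ifs with h
      · linarith [h1 (m + i)]
      · rw [hx _ (not_lt.1 h)]; simp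
    rw [Finset.sum_add_distrib, Finset.sum_const, Finset.card_range, nsmul_eq_mul] at this
    linarith

theorem sum_range_mul_div_eq (x : ℕ → ℝ) (g : ℕ → ℝ) (B : ℕ) {H : ℕ} (hH : 0 < H) :
    ∑ j ∈ Finset.range (B * H), x j * g (j / H) =
      ∑ b ∈ Finset.range B, (∑ i ∈ Finset.range H, x (b * H + i)) * g b := by
  rw [sum_range_mul_eq]
  refine Finset.sum_congr rfl fun b _ => ?_
  rw [Finset.sum_mul]
  refine Finset.sum_congr rfl fun i hi => ?_
  rw [mul_comm b H, Nat.mul_add_div hH, Nat.div_eq_of_lt (Finset.mem_range.1 hi), add_zero]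

end BlockSums

section SieveSet

variable (F : Type*) [Field F] [Fintype F]

open Classical in
noncomputable def coprimeMonics (W : F[X]) (N : ℕ) : Finset F[X] :=
  (Finset.range N).biUnion fun j => (monicsOfDegree F j).filter fun f => IsCoprime f W

open Classical in
noncomputable def coprimeDensity (W : F[X]) (j : ℕ) : ℝ :=
  ((monicsOfDegree F j).filter fun f => IsCoprime f W).card / (Fintype.card F : ℝ) ^ j

noncomputable def degreeWeight (H : ℕ) (r : F[X]) : ℝ := ((r.natDegree / H : ℕ) : ℝ) + 1

variable {F}

theorem mem_coprimeMonics {W : F[X]} {N : ℕ} {f : F[X]} :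
    f ∈ coprimeMonics F W N ↔ f.Monic ∧ f.natDegree < N ∧ IsCoprime f W := by
  simp only [coprimeMonics, Finset.mem_biUnion, Finset.mem_range, Finset.mem_filter,
    mem_monicsOfDegree]
  constructor
  · rintro ⟨j, hj, ⟨h1, rfl⟩, h2⟩
    exact ⟨h1, hj, h2⟩
  · rintro ⟨h1, h2, h3⟩
    exact ⟨_, h2, ⟨h1, rfl⟩, h3⟩

theorem card_pos_real : (0 : ℝ) < Fintype.card F := by exact_mod_cast Fintype.card_pos

theorem coprimeDensity_nonneg (W : F[X]) (j : ℕ) : 0 ≤ coprimeDensity F W j := by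
  unfold coprimeDensity; positivity

theorem coprimeDensity_le_one (W : F[X]) (j : ℕ) : coprimeDensity F W j ≤ 1 := by
  classical
  unfold coprimeDensity
  refine div_le_one_of_le₀ ?_ (by positivity)
  have := Finset.card_filter_le (monicsOfDegree F j) fun f => IsCoprime f W
  rw [card_monicsOfDegree] at this
  exact_mod_cast this

theorem coprimeDensity_eq {W : F[X]} (hW : W.Monic) {j : ℕ} (hj : W.natDegree ≤ j) :
    coprimeDensity F W j = polyTotient W / polyNorm W := by
  have hq := card_pos_real (F := F)
  unfold coprimeDensity
  rw [card_monics_isCoprime hW hj, polyNorm, div_eq_div_iff (by positivity) (by positivity)]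
  push_cast
  rw [mul_assoc, ← pow_add, Nat.sub_add_cancel hj]

open Classical in
theorem sum_coprimeMonics (W : F[X]) (N : ℕ) (g : ℕ → ℝ) :
    ∑ r ∈ coprimeMonics F W N, (g r.natDegree * polyNorm r)⁻¹ =
      ∑ j ∈ Finset.range N, coprimeDensity F W j * (g j)⁻¹ := by
  unfold coprimeMonics
  rw [Finset.sum_biUnion]
  · refine Finset.sum_congr rfl fun j _ => ?_
    rw [Finset.sum_congr rfl (g := fun _ => (g j * (Fintype.card F : ℝ) ^ j)⁻¹), Finset.sum_const,
      nsmul_eq_mul, mul_inv, coprimeDensity]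
    · ring
    · intro r hr
      rw [polyNorm, (mem_monicsOfDegree.1 (Finset.mem_filter.1 hr).1).2]
  · intro i _ j _ hij
    refine Finset.disjoint_left.2 fun f hf hf' => hij ?_
    rw [← (mem_monicsOfDegree.1 (Finset.mem_filter.1 hf).1).2,
      (mem_monicsOfDegree.1 (Finset.mem_filter.1 hf').1).2]

theorem sieveData_coprimeMonics (w : ℕ) {B H : ℕ} (hBH : 0 < B * H) :
    SieveData (primesBetween F (w + 1) (B * H)) (coprimeMonics F (primorialPoly F w) (B * H))
      (degreeWeight F H) where
  prime p hp := (mem_primesBetween.1 hp).1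
  monic r hr := (mem_coprimeMonics.1 hr).1
  one_mem := mem_coprimeMonics.2 ⟨monic_one, by simpa using hBH, isCoprime_one_left⟩
  mem_prime r hr p hp hpi hd := by
    obtain ⟨h1, h2, h3⟩ := mem_coprimeMonics.1 hr
    refine mem_primesBetween.2 ⟨⟨hp, hpi⟩, ?_, (natDegree_le_of_dvd hd h1.ne_zero).trans_lt h2⟩
    by_contra hlt
    have : p ∣ primorialPoly F w := (dvd_primorialPoly_iff hp hpi).2 (by omega)
    exact hpi.not_isUnit (h3.isUnit_of_dvd' hd this)
  closed d r hd hr h := by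
    obtain ⟨h1, h2, h3⟩ := mem_coprimeMonics.1 h
    rw [hd.natDegree_mul hr] at h2
    exact mem_coprimeMonics.2 ⟨hr, by omega, h3.of_mul_left_right⟩
  beta_one := by simp [degreeWeight]
  one_le_beta r := by simp [degreeWeight]
  beta_mono d r hd hr := by
    simp only [degreeWeight]
    gcongr
    rw [hd.natDegree_mul hr]
    omega

theorem degreeWeight_le {W : F[X]} {B H : ℕ} {r : F[X]} (hr : r ∈ coprimeMonics F W (B * H)) :
    degreeWeight F H r ≤ B := by
  have := Nat.div_lt_of_lt_mul ((mem_coprimeMonics.1 hr).2.1.trans_eq (mul_comm B H))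
  unfold degreeWeight
  exact_mod_cast this

omit [Fintype F] in
theorem natDegree_le_mul_degreeWeight {H : ℕ} (hH : 0 < H) (r : F[X]) :
    (r.natDegree : ℝ) ≤ H * degreeWeight F H r := by
  have := Nat.lt_mul_div_succ r.natDegree hH
  unfold degreeWeight
  exact_mod_cast this.le

variable {B H : ℕ} {W : F[X]} {t : ℝ}

theorem sum_inv_degreeWeight (W : F[X]) (B : ℕ) (hH : 0 < H) :
    ∑ r ∈ coprimeMonics F W (B * H), (degreeWeight F H r * polyNorm r)⁻¹ =
      ∑ b ∈ Finset.range B, (∑ i ∈ Finset.range H, coprimeDensity F W (b * H + i)) *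
        ((b : ℝ) + 1)⁻¹ := by
  rw [← sum_range_mul_div_eq (coprimeDensity F W) (fun b => ((b : ℝ) + 1)⁻¹) B hH]
  exact sum_coprimeMonics W (B * H) fun j => ((j / H : ℕ) : ℝ) + 1

theorem sum_inv_degreeWeight_sq (W : F[X]) (B : ℕ) (hH : 0 < H) :
    ∑ r ∈ coprimeMonics F W (B * H), (degreeWeight F H r ^ 2 * polyNorm r)⁻¹ =
      ∑ b ∈ Finset.range B, (∑ i ∈ Finset.range H, coprimeDensity F W (b * H + i)) *
        (((b : ℝ) + 1) ^ 2)⁻¹ := by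
  rw [← sum_range_mul_div_eq (coprimeDensity F W) (fun b => (((b : ℝ) + 1) ^ 2)⁻¹) B hH]
  exact sum_coprimeMonics W (B * H) fun j => (((j / H : ℕ) : ℝ) + 1) ^ 2

section Bounds

variable (hW : W.Monic) (ht : polyTotient W / polyNorm W = t) (hdH : 2 * W.natDegree ≤ H)
  (htH : W.natDegree ≤ t * H) (hH : 0 < H)

include hW ht hdH htH

theorem block_coprimeDensity_bounds (m : ℕ) :
    t * H / 2 ≤ ∑ i ∈ Finset.range H, coprimeDensity F W (m + i) ∧
      ∑ i ∈ Finset.range H, coprimeDensity F W (m + i) ≤ 2 * (t * H) := by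
  refine block_sum_bounds (coprimeDensity_nonneg W) (coprimeDensity_le_one W) ?_
    (fun j hj => (coprimeDensity_eq hW hj).trans ht) hdH htH m
  rw [← ht]
  exact div_pos (by exact_mod_cast polyTotient_pos hW.ne_zero) (polyNorm_pos W)

include hH

theorem le_sum_inv_degreeWeight :
    t * H / 2 * ∑ b ∈ Finset.range B, ((b : ℝ) + 1)⁻¹ ≤
      ∑ r ∈ coprimeMonics F W (B * H), (degreeWeight F H r * polyNorm r)⁻¹ := by
  rw [sum_inv_degreeWeight W B hH, Finset.mul_sum]
  gcongr with b
  exact (block_coprimeDensity_bounds hW ht hdH htH _).1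

theorem sum_inv_degreeWeight_le :
    ∑ r ∈ coprimeMonics F W (B * H), (degreeWeight F H r * polyNorm r)⁻¹ ≤
      2 * (t * H) * ∑ b ∈ Finset.range B, ((b : ℝ) + 1)⁻¹ := by
  rw [sum_inv_degreeWeight W B hH, Finset.mul_sum]
  gcongr with b
  exact (block_coprimeDensity_bounds hW ht hdH htH _).2

theorem le_sum_inv_degreeWeight_sq (hB : 0 < B) :
    t * H / 2 ≤
      ∑ r ∈ coprimeMonics F W (B * H), (degreeWeight F H r ^ 2 * polyNorm r)⁻¹ := by
  rw [sum_inv_degreeWeight_sq W B hH]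
  refine le_trans ?_ (Finset.single_le_sum (fun b _ => mul_nonneg
    (Finset.sum_nonneg fun i _ => coprimeDensity_nonneg W _) (by positivity))
    (Finset.mem_range.2 hB))
  simpa using (block_coprimeDensity_bounds hW ht hdH htH 0).1

theorem sum_inv_degreeWeight_sq_le :
    ∑ r ∈ coprimeMonics F W (B * H), (degreeWeight F H r ^ 2 * polyNorm r)⁻¹ ≤
      4 * (t * H) := by
  have h1 : ∑ r ∈ coprimeMonics F W (B * H), (degreeWeight F H r ^ 2 * polyNorm r)⁻¹ ≤
      2 * (t * H) * ∑ b ∈ Finset.range B, (((b : ℝ) + 1) ^ 2)⁻¹ := by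
    rw [sum_inv_degreeWeight_sq W B hH, Finset.mul_sum]
    gcongr with b
    exact (block_coprimeDensity_bounds hW ht hdH htH _).2
  have h2 := sum_inv_succ_sq_le B
  have h3 : 0 ≤ t * H := (Nat.cast_nonneg _).trans htH
  nlinarith

end Bounds

theorem sum_inv_degreeWeight_le_mul (W : F[X]) (B H : ℕ) :
    ∑ r ∈ coprimeMonics F W (B * H), (degreeWeight F H r * polyNorm r)⁻¹ ≤ B * H := by
  have := sum_coprimeMonics W (B * H) fun j => ((j / H : ℕ) : ℝ) + 1
  change ∑ r ∈ coprimeMonics F W (B * H), (degreeWeight F H r * polyNorm r)⁻¹ = _ at this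
  rw [this]
  refine (Finset.sum_le_card_nsmul _ _ 1 fun j _ => ?_).trans_eq (by simp)
  refine mul_le_one₀ (coprimeDensity_le_one W j) (by positivity) (inv_le_one_of_one_le₀ ?_)
  linarith [Nat.cast_nonneg (α := ℝ) (j / H)]

end SieveSet

section Growth

theorem exists_forall_mul_pow_lt_two_pow (c : ℝ) (k : ℕ) :
    ∃ N : ℕ, ∀ n : ℕ, N ≤ n → c * (n : ℝ) ^ k < 2 ^ n := by
  have h := (tendsto_pow_const_div_const_pow_of_one_lt k (one_lt_two (α := ℝ))).const_mul c
  rw [mul_zero] at h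
  obtain ⟨N, hN⟩ := Filter.eventually_atTop.1 (h.eventually_lt_const one_pos)
  refine ⟨N, fun n hn => ?_⟩
  have := hN n hn
  rwa [← mul_div_assoc, div_lt_one (by positivity)] at this

theorem exists_le_sum_inv_succ (C : ℝ) :
    ∃ B : ℕ, 1 ≤ B ∧ C ≤ ∑ b ∈ Finset.range B, ((b : ℝ) + 1)⁻¹ := by
  obtain ⟨B, h1, h2⟩ := ((Real.tendsto_sum_range_one_div_nat_succ_atTop.eventually_ge_atTop C).and
    (Filter.eventually_ge_atTop 1)).exists
  exact ⟨B, h2, by simpa only [one_div] using h1⟩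

theorem sq_le_two_pow {n : ℕ} (hn : 4 ≤ n) : n ^ 2 ≤ 2 ^ n := by
  induction n, hn using Nat.le_induction with
  | base => norm_num
  | succ n hn ih => rw [pow_succ 2 n]; nlinarith

end Growth

section LargePrimes

variable {F : Type*} [Field F] [Fintype F]

theorem two_pow_natDegree_le_polyNorm (p : F[X]) : (2 : ℝ) ^ p.natDegree ≤ polyNorm p := by
  unfold polyNorm
  gcongr
  exact_mod_cast Fintype.one_lt_card (α := F)

theorem natDegree_add_one_le_polyNorm (p : F[X]) : (p.natDegree : ℝ) + 1 ≤ polyNorm p :=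
  le_trans (by exact_mod_cast Nat.lt_two_pow_self) (two_pow_natDegree_le_polyNorm p)

theorem sum_inv_sq_mul_polyNorm_le {w : ℕ} (hw : 1 ≤ w) (v : ℕ) :
    ∑ p ∈ primesBetween F (w + 1) v, ((p.natDegree : ℝ) ^ 2 * polyNorm p)⁻¹ ≤ (w : ℝ)⁻¹ := by
  refine sum_primesBetween_le hw v fun p hp => ?_
  have h1 : ((w + 1 : ℕ) : ℝ) ≤ p.natDegree := by exact_mod_cast (mem_primesBetween.1 hp).2.1
  have h2 : (1 : ℝ) ≤ w := by exact_mod_cast hw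
  push_cast at h1
  have h3 := polyNorm_pos p
  rw [mul_comm]
  refine inv_anti₀ (mul_pos h3 (by linarith)) ?_
  gcongr
  nlinarith

theorem sum_inv_polyNorm_sq_le {w : ℕ} (hw : 1 ≤ w) (v : ℕ) :
    ∑ p ∈ primesBetween F (w + 1) v, (polyNorm (p ^ 2))⁻¹ ≤ (w : ℝ)⁻¹ := by
  refine sum_primesBetween_le hw v fun p hp => ?_
  obtain ⟨⟨hp1, -⟩, h1, -⟩ := mem_primesBetween.1 hp
  have h1 : ((w + 1 : ℕ) : ℝ) ≤ p.natDegree := by exact_mod_cast h1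
  have h2 : (1 : ℝ) ≤ w := by exact_mod_cast hw
  push_cast at h1
  have h3 := polyNorm_pos p
  have h4 := natDegree_add_one_le_polyNorm p
  rw [sq, polyNorm_mul hp1.ne_zero hp1.ne_zero]
  refine inv_anti₀ (mul_pos h3 (by linarith)) ?_
  gcongr
  linarith

theorem one_le_inv_mul_two_mul_polyNorm_sq {p : F[X]} (hp : 4 ≤ p.natDegree) :
    1 ≤ ((p.natDegree : ℝ) ^ 2 * polyNorm p)⁻¹ * (2 * polyNorm p ^ 2) := by
  have h3 := polyNorm_pos p
  have h1 : (0 : ℝ) < p.natDegree := by exact_mod_cast (by omega : 0 < p.natDegree)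
  rw [inv_mul_eq_div, one_le_div (by positivity)]
  have h2 : (p.natDegree : ℝ) ^ 2 ≤ polyNorm p :=
    le_trans (by exact_mod_cast sq_le_two_pow hp) (two_pow_natDegree_le_polyNorm p)
  nlinarith

theorem sieve_error_lt {k d n : ℕ} {Z : ℝ} {W : F[X]} (hd : W.natDegree = d) (hZ0 : 0 ≤ Z)
    (hZ : Z ≤ n) (hdn : d ≤ n) (hn : (43 * k : ℝ) * n ^ (2 * k + 1) < 2 ^ n) :
    (k : ℝ) * ((W.natDegree + 2 * n + 2 * (20 * n : ℕ)) * (Fintype.card F : ℝ) ^ (20 * n) *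
      ((Fintype.card F : ℝ) ^ (2 * n) * Z ^ k) ^ 2) * polyNorm W <
      (Fintype.card F : ℝ) ^ (2 * (20 * n)) := by
  set q : ℝ := (Fintype.card F : ℝ) with hq
  have hq2 : 2 ≤ q := by rw [hq]; exact_mod_cast Fintype.one_lt_card (α := F)
  have hd' : (d : ℝ) ≤ n := by exact_mod_cast hdn
  have hW : polyNorm W ≤ q ^ n := by
    unfold polyNorm
    exact pow_le_pow_right₀ (by linarith) (hd ▸ hdn)
  have hqn : 2 ^ n ≤ q ^ (15 * n) :=
    (pow_le_pow_left₀ (by norm_num) hq2 n).trans (pow_le_pow_right₀ (by linarith) (by omega))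
  have hW0 := (polyNorm_pos W).le
  rw [hd]
  calc (k : ℝ) * ((d + 2 * n + 2 * (20 * n : ℕ)) * q ^ (20 * n) *
        (q ^ (2 * n) * Z ^ k) ^ 2) * polyNorm W
      ≤ (k : ℝ) * ((43 * n) * q ^ (20 * n) * (q ^ (2 * n) * (n : ℝ) ^ k) ^ 2) * q ^ n := by
        gcongr
        push_cast
        linarith
    _ = ((43 * k : ℝ) * n ^ (2 * k + 1)) * q ^ (25 * n) := by ring
    _ < q ^ (15 * n) * q ^ (25 * n) := by
        have : 0 < q ^ (25 * n) := by positivity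
        gcongr
        exact hn.trans_le hqn
    _ = q ^ (2 * (20 * n)) := by ring

end LargePrimes

theorem sieve_parameters_main_le {m L B S t H P Z V e : ℝ} (hm : 1 ≤ m) (hB : 1 ≤ B) (hS : 1 ≤ S)
    (htH : 0 < t * H) (hP : 0 < P) (hmS : 43520 * m ≤ S) (hL : L ≤ 33 * (B * S))
    (hZ : t * H / 2 * S ≤ Z) (hV : V ≤ 4 * (t * H)) (ht : 0 < t) (he : 0 ≤ e)
    (heH : e = 20 * (L * H)) :
    2 * m * (2 * e * (t * P)) * V ≤ B * Z ^ 2 * P := by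
  have hZ0 : 0 ≤ t * H / 2 * S := by positivity
  have hZsq := pow_le_pow_left₀ hZ0 hZ 2
  have key : 1280 * m * L ≤ B * S ^ 2 := by
    have h1 : m * L ≤ m * (33 * (B * S)) := by gcongr
    have h2 : (B * S) * (43520 * m) ≤ (B * S) * S := by gcongr
    have h3 : 0 ≤ (B * S) * m := by positivity
    nlinarith
  calc _ ≤ 2 * m * (2 * e * (t * P)) * (4 * (t * H)) := by gcongr
    _ = 1280 * m * L * ((t * H) ^ 2 / 4 * P) := by rw [heH]; ring
    _ ≤ B * S ^ 2 * ((t * H) ^ 2 / 4 * P) := by gcongr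
    _ = B * (t * H / 2 * S) ^ 2 * P := by ring
    _ ≤ _ := by gcongr

section SieveChoice

variable {F : Type*} [Field F] [Fintype F] {B m : ℕ} {h : Fin B → F[X]}

theorem isSieveProblem_primesBetween {w v : ℕ} {a : F[X]} (hinj : Function.Injective h)
    (hw : ∀ i j, (h i - h j).natDegree ≤ w)
    (ha : ∀ i, IsCoprime (a + h i) (primorialPoly F w)) :
    IsSieveProblem (primesBetween F (w + 1) v) (primorialPoly F w) a h where
  prime p hp := (mem_primesBetween.1 hp).1
  monic := monic_primorialPoly w
  squarefree := squarefree_primorialPoly w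
  not_dvd p hp hd := by
    obtain ⟨⟨h1, h2⟩, h3, -⟩ := mem_primesBetween.1 hp
    have := (dvd_primorialPoly_iff h1 h2).1 hd
    omega
  not_dvd_sub p hp i j hij hd := by
    have h1 := natDegree_le_of_dvd hd (sub_ne_zero.2 fun he => hij (hinj he))
    have h2 := (mem_primesBetween.1 hp).2.1
    have h3 := hw i j
    omega
  coprime := ha

open Classical in
theorem exists_monic_many_irreducible (hm : 1 ≤ m) (hB : 1 ≤ B)
    (hharm : 43520 * (m : ℝ) ≤ ∑ b ∈ Finset.range B, ((b : ℝ) + 1)⁻¹)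
    (hinj : Function.Injective h)
    (hadm : ∀ p : F[X], p.Monic → Irreducible p → ∃ b, ∀ i, ¬ p ∣ h i - b) (N : ℕ) :
    ∃ f : F[X], f.Monic ∧ N < f.natDegree ∧ (∀ i, (h i).natDegree < f.natDegree) ∧
      m ≤ (Finset.univ.filter fun i => Irreducible (f + h i)).card := by
  set S : ℝ := ∑ b ∈ Finset.range B, ((b : ℝ) + 1)⁻¹ with hS
  have hm' : (1 : ℝ) ≤ m := by exact_mod_cast hm
  have hB' : (1 : ℝ) ≤ B := by exact_mod_cast hB
  have hS1 : 1 ≤ S := by linarith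
  obtain ⟨w, hw⟩ : ∃ w : ℕ, 8 + 112 * B ^ 2 + ∑ i, ∑ j, (h i - h j).natDegree ≤ w := ⟨_, le_rfl⟩
  have hw1 : 8 ≤ w := by omega
  have hw2 : 112 * B ^ 2 ≤ w := by omega
  have hwh : ∀ i j, (h i - h j).natDegree ≤ w := fun i j => by
    have h1 := Finset.single_le_sum (f := fun j => (h i - h j).natDegree)
      (fun _ _ => Nat.zero_le _) (Finset.mem_univ j)
    have h2 := Finset.single_le_sum (f := fun i => ∑ j, (h i - h j).natDegree)
      (fun _ _ => Nat.zero_le _) (Finset.mem_univ i)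
    omega
  obtain ⟨a, ha⟩ := exists_isCoprime_primorialPoly hadm w
  have sp := fun v => isSieveProblem_primesBetween (v := v) hinj hwh ha
  have sd := fun H => sieveData_coprimeMonics (F := F) w (B := B) (H := H)
  have hW : (primorialPoly F w).Monic := monic_primorialPoly w
  generalize primorialPoly F w = W at sp sd hW
  obtain ⟨t, ht⟩ : ∃ t : ℝ, polyTotient W / polyNorm W = t := ⟨_, rfl⟩
  have hWpos := polyNorm_pos W
  have ht0 : 0 < t := by
    rw [← ht]
    exact div_pos (by exact_mod_cast polyTotient_pos hW.ne_zero) hWpos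
  obtain ⟨L, hL⟩ : ∃ L : ℕ, L = B + 16 * B * ⌈S⌉₊ := ⟨_, rfl⟩
  have hBL : B ≤ L := by omega
  obtain ⟨N₀, hN₀⟩ := exists_forall_mul_pow_lt_two_pow (43 * B) (2 * B + 1)
  obtain ⟨H, hH⟩ : ∃ H : ℕ, 1 + 2 * W.natDegree + ⌈W.natDegree / t⌉₊ + N₀ + N +
    ∑ i, (h i).natDegree ≤ H := ⟨_, le_rfl⟩
  have hH0 : 0 < H := by omega
  have hdH : 2 * W.natDegree ≤ H := by omega
  have htH : W.natDegree ≤ t * H := by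
    have h1 : W.natDegree / t ≤ H := (Nat.le_ceil _).trans (by exact_mod_cast (by omega))
    rwa [div_le_iff₀ ht0, mul_comm] at h1
  have hhH : ∀ i, (h i).natDegree < H := fun i => by
    have := Finset.single_le_sum (f := fun i => (h i).natDegree)
      (fun _ _ => Nat.zero_le _) (Finset.mem_univ i)
    omega
  obtain ⟨n, hn⟩ : ∃ n : ℕ, n = L * H := ⟨_, rfl⟩
  have hHn : H ≤ n := hn ▸ Nat.le_mul_of_pos_left H (by omega)
  have hBHn : B * H ≤ n := hn ▸ Nat.mul_le_mul_right H hBL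
  have hQ : ∀ p ∈ primesBetween F (w + 1) (B * H), w + 1 ≤ p.natDegree ∧ p.natDegree < B * H :=
    fun p hp => (mem_primesBetween.1 hp).2
  have hQP : ∀ p ∈ primesBetween F (w + 1) (B * H), (w : ℝ) ≤ polyNorm p := fun p hp => by
    have h1 : ((w + 1 : ℕ) : ℝ) ≤ p.natDegree := by exact_mod_cast (hQ p hp).1
    push_cast at h1
    linarith [natDegree_add_one_le_polyNorm p]
  have hw1' : (8 : ℝ) ≤ w := by exact_mod_cast hw1
  have hw2' : 112 * (B : ℝ) ^ 2 ≤ w := by exact_mod_cast hw2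
  have hw0 : (0 : ℝ) < w := by linarith
  have hZ1 := le_sum_inv_degreeWeight (B := B) hW ht hdH htH hH0
  have hZ2 := sum_inv_degreeWeight_le (B := B) hW ht hdH htH hH0
  have hZ3 := sum_inv_degreeWeight_le_mul W B H
  have hV1 := le_sum_inv_degreeWeight_sq (B := B) hW ht hdH htH hH0 (by omega)
  have hV2 := sum_inv_degreeWeight_sq_le (B := B) hW ht hdH htH hH0
  rw [← hS] at hZ1 hZ2
  have htH0 : 0 < t * H := mul_pos ht0 (by exact_mod_cast hH0)
  have hceil := Nat.le_ceil S
  have hceil' := (Nat.ceil_lt_add_one (by linarith : 0 ≤ S)).le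
  have hLr : (L : ℝ) = B + 16 * B * ⌈S⌉₊ := by exact_mod_cast hL
  have hLS : (L : ℝ) ≤ 33 * (B * S) := by
    rw [hLr]
    nlinarith
  obtain ⟨f, hf, hcard⟩ := exists_many_irreducible (κ := Fin B) (M := m)
    (sp (B * H)) (sd H (Nat.mul_pos (by omega) hH0))
    (L := L) (H := H) (n₀ := n) (e := 20 * n) (B := B) (c := 4 * S)
    (ε := fun p => ((p.1.natDegree : ℝ) ^ 2 * polyNorm p.1)⁻¹)
    hm (by simpa using (by omega : 0 < B)) (fun p hp => by linarith [hQP p hp])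
    (fun p hp => by
      rw [Fintype.card_fin]
      refine le_trans ?_ (hQP p hp)
      nlinarith)
    (fun p hp => by have := hQ p hp; omega) (fun i => by have := hhH i; omega)
    (fun p => inv_nonneg.2 (mul_nonneg (by positivity) (polyNorm_pos _).le))
    (fun p => by
      have h1 : ((w + 1 : ℕ) : ℝ) ≤ p.1.natDegree := by exact_mod_cast (hQ p.1 p.2).1
      push_cast at h1
      have h2 := hQP p.1 p.2
      refine inv_le_one_of_one_le₀ (one_le_mul_of_one_le_of_one_le (one_le_pow₀ ?_) ?_) <;>
        linarith)
    (fun p => one_le_inv_mul_two_mul_polyNorm_sq (by have := hQ p.1 p.2; omega))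
    (by
      rw [Finset.sum_coe_sort (primesBetween F (w + 1) (B * H))
        fun p => ((p.natDegree : ℝ) ^ 2 * polyNorm p)⁻¹]
      refine (sum_inv_sq_mul_polyNorm_le (by omega) _).trans ?_
      rw [one_div]
      exact inv_anti₀ (by norm_num) hw1')
    (by
      rw [Fintype.card_fin]
      have h1 := sum_inv_polyNorm_sq_le (F := F) (w := w) (by omega) (B * H)
      have h2 : 14 * (B : ℝ) ^ 2 * (w : ℝ)⁻¹ ≤ 1 / 8 := by
        rw [← div_eq_mul_inv, div_le_iff₀ hw0]
        linarith
      exact (mul_le_mul_of_nonneg_left h1 (by positivity)).trans h2)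
    (fun r hr => degreeWeight_le hr) (fun r _ => natDegree_le_mul_degreeWeight hH0 r)
    hn.ge (by omega) (by omega) (by linarith)
    (by
      rw [Fintype.card_fin, hLr]
      nlinarith)
    (by
      refine hZ2.trans ?_
      nlinarith)
    (by
      rw [Fintype.card_fin, (div_eq_iff hWpos.ne').1 ht]
      refine sieve_parameters_main_le hm' hB' hS1 htH0 hWpos hharm hLS hZ1 hV2 ht0
        (Nat.cast_nonneg _) ?_
      rw [hn]
      push_cast
      ring)
    (by
      rw [Fintype.card_fin]
      refine sieve_error_lt rfl ?_ (hZ3.trans (by exact_mod_cast hBHn)) (by omega)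
        (hN₀ n (by omega))
      exact le_trans (by positivity) hZ1)
  obtain ⟨hf1, hf2⟩ := mem_monicsOfDegree.1 hf
  exact ⟨f, hf1, by omega, fun i => by have := hhH i; omega, hcard⟩

end SieveChoice

theorem stmt2 (m : ℕ) (hm : 2 ≤ m) :
    ∃ k₀ : ℕ, ∀ (F : Type) [Field F] [Fintype F], ∀ k : ℕ, k₀ ≤ k →
      ∀ h : Fin k → Polynomial F, AdmissibleTuple h →
        ∀ N : ℕ, ∃ f : Polynomial F, N < f.natDegree ∧
          m ≤ {i : Fin k | IsPrimePoly (f + h i)}.ncard := by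
  classical
  obtain ⟨B, hB, hharm⟩ := exists_le_sum_inv_succ (43520 * (m : ℝ))
  refine ⟨B, fun F _ _ k hk h hadm N => ?_⟩
  obtain ⟨f, hf, hN, hdeg, hcard⟩ := exists_monic_many_irreducible (h := h ∘ Fin.castLE hk)
    (by omega) hB hharm (hadm.1.comp (Fin.castLE_injective hk))
    (fun p hp hpi => by
      obtain ⟨r, hr⟩ := hadm.2 p ⟨hp, hpi⟩
      obtain ⟨b, rfl⟩ := Ideal.Quotient.mk_surjective r
      refine ⟨b, fun i hd => hr (Fin.castLE hk i) ?_⟩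
      rwa [Ideal.Quotient.mk_eq_mk_iff_sub_mem, Ideal.mem_span_singleton]) N
  refine ⟨f, hN, hcard.trans ?_⟩
  rw [← Finset.card_image_of_injective _ (Fin.castLE_injective hk), ← Set.ncard_coe_finset]
  refine Set.ncard_le_ncard (fun i hi => ?_) (Set.toFinite _)
  obtain ⟨j, hj, rfl⟩ := Finset.mem_image.1 (Finset.mem_coe.1 hi)
  exact ⟨hf.add_of_left (degree_lt_degree (hdeg j)), (Finset.mem_filter.1 hj).2⟩
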